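/- Let ω₀ ∈ C²(ℝ²) have compact support and let Ω ∈ ℝ. Suppose that for every c ∈ ℝ such that ∇ω₀(x) ≠ 0 for all x ∈ ω₀⁻¹({c}) (i.e. c is a regular value of ω₀), the function N*ω₀ + (Ω/2)|x|² is constant on each connected component of the level set ω₀⁻¹({c}) (the constant may differ between components). If Ω ≤ (1/2)·min_{ℝ²} ω₀ or Ω ≥ (1/2)·max_{ℝ²} ω₀, then ω₀ is radially symmetric: if Ω ≠ 0 then ω₀ is a function of |x|, and if Ω = 0 then there exists a ∈ ℝ² such that ω₀ is a function of |x − a|. -/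

import Mathlib

open MeasureTheory Metric Set Filter

noncomputable section

/-- The plane `ℝ²`. -/
abbrev E2 : Type := EuclideanSpace ℝ (Fin 2)

/-- The Newtonian potential `N(x) = (1/(2π)) log(1/|x|)` on `ℝ²`. -/
def NewtonianPotential (x : E2) : ℝ := (1 / (2 * Real.pi)) * Real.log (1 / ‖x‖)

/-- The convolution `(N * ω)(x) = ∫ N(x-y) ω(y) dy`. -/
def newtonConv (ω : E2 → ℝ) (x : E2) : ℝ := ∫ y, NewtonianPotential (x - y) * ω y

lemma i_add {α : Type*} [MeasurableSpace α] {μ : Measure α} {f g : α → ℝ} (hf : Integrable f μ) (hg : Integrable g μ) :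
    Integrable (fun x => f x + g x) μ := hf.add hg

lemma i_sub {α : Type*} [MeasurableSpace α] {μ : Measure α} {f g : α → ℝ} (hf : Integrable f μ) (hg : Integrable g μ) :
    Integrable (fun x => f x - g x) μ := hf.sub hg

/-- Partial derivative. -/
def pd (i : Fin 2) (φ : E2 → ℝ) (x : E2) : ℝ := fderiv ℝ φ x (EuclideanSpace.single i 1)

lemma e2_eq (v : E2) : v = v 0 • EuclideanSpace.single 0 (1:ℝ) + v 1 • EuclideanSpace.single 1 (1:ℝ) := by
  ext i; fin_cases i <;> simp

lemma clm_e2 (L : E2 →L[ℝ] ℝ) (v : E2) :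
    L v = v 0 * L (EuclideanSpace.single 0 1) + v 1 * L (EuclideanSpace.single 1 1) := by
  conv_lhs => rw [e2_eq v]
  simp

lemma fderiv_e2 (φ : E2 → ℝ) (x v : E2) :
    fderiv ℝ φ x v = v 0 * pd 0 φ x + v 1 * pd 1 φ x := clm_e2 _ _

lemma normsq_e2 (v : E2) : ‖v‖ ^ 2 = v 0 ^ 2 + v 1 ^ 2 := by
  rw [EuclideanSpace.norm_sq_eq]; simp

lemma abs_coord_le (v : E2) (i : Fin 2) : |v i| ≤ ‖v‖ := by
  simpa using PiLp.norm_apply_le v i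

lemma integral_fderiv_zero {φ : E2 → ℝ} (h : ContDiff ℝ 1 φ) (hc : HasCompactSupport φ) (v : E2) :
    ∫ x, fderiv ℝ φ x v = 0 := by
  have hd : Integrable (fun x => fderiv ℝ φ x v) := by
    refine Continuous.integrable_of_hasCompactSupport ?_ ?_
    · exact (h.continuous_fderiv (by norm_num)).clm_apply continuous_const
    · exact hc.fderiv_apply (𝕜 := ℝ) v
  have := integral_mul_fderiv_eq_neg_fderiv_mul_of_integrable (μ := volume) (f := fun _ : E2 => (1:ℝ)) (g := φ) (v := v)
    (by simp) (by simpa using hd) (by simpa using h.continuous.integrable_of_hasCompactSupport hc)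
    (by simp) (by intro x _; exact h.differentiable (by norm_num) x)
  simpa using this

lemma integral_pd_zero {φ : E2 → ℝ} (h : ContDiff ℝ 1 φ) (hc : HasCompactSupport φ) (i : Fin 2) :
    ∫ x, pd i φ x = 0 := integral_fderiv_zero h hc _

/-- polar coordinates in `E2` -/
lemma polarE2 (F : E2 → ℝ) :
    ∫ x, F x = ∫ p in (Ioi (0:ℝ)) ×ˢ (Ioo (-Real.pi) Real.pi), p.1 * F (!₂[p.1 * Real.cos p.2, p.1 * Real.sin p.2]) := by
  have h1 : ∫ x, F x = ∫ p : ℝ × ℝ, F (!₂[p.1, p.2]) := by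
    have hm := ((volume_preserving_finTwoArrow ℝ).symm.trans (EuclideanSpace.volume_preserving_symm_measurableEquiv_toLp (Fin 2)).symm)
    rw [← hm.integral_comp']
    congr 1 with p
  rw [h1, ← integral_comp_polarCoord_symm]
  simp [polarCoord]

lemma locInt_of_le {F : E2 → ℝ} {C : ℝ} (hm : AEStronglyMeasurable F)
    (h : ∀ z, |F z| ≤ C * ‖z‖⁻¹) : LocallyIntegrable F := by
  exact locallyIntegrable_of_norm_le_rpow (E := E2) (μ := volume) (f := F) (C := C) (α := 1) (by simp) (by simp)
    (by filter_upwards with x; simpa [Real.rpow_neg_one] using h x) hm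

/-- Key polar identity. -/
lemma polar_key {φ : E2 → ℝ} (h : ContDiff ℝ 1 φ) (hc : HasCompactSupport φ) :
    ∫ z, fderiv ℝ φ z z / ‖z‖ ^ 2 = - (2 * Real.pi * φ 0) := by
  rw [polarE2]
  set σ : ℝ → E2 := fun θ => !₂[Real.cos θ, Real.sin θ] with hσ
  have hσn : ∀ θ, ‖σ θ‖ = 1 := by
    intro θ
    have : ‖σ θ‖ ^ 2 = 1 := by rw [normsq_e2]; simp [hσ]
    nlinarith [norm_nonneg (σ θ)]
  have hσc : Continuous σ := by
    simp only [hσ]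
    refine (PiLp.continuous_toLp 2 _).comp ?_
    refine continuous_pi fun i => ?_
    fin_cases i <;> simp <;> fun_prop
  have h1 : ∀ p ∈ (Ioi (0:ℝ)) ×ˢ (Ioo (-Real.pi) Real.pi),
      p.1 * (fderiv ℝ φ (!₂[p.1 * Real.cos p.2, p.1 * Real.sin p.2]) (!₂[p.1 * Real.cos p.2, p.1 * Real.sin p.2])
        / ‖(!₂[p.1 * Real.cos p.2, p.1 * Real.sin p.2] : E2)‖ ^ 2) = fderiv ℝ φ (p.1 • σ p.2) (σ p.2) := by
    rintro ⟨r, θ⟩ ⟨hr, -⟩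
    have hr0 : (0:ℝ) < r := hr
    have e : (!₂[r * Real.cos θ, r * Real.sin θ] : E2) = r • σ θ := by
      ext i; fin_cases i <;> simp [hσ]
    simp only [e, norm_smul, hσn, map_smul, smul_eq_mul]
    rw [Real.norm_eq_abs, abs_of_pos hr0]
    field_simp
  rw [setIntegral_congr_fun (measurableSet_Ioi.prod measurableSet_Ioo) h1]
  obtain ⟨R, hR0, hR⟩ := hc.isCompact.isBounded.exists_pos_norm_lt
  have hz : ∀ r θ, R ≤ r → fderiv ℝ φ (r • σ θ) = 0 := by
    intro r θ hr
    by_contra hne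
    have := hR _ (support_fderiv_subset ℝ hne)
    rw [norm_smul, hσn, Real.norm_eq_abs, abs_of_pos (by linarith)] at this
    linarith
  have hcont : Continuous (fun p : ℝ × ℝ => fderiv ℝ φ (p.1 • σ p.2) (σ p.2)) := by
    have := h.continuous_fderiv (by norm_num)
    fun_prop
  have hInteg : IntegrableOn (fun p : ℝ × ℝ => fderiv ℝ φ (p.1 • σ p.2) (σ p.2))
      ((Ioi (0:ℝ)) ×ˢ (Ioo (-Real.pi) Real.pi)) (volume.prod volume) := by
    have h2 : IntegrableOn (fun p : ℝ × ℝ => fderiv ℝ φ (p.1 • σ p.2) (σ p.2))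
      ((Icc (0:ℝ) R) ×ˢ (Icc (-Real.pi) Real.pi)) (volume.prod volume) :=
      hcont.continuousOn.integrableOn_compact (isCompact_Icc.prod isCompact_Icc)
    refine IntegrableOn.of_forall_sdiff_eq_zero h2 (measurableSet_Ioi.prod measurableSet_Ioo) ?_
    rintro ⟨r, θ⟩ ⟨⟨hr, hθ⟩, hn⟩
    have : R ≤ r := by
      by_contra hlt
      exact hn ⟨⟨le_of_lt hr, by simpa using (not_le.mp hlt).le⟩, ⟨hθ.1.le, hθ.2.le⟩⟩
    simp [hz r θ this]
  rw [Measure.volume_eq_prod, setIntegral_prod _ hInteg, integral_integral_swap]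
  swap
  · rw [Measure.prod_restrict]; exact hInteg
  have hin : ∀ θ, ∫ r in Ioi (0:ℝ), fderiv ℝ φ (r • σ θ) (σ θ) = - φ 0 := by
    intro θ
    have := integral_Ioi_of_hasDerivAt_of_tendsto (a := (0:ℝ)) (f := fun r : ℝ => φ (r • σ θ))
      (f' := fun r => fderiv ℝ φ (r • σ θ) (σ θ)) (m := 0) ?_ ?_ ?_ ?_
    · rw [this]; simp
    · exact Continuous.continuousWithinAt (by have := h.continuous; fun_prop)
    · intro r _
      have h3 := (h.differentiable (by norm_num) (r • σ θ)).hasFDerivAt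
      have h4 : HasDerivAt (fun r : ℝ => r • σ θ) (σ θ) r := by simpa using (hasDerivAt_id r).smul_const (σ θ)
      exact h3.comp_hasDerivAt r h4
    · have hcc : Continuous (fun r : ℝ => fderiv ℝ φ (r • σ θ) (σ θ)) := by
        have := h.continuous_fderiv (by norm_num)
        fun_prop
      refine IntegrableOn.of_forall_sdiff_eq_zero (hcc.continuousOn.integrableOn_compact (isCompact_Icc (a := 0) (b := R))) measurableSet_Ioi ?_
      rintro r ⟨hr, hn⟩
      have : R ≤ r := by
        by_contra hlt
        exact hn ⟨le_of_lt hr, (not_le.mp hlt).le⟩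
      simp [hz r θ this]
    · refine tendsto_const_nhds.congr' ?_
      filter_upwards [eventually_ge_atTop R] with r hr
      by_contra hne
      have := hR (r • σ θ) (subset_tsupport _ (Ne.symm hne))
      rw [norm_smul, hσn, Real.norm_eq_abs, abs_of_pos (by linarith)] at this
      linarith
  simp only [hin]
  simp
  rw [max_eq_left (by linarith [Real.pi_pos])]
  left; ring

/-- convolution -/
def cv (k ψ : E2 → ℝ) (x : E2) : ℝ := ∫ z, k z * ψ (x - z)

/-- kernel -/
def Kk (i : Fin 2) (z : E2) : ℝ := z i / ‖z‖ ^ 2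

lemma Kk_le (i : Fin 2) (z : E2) : |Kk i z| ≤ ‖z‖⁻¹ := by
  unfold Kk
  rw [abs_div, abs_of_nonneg (sq_nonneg ‖z‖)]
  rcases eq_or_ne z 0 with rfl | hz
  · simp
  · have : 0 < ‖z‖ := norm_pos_iff.mpr hz
    rw [div_le_iff₀ (by positivity)]
    calc |z i| ≤ ‖z‖ := abs_coord_le z i
      _ = _ := by field_simp

lemma coord_meas (i : Fin 2) : Measurable (fun z : E2 => z i) := by
  have : Continuous (fun z : E2 => z i) := by fun_prop
  exact this.measurable

lemma Kk_meas (i : Fin 2) : Measurable (Kk i) := by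
  unfold Kk
  exact (coord_meas i).div (measurable_norm.pow_const 2)

lemma Kk_locInt (i : Fin 2) : LocallyIntegrable (Kk i) :=
  locInt_of_le (C := 1) (Kk_meas i).aestronglyMeasurable (by simpa using Kk_le i)

lemma inv_locInt : LocallyIntegrable (fun z : E2 => ‖z‖⁻¹) :=
  locInt_of_le (C := 1) (measurable_norm.inv).aestronglyMeasurable (by intro z; simp)

/-- log kernel -/
def lk (z : E2) : ℝ := Real.log ‖z‖

lemma abs_log_le_of_pos (r : ℝ) (hr : 0 ≤ r) : |Real.log r| ≤ r⁻¹ + r := by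
  rcases hr.eq_or_lt with rfl | hr
  · simp
  have h1 : Real.log r ≤ r := by linarith [Real.log_le_sub_one_of_pos hr]
  have h2 : Real.log r⁻¹ ≤ r⁻¹ := by linarith [Real.log_le_sub_one_of_pos (inv_pos.mpr hr)]
  rw [Real.log_inv] at h2
  have := inv_pos.mpr hr
  rw [abs_le]; constructor <;> linarith

lemma lk_meas : Measurable lk := Real.measurable_log.comp measurable_norm

lemma lk_locInt : LocallyIntegrable lk := by
  refine LocallyIntegrable.mono (inv_locInt.add (continuous_norm (E := E2)).locallyIntegrable) lk_meas.aestronglyMeasurable ?_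
  filter_upwards with z
  rw [Real.norm_eq_abs, Real.norm_eq_abs]
  refine (abs_log_le_of_pos _ (norm_nonneg z)).trans (le_abs_self _)

lemma lk_abs_locInt : LocallyIntegrable (fun z => |lk z|) :=
  lk_locInt.mono lk_meas.abs.aestronglyMeasurable (by simp)

lemma locInt_mul {k ψ : E2 → ℝ} (hk : LocallyIntegrable k) (hψ : Continuous ψ) (hc : HasCompactSupport ψ) :
    Integrable (fun z => k z * ψ z) := by
  have := hk.integrable_smul_left_of_hasCompactSupport hψ hc
  refine this.congr ?_
  filter_upwards with x
  simp [mul_comm]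

lemma hcs_sub {ψ : E2 → ℝ} (hc : HasCompactSupport ψ) (x : E2) : HasCompactSupport (fun z => ψ (x - z)) :=
  hc.comp_homeomorph (Homeomorph.subLeft x)

lemma cv_integrable {k ψ : E2 → ℝ} (hk : LocallyIntegrable k) (hψ : Continuous ψ) (hc : HasCompactSupport ψ) (x : E2) :
    Integrable (fun z => k z * ψ (x - z)) :=
  locInt_mul hk (ψ := fun z => ψ (x - z)) (by fun_prop) (hcs_sub hc x)

lemma cv_eq (k ψ : E2 → ℝ) : cv k ψ = MeasureTheory.convolution k ψ (ContinuousLinearMap.mul ℝ ℝ) volume := by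
  ext x; simp [cv, convolution_def]

lemma cv_contDiff {k ψ : E2 → ℝ} (hk : LocallyIntegrable k) (n : ℕ∞) (hψ : ContDiff ℝ n ψ) (hc : HasCompactSupport ψ) :
    ContDiff ℝ n (cv k ψ) := by
  rw [cv_eq]
  exact hc.contDiff_convolution_right _ hk hψ

lemma pd_cont {ψ : E2 → ℝ} (hψ : ContDiff ℝ 1 ψ) (i : Fin 2) : Continuous (pd i ψ) :=
  (hψ.continuous_fderiv (by norm_num)).clm_apply continuous_const

lemma pd_contDiff {ψ : E2 → ℝ} (hψ : ContDiff ℝ 2 ψ) (i : Fin 2) : ContDiff ℝ 1 (pd i ψ) := by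
  unfold pd
  exact (hψ.fderiv_right (m := 1) (by norm_num)).clm_apply contDiff_const

lemma pd_hcs {ψ : E2 → ℝ} (hc : HasCompactSupport ψ) (i : Fin 2) : HasCompactSupport (pd i ψ) :=
  hc.fderiv_apply (𝕜 := ℝ) _

lemma cv_pd {k ψ : E2 → ℝ} (hk : LocallyIntegrable k) (hψ : ContDiff ℝ 1 ψ) (hc : HasCompactSupport ψ) (i : Fin 2) (x : E2) :
    pd i (cv k ψ) x = cv k (pd i ψ) x := by
  have h := hc.hasFDerivAt_convolution_right (ContinuousLinearMap.mul ℝ ℝ) hk hψ x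
  rw [← cv_eq] at h
  unfold pd
  rw [h.fderiv, convolution_def, ContinuousLinearMap.integral_apply]
  · simp [cv]
  · exact (hc.fderiv (𝕜 := ℝ)).convolutionExists_right ((ContinuousLinearMap.mul ℝ ℝ).precompR E2) hk
      (hψ.continuous_fderiv (by norm_num)) x

/-- gradient of the logarithm, weak form -/
lemma log_ibp {φ : E2 → ℝ} (hφ : ContDiff ℝ 1 φ) (hc : HasCompactSupport φ) (i : Fin 2) :
    ∫ z, lk z * pd i φ z = - ∫ z, Kk i z * φ z := by
  have hreg : ∀ η : ℝ, 0 < η → ∫ z : E2, (1/2 * Real.log (‖z‖ ^ 2 + η)) * pd i φ z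
      = - ∫ z : E2, (z i / (‖z‖ ^ 2 + η)) * φ z := by
    intro η hη
    have hpos : ∀ z : E2, ‖z‖ ^ 2 + η ≠ 0 := fun z => by positivity
    have hL : ContDiff ℝ 1 (fun z : E2 => 1/2 * Real.log (‖z‖ ^ 2 + η)) := by
      refine contDiff_const.mul (ContDiff.log ?_ hpos)
      exact (contDiff_norm_sq ℝ).add contDiff_const
    have hfd : ∀ z : E2, fderiv ℝ (fun z : E2 => 1/2 * Real.log (‖z‖ ^ 2 + η)) z (EuclideanSpace.single i 1)
        = z i / (‖z‖ ^ 2 + η) := by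
      intro z
      have h1 : HasFDerivAt (fun z : E2 => ‖z‖ ^ 2 + η) (2 • (innerSL ℝ z)) z := by
        exact (hasStrictFDerivAt_norm_sq z).hasFDerivAt.add_const η
      have h2 := (h1.log (hpos z)).const_mul (1/2)
      rw [h2.fderiv]
      simp [EuclideanSpace.inner_single_right]
      field_simp
    have := integral_mul_fderiv_eq_neg_fderiv_mul_of_integrable (μ := volume)
      (f := fun z : E2 => 1/2 * Real.log (‖z‖ ^ 2 + η)) (g := φ) (v := EuclideanSpace.single i 1) ?_ ?_ ?_ ?_ ?_
    · rw [show (fun z : E2 => (1/2 * Real.log (‖z‖ ^ 2 + η)) * pd i φ z) = fun z => (1/2 * Real.log (‖z‖ ^ 2 + η)) * fderiv ℝ φ z (EuclideanSpace.single i 1) from rfl, this]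
      simp only [hfd]
    · exact Continuous.integrable_of_hasCompactSupport ((pd_cont hL i).mul hφ.continuous) hc.mul_left
    · exact Continuous.integrable_of_hasCompactSupport (hL.continuous.mul (pd_cont hφ i)) (pd_hcs hc i).mul_left
    · exact Continuous.integrable_of_hasCompactSupport (hL.continuous.mul hφ.continuous) hc.mul_left
    · intro x _; exact hL.differentiable (by norm_num) x
    · intro x _; exact hφ.differentiable (by norm_num) x
  have hae : ∀ᵐ z : E2, z ≠ 0 := by
    have : volume ({0} : Set E2) = 0 := by simp
    exact compl_mem_ae_iff.mpr this
  have hev : ∀ᶠ η : ℝ in nhdsWithin 0 (Ioi 0), 0 < η ∧ η < 1 :=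
    Ioo_mem_nhdsGT (by norm_num : (0:ℝ) < 1)
  have t1 : Tendsto (fun η : ℝ => ∫ z : E2, (1/2 * Real.log (‖z‖ ^ 2 + η)) * pd i φ z) (nhdsWithin 0 (Ioi 0))
      (nhds (∫ z, lk z * pd i φ z)) := by
    refine tendsto_integral_filter_of_dominated_convergence (fun z => (|lk z| + ‖z‖ ^ 2) * |pd i φ z|) ?_ ?_ ?_ ?_
    · filter_upwards with η
      have := (pd_cont hφ i).measurable
      exact Measurable.aestronglyMeasurable (by fun_prop)
    · filter_upwards [hev] with η hη
      filter_upwards [hae] with z hz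
      have hzp : 0 < ‖z‖ := norm_pos_iff.mpr hz
      rw [Real.norm_eq_abs, abs_mul]
      refine mul_le_mul_of_nonneg_right ?_ (abs_nonneg _)
      have u1 : Real.log (‖z‖ ^ 2 + η) ≤ ‖z‖ ^ 2 := by
        have := Real.log_le_sub_one_of_pos (x := ‖z‖ ^ 2 + η) (by have := hη.1; positivity)
        linarith [hη.2]
      have u2 : 2 * lk z ≤ Real.log (‖z‖ ^ 2 + η) := by
        have e : 2 * lk z = Real.log (‖z‖ ^ 2) := by rw [Real.log_pow]; simp [lk]
        rw [e]
        exact Real.log_le_log (by positivity) (by linarith [hη.1])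
      have := neg_abs_le (lk z)
      have h3 := sq_nonneg ‖z‖
      rw [abs_le]; constructor <;> nlinarith [abs_nonneg (lk z)]
    · have : LocallyIntegrable (fun z : E2 => |lk z| + ‖z‖ ^ 2) :=
        LocallyIntegrable.add lk_abs_locInt (continuous_norm.pow 2).locallyIntegrable
      exact locInt_mul this (pd_cont hφ i).abs (pd_hcs hc i).norm
    · filter_upwards [hae] with z hz
      have hzp : 0 < ‖z‖ := norm_pos_iff.mpr hz
      have : lk z = 1/2 * Real.log (‖z‖ ^ 2 + 0) := by
        rw [add_zero, Real.log_pow]; simp [lk]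
      rw [this]
      refine Tendsto.mul_const _ (Tendsto.const_mul _ ?_)
      refine Tendsto.log ?_ (by positivity)
      exact (tendsto_const_nhds.add tendsto_id).mono_left nhdsWithin_le_nhds
  have t2 : Tendsto (fun η : ℝ => - ∫ z : E2, (z i / (‖z‖ ^ 2 + η)) * φ z) (nhdsWithin 0 (Ioi 0))
      (nhds (- ∫ z, Kk i z * φ z)) := by
    refine Tendsto.neg ?_
    refine tendsto_integral_filter_of_dominated_convergence (fun z => ‖z‖⁻¹ * |φ z|) ?_ ?_ ?_ ?_
    · filter_upwards with η
      have := hφ.continuous.measurable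
      exact Measurable.aestronglyMeasurable (by fun_prop)
    · filter_upwards [hev] with η hη
      filter_upwards [hae] with z hz
      have hzp : 0 < ‖z‖ := norm_pos_iff.mpr hz
      rw [Real.norm_eq_abs, abs_mul]
      refine mul_le_mul_of_nonneg_right ?_ (abs_nonneg _)
      have hp : 0 < ‖z‖ ^ 2 + η := by have := hη.1; positivity
      rw [abs_div, abs_of_pos hp, div_le_iff₀ hp]
      have := abs_coord_le z i
      have h4 : ‖z‖⁻¹ * (‖z‖ ^ 2 + η) = ‖z‖ + ‖z‖⁻¹ * η := by field_simp
      rw [h4]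
      have : 0 ≤ ‖z‖⁻¹ * η := mul_nonneg (by positivity) hη.1.le
      linarith
    · exact locInt_mul inv_locInt hφ.continuous.abs hc.norm
    · filter_upwards [hae] with z hz
      have hzp : 0 < ‖z‖ := norm_pos_iff.mpr hz
      refine Tendsto.mul_const _ ?_
      have : Kk i z = z i / (‖z‖ ^ 2 + 0) := by simp [Kk]
      rw [this]
      refine Tendsto.div tendsto_const_nhds ?_ (by positivity)
      exact (tendsto_const_nhds.add tendsto_id).mono_left nhdsWithin_le_nhds
  refine tendsto_nhds_unique t1 (t2.congr' ?_)
  filter_upwards [hev] with η hη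
  exact (hreg η hη.1).symm

section NewtonPart

lemma cv_comm (k ψ : E2 → ℝ) (x : E2) : cv k ψ x = ∫ y, k (x - y) * ψ y := by
  unfold cv
  rw [← integral_sub_left_eq_self (fun y => k (x - y) * ψ y) volume x]
  simp

lemma newton_eq (ω : E2 → ℝ) : newtonConv ω = fun x => (-(1 / (2 * Real.pi))) * cv lk ω x := by
  ext x
  rw [cv_comm, ← integral_const_mul]
  unfold newtonConv NewtonianPotential lk
  congr 1 with y
  simp; ring

lemma pd_const_mul {φ : E2 → ℝ} (hφ : Differentiable ℝ φ) (c : ℝ) (i : Fin 2) (x : E2) :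
    pd i (fun x => c * φ x) x = c * pd i φ x := by
  unfold pd
  rw [fderiv_const_mul (hφ x)]; simp

lemma cv_pd_lk {ω : E2 → ℝ} (h : ContDiff ℝ 1 ω) (hc : HasCompactSupport ω) (i : Fin 2) (x : E2) :
    cv lk (pd i ω) x = cv (Kk i) ω x := by
  unfold cv
  have h1 : ContDiff ℝ 1 (fun z => ω (x - z)) := h.comp (contDiff_const.sub contDiff_id)
  have h2 := log_ibp h1 (hcs_sub hc x) i
  have h3 : ∀ z, pd i (fun z => ω (x - z)) z = - pd i ω (x - z) := by
    intro z
    unfold pd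
    have : HasFDerivAt (fun z => ω (x - z)) ((fderiv ℝ ω (x - z)).comp (-ContinuousLinearMap.id ℝ E2)) z :=
      ((h.differentiable (by norm_num) (x - z)).hasFDerivAt).comp z ((hasFDerivAt_id z).const_sub x)
    rw [this.fderiv]; simp
  simp only [h3, mul_neg, integral_neg] at h2
  linarith

variable {ω : E2 → ℝ}

lemma newton_contDiff (h : ContDiff ℝ 2 ω) (hc : HasCompactSupport ω) : ContDiff ℝ 2 (newtonConv ω) := by
  rw [newton_eq]
  exact contDiff_const.mul (cv_contDiff lk_locInt 2 h hc)

lemma newton_pd (h : ContDiff ℝ 2 ω) (hc : HasCompactSupport ω) (i : Fin 2) :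
    pd i (newtonConv ω) = fun x => (-(1 / (2 * Real.pi))) * cv (Kk i) ω x := by
  have h1 : ContDiff ℝ 1 ω := h.of_le (by norm_num)
  ext x
  rw [newton_eq, pd_const_mul ((cv_contDiff lk_locInt 2 h hc).differentiable (by norm_num)), cv_pd lk_locInt h1 hc, cv_pd_lk h1 hc]

lemma Kk_dot (z : E2) (hz : z ≠ 0) : z 0 * Kk 0 z + z 1 * Kk 1 z = 1 := by
  have : 0 < ‖z‖ := norm_pos_iff.mpr hz
  unfold Kk
  have h2 := normsq_e2 z
  field_simp
  linarith

lemma conv_grad {A : E2 → ℝ} (h1 : ContDiff ℝ 1 A) (hc : HasCompactSupport A) (x : E2) :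
    cv (Kk 0) (pd 0 A) x + cv (Kk 1) (pd 1 A) x = 2 * Real.pi * A x := by
  unfold cv
  rw [← integral_add (cv_integrable (Kk_locInt 0) (pd_cont h1 0) (pd_hcs hc 0) x)
    (cv_integrable (Kk_locInt 1) (pd_cont h1 1) (pd_hcs hc 1) x)]
  have h2 : ContDiff ℝ 1 (fun z => A (x - z)) := h1.comp (contDiff_const.sub contDiff_id)
  have h3 := polar_key h2 (hcs_sub hc x)
  have h4 : ∀ z, fderiv ℝ (fun z => A (x - z)) z z / ‖z‖ ^ 2 = -(Kk 0 z * pd 0 A (x - z) + Kk 1 z * pd 1 A (x - z)) := by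
    intro z
    have : HasFDerivAt (fun z => A (x - z)) ((fderiv ℝ A (x - z)).comp (-ContinuousLinearMap.id ℝ E2)) z :=
      ((h1.differentiable (by norm_num) (x - z)).hasFDerivAt).comp z ((hasFDerivAt_id z).const_sub x)
    rw [this.fderiv]
    simp only [ContinuousLinearMap.coe_comp, Function.comp, neg_apply, ContinuousLinearMap.id_apply, map_neg]
    rw [fderiv_e2]
    unfold Kk; ring
  simp only [h4, integral_neg, sub_zero] at h3
  linarith

lemma newton_lap (h : ContDiff ℝ 2 ω) (hc : HasCompactSupport ω) (x : E2) :
    pd 0 (pd 0 (newtonConv ω)) x + pd 1 (pd 1 (newtonConv ω)) x = - ω x := by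
  have h1 : ContDiff ℝ 1 ω := h.of_le (by norm_num)
  have h0 : ∀ i, pd i (pd i (newtonConv ω)) x = (-(1 / (2 * Real.pi))) * cv (Kk i) (pd i ω) x := by
    intro i
    rw [newton_pd h hc, pd_const_mul ((cv_contDiff (Kk_locInt i) 2 h hc).differentiable (by norm_num)), cv_pd (Kk_locInt i) h1 hc]
  rw [h0, h0, ← mul_add, conv_grad h1 hc]
  have hpi := Real.pi_pos
  field_simp

/-- Fubini integrability for convolution type double integrals -/
lemma prod_integrable {k ψ₁ ψ₂ : E2 → ℝ} (hk : LocallyIntegrable k)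
    (h₁ : Continuous ψ₁) (c₁ : HasCompactSupport ψ₁) (h₂ : Continuous ψ₂) (c₂ : HasCompactSupport ψ₂) :
    Integrable (fun p : E2 × E2 => ψ₁ p.1 * (k (p.1 - p.2) * ψ₂ p.2)) (volume.prod volume) := by
  obtain ⟨R₁, hR₁, b₁⟩ := c₁.isCompact.isBounded.exists_pos_norm_lt
  obtain ⟨R₂, hR₂, b₂⟩ := c₂.isCompact.isBounded.exists_pos_norm_lt
  set k' : E2 → ℝ := (closedBall (0:E2) (R₁ + R₂)).indicator k with hk'
  have hki : Integrable k' := by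
    rw [hk', integrable_indicator_iff measurableSet_closedBall]
    exact hk.integrableOn_isCompact (isCompact_closedBall _ _)
  have h2i : Integrable ψ₂ := h₂.integrable_of_hasCompactSupport c₂
  have hI := h2i.convolution_integrand (ContinuousLinearMap.mul ℝ ℝ) hki
  obtain ⟨C, hC⟩ := h₁.bounded_above_of_compact_support c₁
  have hJ := hI.bdd_mul (f := fun p : E2 × E2 => ψ₁ p.1) (c := C) (h₁.comp continuous_fst).aestronglyMeasurable (by
    filter_upwards with p; exact hC p.1)
  refine hJ.congr ?_
  filter_upwards with p
  simp only [ContinuousLinearMap.mul_apply']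
  by_cases e1 : ψ₁ p.1 = 0
  · simp [e1]
  by_cases e2 : ψ₂ p.2 = 0
  · simp [e2]
  have m1 := b₁ p.1 (subset_tsupport _ e1)
  have m2 := b₂ p.2 (subset_tsupport _ e2)
  have : k' (p.1 - p.2) = k (p.1 - p.2) := by
    rw [hk', indicator_of_mem]
    rw [mem_closedBall_zero_iff]
    linarith [norm_sub_le p.1 p.2]
  rw [this]; ring

lemma Kk_neg (i : Fin 2) (z : E2) : Kk i (-z) = - Kk i z := by
  unfold Kk; simp; ring

lemma hcs_mul_cont {ψ φ : E2 → ℝ} (hc : HasCompactSupport ψ) : HasCompactSupport (fun x => φ x * ψ x) := hc.mul_left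

lemma coord_cont (i : Fin 2) : Continuous (fun z : E2 => z i) := by fun_prop

lemma virial (h : ContDiff ℝ 2 ω) (hc : HasCompactSupport ω) :
    ∫ x, ω x * (x 0 * pd 0 (newtonConv ω) x + x 1 * pd 1 (newtonConv ω) x) = - (∫ x, ω x) ^ 2 / (4 * Real.pi) := by
  have hcont := h.continuous
  have hI : ∀ i : Fin 2, Integrable (fun p : E2 × E2 => (p.1 i * ω p.1) * (Kk i (p.1 - p.2) * ω p.2)) (volume.prod volume) := fun i =>
    prod_integrable (ψ₁ := fun x => x i * ω x) (Kk_locInt i) ((coord_cont i).mul hcont) hc.mul_left hcont hc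
  have hI' : ∀ i : Fin 2, Integrable (fun p : E2 × E2 => ω p.1 * (Kk i (p.1 - p.2) * (p.2 i * ω p.2))) (volume.prod volume) := fun i =>
    prod_integrable (ψ₂ := fun x => x i * ω x) (Kk_locInt i) hcont hc ((coord_cont i).mul hcont) hc.mul_left
  have e1 : ∀ i : Fin 2, ∫ x, ω x * (x i * cv (Kk i) ω x) = ∫ p : E2 × E2, (p.1 i * ω p.1) * (Kk i (p.1 - p.2) * ω p.2) ∂(volume.prod volume) := by
    intro i
    rw [integral_prod _ (hI i)]
    congr 1 with x
    rw [cv_comm, ← integral_const_mul, ← integral_const_mul]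
    congr 1 with y
    ring
  have e2 : ∀ i : Fin 2, ∫ p : E2 × E2, (p.1 i * ω p.1) * (Kk i (p.1 - p.2) * ω p.2) ∂(volume.prod volume)
     = - ∫ p : E2 × E2, ω p.1 * (Kk i (p.1 - p.2) * (p.2 i * ω p.2)) ∂(volume.prod volume) := by
    intro i
    rw [← integral_prod_swap, ← integral_neg]
    congr 1 with p
    simp only [Prod.swap]
    rw [← neg_sub p.1 p.2, Kk_neg]; ring
  have e3 : (∫ p : E2 × E2, (p.1 0 * ω p.1) * (Kk 0 (p.1 - p.2) * ω p.2) ∂(volume.prod volume)) -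
      (∫ p : E2 × E2, ω p.1 * (Kk 0 (p.1 - p.2) * (p.2 0 * ω p.2)) ∂(volume.prod volume)) +
      ((∫ p : E2 × E2, (p.1 1 * ω p.1) * (Kk 1 (p.1 - p.2) * ω p.2) ∂(volume.prod volume)) -
      (∫ p : E2 × E2, ω p.1 * (Kk 1 (p.1 - p.2) * (p.2 1 * ω p.2)) ∂(volume.prod volume))) = (∫ x, ω x) ^ 2 := by
    have s : ∀ i : Fin 2, Integrable (fun p : E2 × E2 => (p.1 i * ω p.1) * (Kk i (p.1 - p.2) * ω p.2) - ω p.1 * (Kk i (p.1 - p.2) * (p.2 i * ω p.2))) (volume.prod volume) :=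
      fun i => (hI i).sub (hI' i)
    rw [← integral_sub (hI 0) (hI' 0), ← integral_sub (hI 1) (hI' 1), ← integral_add (s 0) (s 1), sq, ← integral_prod_mul]
    refine integral_congr_ae ?_
    have hd : ∀ᵐ p : E2 × E2 ∂(volume.prod volume), p.1 - p.2 ≠ 0 := by
      have hms : MeasurableSet {p : E2 × E2 | p.1 - p.2 ≠ 0} := by
        exact (isOpen_ne_fun (by fun_prop) continuous_const).measurableSet
      rw [Measure.ae_prod_iff_ae_ae hms]
      filter_upwards with x
      have : volume ({x} : Set E2) = 0 := by simp
      have h5 : ∀ᵐ y : E2, y ≠ x := compl_mem_ae_iff.mpr this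
      filter_upwards [h5] with y hy
      exact sub_ne_zero.mpr hy.symm
    filter_upwards [hd] with p hp
    have := Kk_dot _ hp
    simp only [PiLp.sub_apply] at this
    linear_combination ω p.1 * ω p.2 * this
  have ii : ∀ i : Fin 2, Integrable (fun x => ω x * (x i * cv (Kk i) ω x)) := fun i => by
    refine Continuous.integrable_of_hasCompactSupport ?_ hc.mul_right
    exact hcont.mul ((coord_cont i).mul (cv_contDiff (Kk_locInt i) 2 h hc).continuous)
  have e4 : ∫ x, ω x * (x 0 * pd 0 (newtonConv ω) x + x 1 * pd 1 (newtonConv ω) x) =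
      (-(1 / (2 * Real.pi))) * ((∫ x, ω x * (x 0 * cv (Kk 0) ω x)) + ∫ x, ω x * (x 1 * cv (Kk 1) ω x)) := by
    rw [← integral_add (ii 0) (ii 1), ← integral_const_mul]
    congr 1 with x
    rw [newton_pd h hc, newton_pd h hc]; ring
  rw [e4, e1, e1]
  have q0 := e2 0
  have q1 := e2 1
  have : ((∫ p : E2 × E2, (p.1 0 * ω p.1) * (Kk 0 (p.1 - p.2) * ω p.2) ∂(volume.prod volume)) +
    ∫ p : E2 × E2, (p.1 1 * ω p.1) * (Kk 1 (p.1 - p.2) * ω p.2) ∂(volume.prod volume)) = (∫ x, ω x) ^ 2 / 2 := by linarith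
  rw [this]
  have hpi := Real.pi_pos
  field_simp
  ring

end NewtonPart

lemma pd_mul {φ ψ : E2 → ℝ} (hφ : Differentiable ℝ φ) (hψ : Differentiable ℝ ψ) (i : Fin 2) (x : E2) :
    pd i (fun x => φ x * ψ x) x = pd i φ x * ψ x + φ x * pd i ψ x := by
  unfold pd
  rw [fderiv_fun_mul (hφ x) (hψ x)]; simp; ring

lemma pd_add {φ ψ : E2 → ℝ} (hφ : Differentiable ℝ φ) (hψ : Differentiable ℝ ψ) (i : Fin 2) (x : E2) :
    pd i (fun x => φ x + ψ x) x = pd i φ x + pd i ψ x := by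
  unfold pd
  rw [fderiv_fun_add (hφ x) (hψ x)]; simp

lemma pd_coord (i j : Fin 2) (x : E2) : pd i (fun x : E2 => x j) x = if i = j then 1 else 0 := by
  unfold pd
  have : HasFDerivAt (fun x : E2 => x j) (EuclideanSpace.proj j : E2 →L[ℝ] ℝ) x :=
    (EuclideanSpace.proj j : E2 →L[ℝ] ℝ).hasFDerivAt
  rw [this.fderiv]
  simp [eq_comm]

lemma coord_contDiff (i : Fin 2) {n : WithTop ℕ∞} : ContDiff ℝ n (fun x : E2 => x i) :=
  (EuclideanSpace.proj i : E2 →L[ℝ] ℝ).contDiff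

/-- product integrals by parts -/
lemma ibp {φ ψ : E2 → ℝ} (hφ : ContDiff ℝ 1 φ) (hψ : ContDiff ℝ 1 ψ) (hc : HasCompactSupport φ) (i : Fin 2) :
    ∫ x, pd i φ x * ψ x = - ∫ x, φ x * pd i ψ x := by
  have h := integral_pd_zero (hφ.mul hψ) hc.mul_right i
  have e : ∀ x, pd i (fun x => φ x * ψ x) x = pd i φ x * ψ x + φ x * pd i ψ x := fun x =>
    pd_mul (hφ.differentiable (by norm_num)) (hψ.differentiable (by norm_num)) i x
  simp only [e] at h
  rw [integral_add] at h
  · linarith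
  · exact Continuous.integrable_of_hasCompactSupport ((pd_cont hφ i).mul hψ.continuous) (pd_hcs hc i).mul_right
  · exact Continuous.integrable_of_hasCompactSupport (hφ.continuous.mul (pd_cont hψ i)) hc.mul_right

/-- `∫ x·∇Y = -2 ∫ Y` -/
lemma euler_ibp {Y : E2 → ℝ} (hY : ContDiff ℝ 1 Y) (hc : HasCompactSupport Y) :
    ∫ x, (x 0 * pd 0 Y x + x 1 * pd 1 Y x) = - 2 * ∫ x, Y x := by
  have i0 : ∀ i : Fin 2, Integrable (fun x : E2 => x i * pd i Y x) := fun i =>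
    Continuous.integrable_of_hasCompactSupport ((coord_cont i).mul (pd_cont hY i)) (pd_hcs hc i).mul_left
  rw [integral_add (i0 0) (i0 1)]
  have : ∀ i : Fin 2, ∫ x : E2, x i * pd i Y x = - ∫ x, Y x := by
    intro i
    have := ibp hY (coord_contDiff i) hc i
    simp only [pd_coord, if_true, mul_one] at this
    rw [← this]; congr 1 with x; ring
  rw [this, this]; ring

/-- `z_i z_j / |z|²` -/
def rr (i j : Fin 2) (z : E2) : ℝ := z i * z j / ‖z‖ ^ 2

lemma rr_le (i j : Fin 2) (z : E2) : |rr i j z| ≤ 1 := by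
  unfold rr
  rw [abs_div, abs_mul, abs_of_nonneg (sq_nonneg ‖z‖)]
  refine div_le_one_of_le₀ ?_ (sq_nonneg _)
  rw [sq]; exact mul_le_mul (abs_coord_le z i) (abs_coord_le z j) (abs_nonneg _) (norm_nonneg _)

lemma rr_meas (i j : Fin 2) : Measurable (rr i j) := by
  unfold rr
  exact ((coord_meas i).mul (coord_meas j)).div (measurable_norm.pow_const 2)

lemma rr_int {p q : E2 → ℝ} (hp : Integrable p) (hq : Integrable q) (i j : Fin 2) :
    Integrable (fun z : E2 × E2 => rr i j (z.1 - z.2) * (p z.1 * q z.2)) (volume.prod volume) := by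
  refine (hp.mul_prod hq).bdd_mul (c := 1) ?_ ?_
  · exact ((rr_meas i j).comp (measurable_fst.sub measurable_snd)).aestronglyMeasurable
  · filter_upwards with z; exact rr_le i j _

/-- The kernel identity. -/
lemma kernel_id {A : E2 → ℝ} (h : ContDiff ℝ 1 A) (hc : HasCompactSupport A) :
    ∫ p : E2 × E2, (pd 0 A p.1 * pd 0 A p.2 + pd 1 A p.1 * pd 1 A p.2 -
      2 * (rr 0 0 (p.1 - p.2) * (pd 0 A p.1 * pd 0 A p.2) + rr 0 1 (p.1 - p.2) * (pd 0 A p.1 * pd 1 A p.2)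
        + rr 1 0 (p.1 - p.2) * (pd 1 A p.1 * pd 0 A p.2) + rr 1 1 (p.1 - p.2) * (pd 1 A p.1 * pd 1 A p.2))) ∂(volume.prod volume)
      = 4 * Real.pi * ∫ x, A x ^ 2 := by
  have hi : ∀ i, Integrable (pd i A) := fun i => (pd_cont h i).integrable_of_hasCompactSupport (pd_hcs hc i)
  have hr : ∀ i j, Integrable (fun z : E2 × E2 => rr i j (z.1 - z.2) * (pd i A z.1 * pd j A z.2)) (volume.prod volume) :=
    fun i j => rr_int (hi i) (hi j) i j
  have hsum : Integrable (fun p : E2 × E2 => rr 0 0 (p.1 - p.2) * (pd 0 A p.1 * pd 0 A p.2) + rr 0 1 (p.1 - p.2) * (pd 0 A p.1 * pd 1 A p.2)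
        + rr 1 0 (p.1 - p.2) * (pd 1 A p.1 * pd 0 A p.2) + rr 1 1 (p.1 - p.2) * (pd 1 A p.1 * pd 1 A p.2)) (volume.prod volume) :=
    (((hr 0 0).add (hr 0 1)).add (hr 1 0)).add (hr 1 1)
  have hmm : Integrable (fun p : E2 × E2 => pd 0 A p.1 * pd 0 A p.2 + pd 1 A p.1 * pd 1 A p.2) (volume.prod volume) :=
    ((hi 0).mul_prod (hi 0)).add ((hi 1).mul_prod (hi 1))
  rw [integral_sub hmm (hsum.const_mul 2), integral_add ((hi 0).mul_prod (hi 0)) ((hi 1).mul_prod (hi 1)),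
    integral_prod_mul, integral_prod_mul, integral_pd_zero h hc, integral_pd_zero h hc, integral_const_mul]
  have inner : ∀ x, ∫ y, (rr 0 0 (x - y) * (pd 0 A x * pd 0 A y) + rr 0 1 (x - y) * (pd 0 A x * pd 1 A y)
        + rr 1 0 (x - y) * (pd 1 A x * pd 0 A y) + rr 1 1 (x - y) * (pd 1 A x * pd 1 A y))
        = pd 0 A x * cv (Kk 0) A x + pd 1 A x * cv (Kk 1) A x := by
    intro x
    rw [← integral_sub_left_eq_self _ volume x]
    set a := pd 0 A x
    set b := pd 1 A x
    have hl : ContDiff ℝ 1 (fun z : E2 => a * z 0 + b * z 1) :=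
      (contDiff_const.mul (coord_contDiff 0)).add (contDiff_const.mul (coord_contDiff 1))
    have h1 : ContDiff ℝ 1 (fun z => A (x - z)) := h.comp (contDiff_const.sub contDiff_id)
    have hk := polar_key (hl.mul h1) (hcs_sub hc x).mul_left
    have hz : ∀ z, fderiv ℝ (fun z => (a * z 0 + b * z 1) * A (x - z)) z z / ‖z‖ ^ 2 =
       (a * (Kk 0 z * A (x - z)) + b * (Kk 1 z * A (x - z))) -
         (rr 0 0 z * (a * pd 0 A (x - z)) + rr 0 1 z * (a * pd 1 A (x - z))
        + rr 1 0 z * (b * pd 0 A (x - z)) + rr 1 1 z * (b * pd 1 A (x - z))) := by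
      intro z
      rw [fderiv_fun_mul (hl.differentiable (by norm_num) z) (h1.differentiable (by norm_num) z)]
      have g1 : HasFDerivAt (fun z => A (x - z)) ((fderiv ℝ A (x - z)).comp (-ContinuousLinearMap.id ℝ E2)) z :=
        ((h.differentiable (by norm_num) (x - z)).hasFDerivAt).comp z ((hasFDerivAt_id z).const_sub x)
      have g2 : HasFDerivAt (fun z : E2 => a * z 0 + b * z 1) (a • (EuclideanSpace.proj 0 : E2 →L[ℝ] ℝ) + b • (EuclideanSpace.proj 1 : E2 →L[ℝ] ℝ)) z :=
        ((EuclideanSpace.proj 0 : E2 →L[ℝ] ℝ).hasFDerivAt.const_mul a).add ((EuclideanSpace.proj 1 : E2 →L[ℝ] ℝ).hasFDerivAt.const_mul b)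
      rw [g1.fderiv, g2.fderiv]
      simp only [add_apply, smul_apply, ContinuousLinearMap.coe_comp, Function.comp, neg_apply, ContinuousLinearMap.id_apply, map_neg, smul_eq_mul, PiLp.proj_apply]
      rw [fderiv_e2 A]
      unfold Kk rr
      ring
    simp only [hz] at hk
    have k0 : ∀ i, Integrable (fun z => Kk i z * A (x - z)) := fun i => cv_integrable (Kk_locInt i) h.continuous hc x
    have rI : ∀ i j (c : ℝ), Integrable (fun z => rr i j z * (c * pd j A (x - z))) := by
      intro i j c
      refine Integrable.bdd_mul (c := 1) ?_ (rr_meas i j).aestronglyMeasurable (by filter_upwards with z; exact rr_le i j z)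
      exact ((hi j).comp_sub_left x).const_mul c
    rw [integral_sub (i_add ((k0 0).const_mul a) ((k0 1).const_mul b)) (i_add (i_add (i_add (rI 0 0 a) (rI 0 1 a)) (rI 1 0 b)) (rI 1 1 b)),
      integral_add ((k0 0).const_mul a) ((k0 1).const_mul b), integral_const_mul, integral_const_mul] at hk
    simp only [sub_sub_cancel]
    unfold cv
    simp at hk ⊢
    linarith
  rw [integral_prod _ hsum]
  simp only [inner]
  have c1 : ∀ i, ContDiff ℝ 1 (cv (Kk i) A) := fun i => cv_contDiff (Kk_locInt i) 1 h hc
  have i1 : ∀ i, Integrable (fun x => pd i A x * cv (Kk i) A x) := fun i =>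
    Continuous.integrable_of_hasCompactSupport ((pd_cont h i).mul (c1 i).continuous) (pd_hcs hc i).mul_right
  rw [integral_add (i1 0) (i1 1), ibp h (c1 0) hc, ibp h (c1 1) hc]
  have i2 : ∀ i, Integrable (fun x => A x * pd i (cv (Kk i) A) x) := fun i =>
    Continuous.integrable_of_hasCompactSupport (h.continuous.mul (pd_cont (c1 i) i)) hc.mul_right
  rw [← neg_add, ← integral_add (i2 0) (i2 1)]
  have : ∀ x, A x * pd 0 (cv (Kk 0) A) x + A x * pd 1 (cv (Kk 1) A) x = 2 * Real.pi * A x ^ 2 := by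
    intro x
    rw [cv_pd (Kk_locInt 0) h hc, cv_pd (Kk_locInt 1) h hc]
    linear_combination A x * conv_grad h hc x
  simp only [this, integral_const_mul]
  ring

lemma sard_null_local {ω : E2 → ℝ} (h : ContDiff ℝ 2 ω) (i : Fin 2) (x₀ : E2)
    (hL : fderiv ℝ (pd i ω) x₀ ≠ 0) :
    ∃ U ∈ nhds x₀, volume (ω '' ({x | fderiv ℝ ω x = 0} ∩ U)) = 0 := by
  set L := fderiv ℝ (pd i ω) x₀ with hLd
  set l0 := L (EuclideanSpace.single 0 1) with hl0
  set l1 := L (EuclideanSpace.single 1 1) with hl1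
  have hLv : ∀ v : E2, L v = v 0 * l0 + v 1 * l1 := clm_e2 L
  have hpos : 0 < l0 ^ 2 + l1 ^ 2 := by
    by_contra hn
    have h0 : l0 = 0 := by nlinarith [sq_nonneg l0, sq_nonneg l1]
    have h1 : l1 = 0 := by nlinarith [sq_nonneg l0, sq_nonneg l1]
    apply hL
    ext v
    simp [hLv, h0, h1]
  have hstrict : HasStrictFDerivAt (pd i ω) L x₀ :=
    (pd_contDiff h i).contDiffAt.hasStrictFDerivAt (by norm_num)
  set n := Real.sqrt (l0 ^ 2 + l1 ^ 2) with hn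
  have hn0 : 0 < n := Real.sqrt_pos.mpr hpos
  have hn2 : n ^ 2 = l0 ^ 2 + l1 ^ 2 := Real.sq_sqrt hpos.le
  have hap := hstrict.isLittleO.def (half_pos hn0)
  rw [nhds_prod_eq] at hap
  obtain ⟨V, hV, hVU⟩ := mem_prod_self_iff.mp hap
  refine ⟨V, hV, ?_⟩
  set C := {x | fderiv ℝ ω x = 0} ∩ V with hC
  set ℓ : E2 → ℝ := fun v => - l1 * v 0 + l0 * v 1 with hℓ
  have hp0 : ∀ x ∈ C, pd i ω x = 0 := by
    intro x hx
    have : fderiv ℝ ω x = 0 := hx.1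
    simp [pd, this]
  have key : ∀ x ∈ C, ∀ y ∈ C, n * ‖x - y‖ ≤ 2 * |ℓ x - ℓ y| := by
    intro x hx y hy
    have h1 : ‖pd i ω x - pd i ω y - L (x - y)‖ ≤ n / 2 * ‖x - y‖ := hVU (Set.mk_mem_prod hx.2 hy.2)
    simp only [hp0 x hx, hp0 y hy, sub_self, zero_sub, norm_neg] at h1
    rw [hLv, Real.norm_eq_abs] at h1
    have h2 := abs_le.mp h1
    have h3 := normsq_e2 (x - y)
    set v := x - y with hv
    have h4 : ℓ x - ℓ y = - l1 * v 0 + l0 * v 1 := by simp [hℓ, hv]; ring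
    rw [h4]
    have h5 : (n * ‖v‖) ^ 2 ≤ (2 * |-l1 * v 0 + l0 * v 1|) ^ 2 := by
      rw [mul_pow, mul_pow, sq_abs, hn2]
      have h6 : (v 0 * l0 + v 1 * l1) ^ 2 ≤ (n / 2 * ‖v‖) ^ 2 := sq_le_sq' (by linarith) h2.2
      have h7 : (v 0 * l0 + v 1 * l1) ^ 2 + (- l1 * v 0 + l0 * v 1) ^ 2 = (l0 ^ 2 + l1 ^ 2) * ‖v‖ ^ 2 := by rw [h3]; ring
      have h8 : (n / 2 * ‖v‖) ^ 2 = (l0 ^ 2 + l1 ^ 2) * ‖v‖ ^ 2 / 4 := by rw [← hn2]; ring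
      nlinarith [mul_nonneg hpos.le (sq_nonneg ‖v‖)]
    exact abs_le_of_sq_le_sq' h5 (by positivity) |>.2
  have hinj : InjOn ℓ C := by
    intro x hx y hy hxy
    have := key x hx y hy
    rw [hxy] at this
    simp at this
    have h9 : ‖x - y‖ ≤ 0 := by nlinarith
    exact sub_eq_zero.mp (norm_le_zero_iff.mp h9)
  set σ : ℝ → E2 := Function.invFunOn ℓ C with hσ
  have hσl : ∀ x ∈ C, σ (ℓ x) = x := fun x hx => hinj.leftInvOn_invFunOn hx
  have himg : ω '' C = (ω ∘ σ) '' (ℓ '' C) := by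
    ext t; constructor
    · rintro ⟨x, hx, rfl⟩; exact ⟨ℓ x, ⟨x, hx, rfl⟩, by simp [hσl x hx]⟩
    · rintro ⟨_, ⟨x, hx, rfl⟩, rfl⟩; exact ⟨x, hx, by simp [hσl x hx]⟩
  rw [himg]
  refine addHaar_image_eq_zero_of_det_fderivWithin_eq_zero (f' := fun _ => 0) volume ?_ ?_
  · rintro _ ⟨x, hx, rfl⟩
    have hd : HasFDerivAt ω (0 : E2 →L[ℝ] ℝ) x := by
      have := (h.differentiable (by norm_num) x).hasFDerivAt
      have e : fderiv ℝ ω x = 0 := hx.1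
      rwa [e] at this
    have hlip : ∀ s ∈ ℓ '' C, ‖σ s - σ (ℓ x)‖ ≤ (2 / n) * ‖s - ℓ x‖ := by
      rintro _ ⟨y, hy, rfl⟩
      rw [hσl x hx, hσl y hy, Real.norm_eq_abs]
      have := key y hy x hx
      rw [div_mul_eq_mul_div, le_div_iff₀ hn0]; linarith
    have htend : Tendsto σ (nhdsWithin (ℓ x) (ℓ '' C)) (nhds (σ (ℓ x))) := by
      rw [tendsto_iff_norm_sub_tendsto_zero]
      refine squeeze_zero' (Eventually.of_forall fun _ => norm_nonneg _) (g := fun s => (2/n) * ‖s - ℓ x‖) ?_ ?_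
      · filter_upwards [self_mem_nhdsWithin] with s hs using hlip s hs
      · have : Tendsto (fun s => (2/n) * ‖s - ℓ x‖) (nhds (ℓ x)) (nhds ((2/n) * ‖ℓ x - ℓ x‖)) := by
          apply Continuous.tendsto; fun_prop
        simp at this
        simpa using this.mono_left nhdsWithin_le_nhds
    rw [hσl x hx] at htend
    rw [hasFDerivWithinAt_iff_isLittleO]
    have h1 := (hd.isLittleO).comp_tendsto htend
    simp only [Function.comp_def, ContinuousLinearMap.zero_apply, sub_zero, hσl x hx] at h1 ⊢
    refine h1.trans_isBigO ?_
    refine Asymptotics.IsBigO.of_bound (2/n) ?_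
    filter_upwards [self_mem_nhdsWithin] with s hs
    have := hlip s hs
    rwa [hσl x hx] at this
  · intro x _
    simp

lemma sard_c1 {ω : E2 → ℝ} (h : ContDiff ℝ 2 ω) (hc : HasCompactSupport ω) :
    volume (ω '' {x | fderiv ℝ ω x = 0 ∧ ∀ i, fderiv ℝ (pd i ω) x = 0}) = 0 := by
  set C := {x | fderiv ℝ ω x = 0 ∧ ∀ i, fderiv ℝ (pd i ω) x = 0} with hC
  obtain ⟨R, hR0, hR⟩ := hc.isCompact.isBounded.exists_pos_norm_lt
  -- local estimate
  have hloc : ∀ ε > 0, ∃ r > 0, ∀ y ∈ C, ∀ x, ‖x - y‖ ≤ r → |ω x - ω y| ≤ ε * ‖x - y‖ ^ 2 := by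
    intro ε hε
    have huc : ∀ i, UniformContinuous (fderiv ℝ (pd i ω)) := fun i =>
      ((pd_hcs hc i).fderiv (𝕜 := ℝ)).uniformContinuous_of_continuous
        ((pd_contDiff h i).continuous_fderiv (by norm_num))
    have h1 : ∀ i, ∃ r > 0, ∀ y ∈ C, ∀ x, ‖x - y‖ < r → ‖fderiv ℝ (pd i ω) x‖ < ε / 2 := by
      intro i
      obtain ⟨r, hr, hr'⟩ := Metric.uniformContinuous_iff.mp (huc i) (ε/2) (by positivity)
      refine ⟨r, hr, fun y hy x hxy => ?_⟩
      have := hr' (a := x) (b := y) (by rwa [dist_eq_norm])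
      rwa [hy.2 i, dist_zero_right] at this
    obtain ⟨r0, hr0, H0⟩ := h1 0
    obtain ⟨r1, hr1, H1⟩ := h1 1
    have H : ∀ i, ∀ y ∈ C, ∀ x, ‖x - y‖ < min r0 r1 → ‖fderiv ℝ (pd i ω) x‖ ≤ ε / 2 := by
      intro i y hy x hx
      fin_cases i
      · exact (H0 y hy x (lt_of_lt_of_le hx (min_le_left _ _))).le
      · exact (H1 y hy x (lt_of_lt_of_le hx (min_le_right _ _))).le
    set r := min r0 r1
    have hr : 0 < r := lt_min hr0 hr1
    refine ⟨r / 2, by positivity, fun y hy x hxy => ?_⟩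
    have hpd : ∀ i, ∀ z ∈ closedBall y ‖x - y‖, |pd i ω z| ≤ ε / 2 * ‖x - y‖ := by
      intro i z hz
      have hzz : ‖z - y‖ ≤ ‖x - y‖ := by rwa [mem_closedBall, dist_eq_norm] at hz
      have := (convex_closedBall y ‖x - y‖).norm_image_sub_le_of_norm_fderiv_le (𝕜 := ℝ) (f := pd i ω) (C := ε/2)
        (fun w _ => (pd_contDiff h i).differentiable (by norm_num) w)
        (fun w hw => H i y hy w (by rw [mem_closedBall, dist_eq_norm] at hw; linarith))
        (mem_closedBall_self (norm_nonneg _)) hz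
      have h0 : pd i ω y = 0 := by simp [pd, hy.1]
      rw [h0, sub_zero, Real.norm_eq_abs] at this
      refine this.trans ?_
      gcongr
    have hfd : ∀ z ∈ closedBall y ‖x - y‖, ‖fderiv ℝ ω z‖ ≤ ε * ‖x - y‖ := by
      intro z hz
      refine ContinuousLinearMap.opNorm_le_bound _ (by positivity) fun v => ?_
      rw [fderiv_e2, Real.norm_eq_abs]
      calc |v 0 * pd 0 ω z + v 1 * pd 1 ω z| ≤ |v 0| * |pd 0 ω z| + |v 1| * |pd 1 ω z| := by
            rw [← abs_mul, ← abs_mul]; exact abs_add_le _ _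
        _ ≤ ‖v‖ * (ε / 2 * ‖x - y‖) + ‖v‖ * (ε / 2 * ‖x - y‖) := by
            gcongr
            · exact abs_coord_le v 0
            · exact hpd 0 z hz
            · exact abs_coord_le v 1
            · exact hpd 1 z hz
        _ = _ := by ring
    have := (convex_closedBall y ‖x - y‖).norm_image_sub_le_of_norm_fderiv_le (𝕜 := ℝ) (f := ω) (C := ε * ‖x - y‖)
        (fun w _ => h.differentiable (by norm_num) w) hfd
        (mem_closedBall_self (norm_nonneg _)) (y := x) (by simp [dist_eq_norm])
    rw [Real.norm_eq_abs] at this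
    refine this.trans (le_of_eq (by ring))
  have hsub : ω '' C ⊆ ω '' (C ∩ closedBall 0 R) ∪ {0} := by
    rintro _ ⟨x, hx, rfl⟩
    by_cases hxR : ‖x‖ ≤ R
    · left; exact ⟨x, ⟨hx, by simpa using hxR⟩, rfl⟩
    · right
      by_contra hne
      exact hxR (hR x (subset_tsupport _ hne)).le
  refine measure_mono_null hsub (measure_union_null ?_ (by simp))
  -- grid
  have hfin : ∀ ε > 0, volume (ω '' (C ∩ closedBall 0 R)) ≤ ENNReal.ofReal (36 * R ^ 2 * ε) := by
    intro ε hε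
    obtain ⟨r, hr, hrr⟩ := hloc ε hε
    obtain ⟨n, hn⟩ := exists_nat_gt (2 * R / r)
    have hn0 : (0:ℝ) < n := lt_of_le_of_lt (by positivity) hn
    set s := R / n with hs
    have hs0 : 0 < s := by positivity
    have h2s : 2 * s ≤ r := by
      rw [hs]; rw [div_lt_iff₀ hr] at hn
      rw [← mul_div_assoc, div_le_iff₀ hn0]; linarith
    set I : Finset (ℤ × ℤ) := Finset.Icc (-(n:ℤ)) n ×ˢ Finset.Icc (-(n:ℤ)) n
    set P : ℤ × ℤ → Set E2 := fun k => {x | x ∈ C ∩ closedBall 0 R ∧ ⌊x 0 / s⌋ = k.1 ∧ ⌊x 1 / s⌋ = k.2}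
    have hcov : ω '' (C ∩ closedBall 0 R) ⊆ ⋃ k ∈ I, ω '' P k := by
      rintro _ ⟨x, hx, rfl⟩
      have hxR : ‖x‖ ≤ R := by simpa using hx.2
      have hb : ∀ j : Fin 2, ⌊x j / s⌋ ∈ Finset.Icc (-(n:ℤ)) n := by
        intro j
        have := abs_le.mp ((abs_coord_le x j).trans hxR)
        have e : R = n * s := by rw [hs]; field_simp
        rw [Finset.mem_Icc]
        constructor
        · rw [Int.le_floor, le_div_iff₀ hs0]; push_cast; linarith
        · have : ⌊x j / s⌋ ≤ ⌊(n:ℝ)⌋ := Int.floor_le_floor (by rw [div_le_iff₀ hs0]; linarith)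
          simpa using this
      refine mem_biUnion (x := (⌊x 0 / s⌋, ⌊x 1 / s⌋)) ?_ ⟨x, ⟨hx, rfl, rfl⟩, rfl⟩
      exact Finset.mem_product.mpr ⟨hb 0, hb 1⟩
    have hpiece : ∀ k, volume (ω '' P k) ≤ ENNReal.ofReal (4 * ε * s ^ 2) := by
      intro k
      refine (Real.volume_le_diam _).trans ?_
      refine ediam_le_of_forall_dist_le ?_
      rintro _ ⟨x, hx, rfl⟩ _ ⟨y, hy, rfl⟩
      have hd : ∀ j : Fin 2, |x j - y j| ≤ s := by
        intro j
        have hfl : ⌊x j / s⌋ = ⌊y j / s⌋ := by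
          fin_cases j
          · exact hx.2.1.trans hy.2.1.symm
          · exact hx.2.2.trans hy.2.2.symm
        have := (Int.abs_sub_lt_one_of_floor_eq_floor hfl).le
        rw [← sub_div, abs_div, abs_of_pos hs0, div_le_one hs0] at this
        exact this
      have hsq : ‖x - y‖ ^ 2 ≤ 4 * s ^ 2 := by
        rw [normsq_e2]
        have a0 := sq_le_sq' (by linarith [abs_le.mp (hd 0)]) (abs_le.mp (hd 0)).2
        have a1 := sq_le_sq' (by linarith [abs_le.mp (hd 1)]) (abs_le.mp (hd 1)).2
        simp only [PiLp.sub_apply]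
        nlinarith [sq_nonneg s]
      have hn2 : ‖x - y‖ ≤ r := by
        refine le_trans (abs_le_of_sq_le_sq' (b := 2 * s) (by nlinarith) (by positivity) |>.2) h2s
      rw [Real.dist_eq]
      refine (hrr y hy.1.1 x hn2).trans ?_
      nlinarith
    calc volume (ω '' (C ∩ closedBall 0 R)) ≤ volume (⋃ k ∈ I, ω '' P k) := measure_mono hcov
      _ ≤ ∑ k ∈ I, volume (ω '' P k) := measure_biUnion_finset_le _ _
      _ ≤ ∑ k ∈ I, ENNReal.ofReal (4 * ε * s ^ 2) := Finset.sum_le_sum fun k _ => hpiece k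
      _ = ENNReal.ofReal (I.card * (4 * ε * s ^ 2)) := by
          rw [Finset.sum_const, nsmul_eq_mul, ENNReal.ofReal_mul (p := (I.card : ℝ)) (by positivity), ENNReal.ofReal_natCast]
      _ ≤ ENNReal.ofReal (36 * R ^ 2 * ε) := by
          refine ENNReal.ofReal_le_ofReal ?_
          have hcard : (I.card : ℝ) = (2 * n + 1) ^ 2 := by
            simp only [I, Finset.card_product, Int.card_Icc]
            have : ((n:ℤ) + 1 - -(n:ℤ)).toNat = 2 * n + 1 := by omega
            rw [this]; push_cast; ring
          rw [hcard]
          have hn1 : (1:ℝ) ≤ n := by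
            have : 0 < n := by exact_mod_cast hn0
            exact_mod_cast this
          have e : R = n * s := by rw [hs]; field_simp
          rw [e]
          have : (2 * (n:ℝ) + 1) ^ 2 ≤ 9 * n ^ 2 := by nlinarith
          nlinarith [mul_le_mul_of_nonneg_right this (by positivity : 0 ≤ 4 * ε * s ^ 2)]
  refine le_antisymm (ENNReal.le_of_forall_pos_le_add ?_) bot_le
  intro ε hε _
  rw [zero_add]
  refine (hfin (ε / (36 * R ^ 2)) (by positivity)).trans ?_
  have : 36 * R ^ 2 * (ε / (36 * R ^ 2)) = ε := by field_simp
  rw [this]; simp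

lemma sard2 {ω : E2 → ℝ} (h : ContDiff ℝ 2 ω) (hc : HasCompactSupport ω) :
    volume (ω '' {x | fderiv ℝ ω x = 0}) = 0 := by
  have hsub : ∀ i, volume (ω '' {x | fderiv ℝ ω x = 0 ∧ fderiv ℝ (pd i ω) x ≠ 0}) = 0 := by
    intro i
    set s := {x | fderiv ℝ ω x = 0 ∧ fderiv ℝ (pd i ω) x ≠ 0} with hs
    have : ∀ x ∈ s, ∃ U ∈ nhds x, volume (ω '' ({x | fderiv ℝ ω x = 0} ∩ U)) = 0 := fun x hx =>
      sard_null_local h i x hx.2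
    choose! U hU hU0 using this
    obtain ⟨t, hts, htc, hcov⟩ := TopologicalSpace.countable_cover_nhdsWithin (s := s) (f := U)
      (fun x hx => mem_nhdsWithin_of_mem_nhds (hU x hx))
    have h1 : ω '' s ⊆ ⋃ x ∈ t, ω '' ({x | fderiv ℝ ω x = 0} ∩ U x) := by
      rintro _ ⟨x, hx, rfl⟩
      obtain ⟨y, hy, hxy⟩ := mem_iUnion₂.mp (hcov hx)
      exact mem_iUnion₂.mpr ⟨y, hy, ⟨x, ⟨hx.1, hxy⟩, rfl⟩⟩
    refine measure_mono_null h1 ?_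
    rw [measure_biUnion_null_iff htc]
    exact fun x hx => hU0 x (hts hx)
  refine measure_mono_null (t := (ω '' {x | fderiv ℝ ω x = 0 ∧ ∀ i, fderiv ℝ (pd i ω) x = 0}) ∪
    ((ω '' {x | fderiv ℝ ω x = 0 ∧ fderiv ℝ (pd 0 ω) x ≠ 0}) ∪ (ω '' {x | fderiv ℝ ω x = 0 ∧ fderiv ℝ (pd 1 ω) x ≠ 0}))) ?_
    (measure_union_null (sard_c1 h hc) (measure_union_null (hsub 0) (hsub 1)))
  rintro _ ⟨x, hx, rfl⟩
  by_cases h0 : fderiv ℝ (pd 0 ω) x = 0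
  · by_cases h1 : fderiv ℝ (pd 1 ω) x = 0
    · left; refine ⟨x, ⟨hx, fun i => ?_⟩, rfl⟩
      fin_cases i
      · exact h0
      · exact h1
    · right; right; exact ⟨x, ⟨hx, h1⟩, rfl⟩
  · right; left; exact ⟨x, ⟨hx, h0⟩, rfl⟩

/-- The gradients of `u` and `ω` are parallel. -/
lemma parallel {ω u : E2 → ℝ} (h : ContDiff ℝ 2 ω) (hc : HasCompactSupport ω) (hu : ContDiff ℝ 2 u)
    (hrot : ∀ c : ℝ, (∀ x, ω x = c → fderiv ℝ ω x ≠ 0) →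
      ∀ x, ω x = c → ∀ y ∈ connectedComponentIn {z | ω z = c} x, u y = u x) (x₀ : E2) :
    pd 0 u x₀ * pd 1 ω x₀ = pd 1 u x₀ * pd 0 ω x₀ := by
  by_contra hne
  set F : E2 → ℝ × ℝ := fun x => (u x, ω x) with hF
  set L : E2 →L[ℝ] ℝ × ℝ := (fderiv ℝ u x₀).prod (fderiv ℝ ω x₀) with hL
  have hinj : Function.Injective (L : E2 →ₗ[ℝ] ℝ × ℝ) := by
    rw [← LinearMap.ker_eq_bot, LinearMap.ker_eq_bot']
    intro v hv
    have h1 : fderiv ℝ u x₀ v = 0 := congrArg Prod.fst hv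
    have h2 : fderiv ℝ ω x₀ v = 0 := congrArg Prod.snd hv
    rw [fderiv_e2] at h1 h2
    have hne' : pd 0 u x₀ * pd 1 ω x₀ - pd 1 u x₀ * pd 0 ω x₀ ≠ 0 := sub_ne_zero.mpr hne
    have a0 : v 0 * (pd 0 u x₀ * pd 1 ω x₀ - pd 1 u x₀ * pd 0 ω x₀) = 0 := by
      linear_combination pd 1 ω x₀ * h1 - pd 1 u x₀ * h2
    have a1 : v 1 * (pd 0 u x₀ * pd 1 ω x₀ - pd 1 u x₀ * pd 0 ω x₀) = 0 := by
      linear_combination pd 0 u x₀ * h2 - pd 0 ω x₀ * h1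
    ext i; fin_cases i
    · simpa [hne'] using a0
    · simpa [hne'] using a1
  set Le : E2 ≃L[ℝ] ℝ × ℝ := (LinearEquiv.ofInjectiveOfFinrankEq (L : E2 →ₗ[ℝ] ℝ × ℝ) hinj (by simp)).toContinuousLinearEquiv with hLe
  have hLL : (Le : E2 →L[ℝ] ℝ × ℝ) = L := by ext v <;> rfl
  have hst : HasStrictFDerivAt F (Le : E2 →L[ℝ] ℝ × ℝ) x₀ := by
    rw [hLL]
    exact (hu.contDiffAt.hasStrictFDerivAt (by norm_num)).prodMk (h.contDiffAt.hasStrictFDerivAt (by norm_num))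
  set Φ := hst.toOpenPartialHomeomorph F with hΦ
  have hmem : F x₀ ∈ Φ.target := hst.image_mem_toOpenPartialHomeomorph_target
  obtain ⟨r, hr, hball⟩ := Metric.isOpen_iff.mp Φ.open_target _ hmem
  have hcr : ∃ c ∈ Ioo (ω x₀ - r) (ω x₀ + r), c ∉ ω '' {x | fderiv ℝ ω x = 0} := by
    by_contra hcon
    push Not at hcon
    have h1 : volume (Ioo (ω x₀ - r) (ω x₀ + r)) = 0 := measure_mono_null hcon (sard2 h hc)
    rw [Real.volume_Ioo] at h1
    simp at h1
    linarith
  obtain ⟨c, hcI, hcn⟩ := hcr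
  have hreg : ∀ x, ω x = c → fderiv ℝ ω x ≠ 0 := fun x hx h0 => hcn ⟨x, h0, hx⟩
  set S : Set (ℝ × ℝ) := ball (u x₀) r ×ˢ {c} with hS
  have hST : S ⊆ Φ.target := by
    rintro ⟨a, b⟩ ⟨ha, hb⟩
    apply hball
    rw [← ball_prod_same]
    refine ⟨ha, ?_⟩
    have hb' : b = c := hb
    rw [hb', Real.ball_eq_Ioo]; exact hcI
  have hSc : IsPreconnected S := (convex_ball _ _).isPreconnected.prod isPreconnected_singleton
  have hright : ∀ p ∈ S, F (Φ.symm p) = p := fun p hp => Φ.right_inv (hST hp)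
  have himg : IsPreconnected (Φ.symm '' S) := hSc.image _ (Φ.continuousOn_symm.mono hST)
  have hsubl : Φ.symm '' S ⊆ {z | ω z = c} := by
    rintro _ ⟨p, hp, rfl⟩
    have := congrArg Prod.snd (hright p hp)
    exact this.trans hp.2
  have m1 : ((u x₀, c) : ℝ × ℝ) ∈ S := ⟨mem_ball_self hr, rfl⟩
  have m2 : ((u x₀ + r / 2, c) : ℝ × ℝ) ∈ S := ⟨by simp [abs_of_pos hr]; linarith, rfl⟩
  have := hrot c hreg (Φ.symm (u x₀, c)) (hsubl ⟨_, m1, rfl⟩) (Φ.symm (u x₀ + r / 2, c))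
    (himg.subset_connectedComponentIn ⟨_, m1, rfl⟩ hsubl ⟨_, m2, rfl⟩)
  have e1 := congrArg Prod.fst (hright _ m1)
  have e2 := congrArg Prod.fst (hright _ m2)
  simp only [hF] at e1 e2
  linarith

lemma ci {φ : E2 → ℝ} (h : Continuous φ) (hc : HasCompactSupport φ) : Integrable φ :=
  h.integrable_of_hasCompactSupport hc

lemma far_bound {k ω : E2 → ℝ} (h : Continuous ω) (hc : HasCompactSupport ω) {R0 : ℝ}
    (hR : ∀ y, ω y ≠ 0 → ‖y‖ ≤ R0) {x : E2} (hx : 2 * R0 ≤ ‖x‖) {B : ℝ}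
    (hk : ∀ z, ‖x‖ / 2 ≤ ‖z‖ → ‖z‖ ≤ 2 * ‖x‖ → |k z| ≤ B) :
    |cv k ω x| ≤ B * ∫ y, |ω y| := by
  rw [cv_comm, ← integral_const_mul, ← Real.norm_eq_abs]
  refine norm_integral_le_of_norm_le ((ci h hc).norm.const_mul B) ?_
  filter_upwards with y
  rw [Real.norm_eq_abs, abs_mul]
  by_cases hy : ω y = 0
  · simp [hy]
  have h1 := hR y hy
  have h2 := norm_sub_norm_le x y
  have h3 := norm_sub_le x y
  exact mul_le_mul_of_nonneg_right (hk _ (by linarith) (by linarith [norm_nonneg y])) (abs_nonneg _)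

lemma supp_bound {ω : E2 → ℝ} (hc : HasCompactSupport ω) : ∃ R0 > 0, ∀ y, ω y ≠ 0 → ‖y‖ ≤ R0 := by
  obtain ⟨R, hR0, hR⟩ := hc.isCompact.isBounded.exists_pos_norm_lt
  exact ⟨R, hR0, fun y hy => (hR y (subset_tsupport _ hy)).le⟩

lemma newton_pd_bound {ω : E2 → ℝ} (h : ContDiff ℝ 2 ω) (hc : HasCompactSupport ω) :
    ∃ C R, 0 < C ∧ 0 < R ∧ ∀ x : E2, R ≤ ‖x‖ → ∀ i, |pd i (newtonConv ω) x| ≤ C / ‖x‖ := by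
  obtain ⟨R0, hR0, hR⟩ := supp_bound hc
  have hI : 0 ≤ ∫ y, |ω y| := integral_nonneg fun y => abs_nonneg _
  refine ⟨(1 / (2 * Real.pi)) * 2 * (∫ y, |ω y|) + 1, 2 * R0, by positivity, by positivity, ?_⟩
  intro x hx i
  have hx0 : 0 < ‖x‖ := by linarith
  have h1 := far_bound (k := Kk i) h.continuous hc hR hx (B := 2 / ‖x‖) (by
    intro z hz _
    refine (Kk_le i z).trans ?_
    rw [inv_eq_one_div, div_le_div_iff₀ (by linarith) hx0]; linarith)
  rw [newton_pd h hc]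
  simp only
  rw [abs_mul, abs_neg, abs_of_pos (by positivity : 0 < 1 / (2 * Real.pi))]
  calc _ ≤ (1 / (2 * Real.pi)) * (2 / ‖x‖ * ∫ y, |ω y|) := by gcongr
    _ = ((1 / (2 * Real.pi)) * 2 * (∫ y, |ω y|)) / ‖x‖ := by ring
    _ ≤ _ := by gcongr; linarith

lemma newton_little {ω : E2 → ℝ} (h : ContDiff ℝ 2 ω) (hc : HasCompactSupport ω) {κ : ℝ} (hκ : 0 < κ) :
    ∃ R, 0 < R ∧ ∀ x : E2, R ≤ ‖x‖ → |newtonConv ω x| ≤ κ * ‖x‖ := by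
  obtain ⟨R0, hR0, hR⟩ := supp_bound hc
  have hI : 0 ≤ ∫ y, |ω y| := integral_nonneg fun y => abs_nonneg _
  set C := (1 / (2 * Real.pi)) * (∫ y, |ω y|) + 1 with hC
  have hC0 : 0 < C := by positivity
  obtain ⟨R1, hR1⟩ := eventually_atTop.mp (Real.isLittleO_log_id_atTop.def (by positivity : 0 < κ / (2 * C)))
  refine ⟨max (2 * R0) (max 2 R1), lt_of_lt_of_le two_pos ((le_max_left _ _).trans (le_max_right _ _)), ?_⟩
  intro x hx
  have hx1 : 2 * R0 ≤ ‖x‖ := (le_max_left _ _).trans hx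
  have hx2 : 2 ≤ ‖x‖ := ((le_max_left _ _).trans (le_max_right _ _)).trans hx
  have hx3 : R1 ≤ ‖x‖ := ((le_max_right _ _).trans (le_max_right _ _)).trans hx
  have hlog := hR1 (2 * ‖x‖) (by linarith)
  simp only [id, Real.norm_eq_abs] at hlog
  have hl0 : 0 ≤ Real.log (2 * ‖x‖) := Real.log_nonneg (by linarith)
  rw [abs_of_nonneg hl0, abs_of_nonneg (by positivity)] at hlog
  have h1 := far_bound (k := lk) h.continuous hc hR hx1 (B := Real.log (2 * ‖x‖)) (by
    intro z hz hz'
    unfold lk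
    rw [abs_of_nonneg (Real.log_nonneg (by linarith))]
    exact Real.log_le_log (by linarith) hz')
  rw [newton_eq]
  simp only
  rw [abs_mul, abs_neg, abs_of_pos (by positivity : 0 < 1 / (2 * Real.pi))]
  calc _ ≤ (1 / (2 * Real.pi)) * (Real.log (2 * ‖x‖) * ∫ y, |ω y|) := by gcongr
    _ = ((1 / (2 * Real.pi)) * ∫ y, |ω y|) * Real.log (2 * ‖x‖) := by ring
    _ ≤ C * Real.log (2 * ‖x‖) := by gcongr; rw [hC]; linarith
    _ ≤ C * (κ / (2 * C) * (2 * ‖x‖)) := by gcongr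
    _ = κ * ‖x‖ := by field_simp

lemma newton_log {ω : E2 → ℝ} (h : ContDiff ℝ 2 ω) (hc : HasCompactSupport ω) (hpos : ∀ x, 0 ≤ ω x) :
    ∃ R, 0 < R ∧ ∀ x : E2, R ≤ ‖x‖ → newtonConv ω x ≤ -((∫ y, ω y) / (2 * Real.pi)) * Real.log (‖x‖ / 2) := by
  obtain ⟨R0, hR0, hR⟩ := supp_bound hc
  refine ⟨2 * R0, by positivity, fun x hx => ?_⟩
  rw [newton_eq]
  simp only
  rw [cv_comm]
  have : Real.log (‖x‖ / 2) * ∫ y, ω y ≤ ∫ y, lk (x - y) * ω y := by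
    rw [← integral_const_mul]
    refine integral_mono ((h.continuous.integrable_of_hasCompactSupport hc).const_mul _) ?_ ?_
    · have := (cv_integrable lk_locInt h.continuous hc x).comp_sub_left x
      simpa using this
    · intro y
      simp only
      by_cases hy : ω y = 0
      · simp [hy]
      have h1 := hR y hy
      have h2 := norm_sub_norm_le x y
      exact mul_le_mul_of_nonneg_right (Real.log_le_log (by linarith) (by linarith)) (hpos y)
  have hp : 0 < 1 / (2 * Real.pi) := by positivity
  have h2 := mul_le_mul_of_nonneg_left this hp.le
  calc _ = -(1 / (2 * Real.pi) * ∫ y, lk (x - y) * ω y) := by ring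
    _ ≤ -(1 / (2 * Real.pi) * (Real.log (‖x‖ / 2) * ∫ y, ω y)) := by linarith
    _ = _ := by ring

lemma superlevel_bdd {ω : E2 → ℝ} (h : ContDiff ℝ 2 ω) (hc : HasCompactSupport ω) {l : ℝ} (hl : 0 ≤ l)
    (hpos : ∀ x, 0 ≤ ω x + l) (hne : ∃ x, ω x ≠ 0) (T : ℝ) :
    ∃ R, 0 < R ∧ ∀ x, T ≤ newtonConv ω x - l / 4 * ‖x‖ ^ 2 → ‖x‖ < R := by
  rcases hl.eq_or_lt with hl | hl
  · subst hl
    simp only [add_zero] at hpos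
    obtain ⟨R, hR, H⟩ := newton_log h hc hpos
    have hm : 0 < ∫ y, ω y := by
      rw [integral_pos_iff_support_of_nonneg hpos (h.continuous.integrable_of_hasCompactSupport hc)]
      obtain ⟨x, hx⟩ := hne
      exact (h.continuous.isOpen_support).measure_pos _ ⟨x, hx⟩
    set c := (∫ y, ω y) / (2 * Real.pi) with hcd
    have hc0 : 0 < c := by positivity
    refine ⟨max R (2 * Real.exp ((1 - T) / c)), lt_max_of_lt_left hR, fun x hx => ?_⟩
    by_contra hn
    push Not at hn
    have h1 := H x ((le_max_left _ _).trans hn)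
    have h2 : 2 * Real.exp ((1 - T) / c) ≤ ‖x‖ := (le_max_right _ _).trans hn
    have h3 : (1 - T) / c ≤ Real.log (‖x‖ / 2) := by
      rw [Real.le_log_iff_exp_le (by have := Real.exp_pos ((1 - T) / c); linarith)]
      linarith
    have h4 : 1 - T ≤ c * Real.log (‖x‖ / 2) := by
      calc 1 - T = c * ((1 - T) / c) := by field_simp
        _ ≤ _ := by gcongr
    simp at hx
    linarith
  · obtain ⟨R, hR, H⟩ := newton_little h hc (one_pos)
    refine ⟨max R (max 1 (4 * (2 + |T|) / l)), lt_max_of_lt_left hR, fun x hx => ?_⟩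
    by_contra hn
    push Not at hn
    have h1 := H x ((le_max_left _ _).trans hn)
    have h2 : 1 ≤ ‖x‖ := ((le_max_left _ _).trans (le_max_right _ _)).trans hn
    have h3 : 4 * (2 + |T|) / l ≤ ‖x‖ := ((le_max_right _ _).trans (le_max_right _ _)).trans hn
    rw [div_le_iff₀ hl] at h3
    have h4 := (abs_le.mp h1).2
    have h5 := (abs_le.mp (le_refl |T|)).1
    nlinarith [abs_nonneg T]

/-- smooth transition from `0` (for `s ≤ 0`) to `1` (for `s ≥ ε`) -/
def bt (ε s : ℝ) : ℝ := Real.smoothTransition (s / ε)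
/-- its derivative -/
def db (ε s : ℝ) : ℝ := deriv (bt ε) s

lemma bt_contDiff (ε : ℝ) : ContDiff ℝ 3 (bt ε) :=
  (Real.smoothTransition.contDiff (n := 3)).comp (contDiff_id.div_const ε)
lemma bt_cont (ε : ℝ) : Continuous (bt ε) := (bt_contDiff ε).continuous
lemma bt_nonneg (ε s : ℝ) : 0 ≤ bt ε s := Real.smoothTransition.nonneg _
lemma bt_le_one (ε s : ℝ) : bt ε s ≤ 1 := Real.smoothTransition.le_one _
lemma bt_zero {ε s : ℝ} (hε : 0 < ε) (h : s ≤ 0) : bt ε s = 0 :=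
  Real.smoothTransition.zero_of_nonpos (div_nonpos_of_nonpos_of_nonneg h hε.le)
lemma bt_one {ε s : ℝ} (hε : 0 < ε) (h : ε ≤ s) : bt ε s = 1 :=
  Real.smoothTransition.one_of_one_le ((one_le_div hε).mpr h)
lemma bt_mono {ε : ℝ} (hε : 0 < ε) : Monotone (bt ε) := fun _ _ h =>
  Real.smoothTransition.monotone (div_le_div_of_nonneg_right h hε.le)
lemma bt_hasDeriv (ε s : ℝ) : HasDerivAt (bt ε) (db ε s) s :=
  ((bt_contDiff ε).differentiable (by norm_num) s).hasDerivAt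
lemma db_contDiff (ε : ℝ) : ContDiff ℝ 1 (db ε) := by
  have : ContDiff ℝ (1 + 1) (bt ε) := (bt_contDiff ε).of_le (by norm_num)
  exact (contDiff_succ_iff_deriv.mp this).2.2
lemma db_cont (ε : ℝ) : Continuous (db ε) := (db_contDiff ε).continuous
lemma db_nonneg {ε : ℝ} (hε : 0 < ε) (s : ℝ) : 0 ≤ db ε s := (bt_mono hε).deriv_nonneg
lemma db_zero_left {ε s : ℝ} (hε : 0 < ε) (h : s ≤ 0) : db ε s = 0 := by
  refine IsLocalMin.deriv_eq_zero ?_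
  filter_upwards with y
  rw [bt_zero hε h]; exact bt_nonneg _ _
lemma db_zero_right {ε s : ℝ} (hε : 0 < ε) (h : ε ≤ s) : db ε s = 0 := by
  refine IsLocalMax.deriv_eq_zero ?_
  filter_upwards with y
  rw [bt_one hε h]; exact bt_le_one _ _

structure Setup (u f : E2 → ℝ) : Prop where
  hu : ContDiff ℝ 2 u
  hf : ContDiff ℝ 2 f
  f0 : ∀ x, 0 ≤ f x
  lap : ∀ x, pd 0 (pd 0 u) x + pd 1 (pd 1 u) x = - f x
  par : ∀ x, pd 0 u x * pd 1 f x = pd 1 u x * pd 0 f x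
  bdd : ∀ T, ∃ R, 0 < R ∧ ∀ x, T ≤ u x → ‖x‖ < R

lemma Setup.hcs {u f : E2 → ℝ} (S : Setup u f) {φ : E2 → ℝ} {t : ℝ} (h : ∀ x, u x < t → φ x = 0) : HasCompactSupport φ := by
  obtain ⟨R, _, hR⟩ := S.bdd t
  refine HasCompactSupport.intro (isCompact_closedBall (0:E2) R) fun x hx => h x ?_
  by_contra hn
  push Not at hn
  exact hx (by simpa using (hR x hn).le)

lemma exterior_preconnected {R : ℝ} (hR : 0 < R) : IsPreconnected {x : E2 | R < ‖x‖} := by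
  have h1 : IsPreconnected (sphere (0:E2) 1) := isPreconnected_sphere (by rw [← Module.finrank_eq_rank]; simp) 0 1
  have h2 := (isPreconnected_Ioi (a := R)).prod h1
  have h3 := h2.image (fun p : ℝ × E2 => p.1 • p.2) (by fun_prop)
  convert h3 using 1
  ext x
  constructor
  · intro hx
    have hx' : R < ‖x‖ := hx
    have : ‖x‖ ≠ 0 := by linarith
    refine ⟨(‖x‖, ‖x‖⁻¹ • x), ⟨hx, ?_⟩, ?_⟩
    · simp [norm_smul, this]
    · simp [smul_smul, this]
  · rintro ⟨⟨r, s⟩, ⟨hr, hs⟩, rfl⟩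
    have hr' : R < r := hr
    have hs' : ‖s‖ = 1 := by simpa using hs
    simp [norm_smul, hs', abs_of_pos (hR.trans hr')]
    exact hr'

lemma fderiv_zero_of_pd {φ : E2 → ℝ} {x : E2} (h0 : pd 0 φ x = 0) (h1 : pd 1 φ x = 0) : fderiv ℝ φ x = 0 := by
  ext v
  rw [fderiv_e2, h0, h1]; simp

/-- Along a line. -/
lemma line_deriv {φ : E2 → ℝ} (h : Differentiable ℝ φ) (x : E2) (i : Fin 2) (s : ℝ) :
    HasDerivAt (fun s : ℝ => φ (x + s • EuclideanSpace.single i 1)) (pd i φ (x + s • EuclideanSpace.single i 1)) s := by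
  have h1 : HasDerivAt (fun s : ℝ => x + s • EuclideanSpace.single i (1:ℝ)) (EuclideanSpace.single i 1) s := by
    simpa using ((hasDerivAt_id s).smul_const (EuclideanSpace.single i (1:ℝ))).const_add x
  exact ((h _).hasFDerivAt).comp_hasDerivAt s h1

lemma pd2_nonneg_of_min {v : E2 → ℝ} (h : ContDiff ℝ 2 v) {x : E2} (hm : IsLocalMin v x) (i : Fin 2) :
    0 ≤ pd i (pd i v) x := by
  by_contra hn
  push Not at hn
  set φ : ℝ → ℝ := fun s => v (x + s • EuclideanSpace.single i 1) with hφ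
  have d1 : deriv φ = fun s => pd i v (x + s • EuclideanSpace.single i 1) := by
    ext s; exact (line_deriv (h.differentiable (by norm_num)) x i s).deriv
  have d2 : deriv (deriv φ) 0 = pd i (pd i v) x := by
    rw [d1, (line_deriv ((pd_contDiff h i).differentiable (by norm_num)) x i 0).deriv]; simp
  have hcont : Continuous (fun s : ℝ => x + s • EuclideanSpace.single i (1:ℝ)) := by fun_prop
  have hmin : IsLocalMin φ 0 := by
    have : Tendsto (fun s : ℝ => x + s • EuclideanSpace.single i (1:ℝ)) (nhds 0) (nhds x) := by
      have := hcont.tendsto 0; simpa using this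
    filter_upwards [this.eventually hm] with s hs
    simpa [hφ] using hs
  have hmax : IsLocalMax φ 0 := isLocalMax_of_deriv_deriv_neg (by rw [d2]; exact hn) hmin.deriv_eq_zero
    (h.continuous.comp hcont).continuousAt
  have heq : φ =ᶠ[nhds 0] fun _ => φ 0 := by
    filter_upwards [hmin, hmax] with s h1 h2 using le_antisymm h2 h1
  have := heq.deriv.deriv_eq
  rw [d2] at this
  simp at this
  linarith

lemma Setup.primitive {u f : E2 → ℝ} (S : Setup u f) {G : E2 → ℝ} (hG : ContDiff ℝ 1 G)
    (hpar : ∀ x, pd 0 G x * pd 1 u x = pd 1 G x * pd 0 u x) {t : ℝ} (hz : ∀ x, u x < t → G x = 0) :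
    ∃ A : E2 → ℝ, ContDiff ℝ 1 A ∧ (∀ i x, pd i A x = G x * pd i u x) ∧ ∀ x, u x < t → A x = 0 := by
  have hdu : ContDiff ℝ 1 (fderiv ℝ u) := S.hu.fderiv_right (by norm_num)
  set w : E2 → (E2 →L[ℝ] ℝ) := fun x => G x • fderiv ℝ u x with hw
  have hwc : ContDiff ℝ 1 w := hG.smul hdu
  obtain ⟨A₀, hA₀⟩ := (convex_univ (𝕜 := ℝ) (E := E2)).exists_forall_hasFDerivAt_of_fderiv_symmetric isOpen_univ
    (ω := w) (hwc.differentiable (by norm_num)).differentiableOn (by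
      intro a _ x y
      have h1 : HasFDerivAt w (G a • fderiv ℝ (fderiv ℝ u) a + (fderiv ℝ G a).smulRight (fderiv ℝ u a)) a :=
        ((hG.differentiable (by norm_num) a).hasFDerivAt).smul ((hdu.differentiable (by norm_num) a).hasFDerivAt)
      rw [h1.fderiv]
      have h2 : fderiv ℝ (fderiv ℝ u) a x y = fderiv ℝ (fderiv ℝ u) a y x :=
        (S.hu.contDiffAt (x := a)).isSymmSndFDerivAt (by simp) x y
      simp only [add_apply, smul_apply, ContinuousLinearMap.smulRight_apply, smul_eq_mul, h2]
      rw [fderiv_e2, fderiv_e2, fderiv_e2, fderiv_e2]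
      linear_combination (x 0 * y 1 - x 1 * y 0) * hpar a)
  have hfd : ∀ x, HasFDerivAt A₀ (w x) x := fun x => hA₀ x (mem_univ _)
  obtain ⟨R, hR0, hR⟩ := S.bdd t
  have hext : ∀ x, R < ‖x‖ → u x < t := fun x hx => by
    by_contra hn; push Not at hn; linarith [hR x hn]
  have hw0 : ∀ x, u x < t → fderiv ℝ A₀ x = 0 := fun x hx => by
    rw [(hfd x).fderiv, hw]; simp [hz x hx]
  have hdA : Differentiable ℝ A₀ := fun x => (hfd x).differentiableAt
  obtain ⟨a, ha⟩ := IsOpen.exists_is_const_of_fderiv_eq_zero (𝕜 := ℝ) (f := A₀) (s := {x : E2 | R < ‖x‖})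
    (isOpen_lt continuous_const continuous_norm) (exterior_preconnected hR0) hdA.differentiableOn
    (fun x hx => hw0 x (hext x hx))
  set A : E2 → ℝ := fun x => A₀ x - a with hA
  have hfdA : ∀ x, HasFDerivAt A (w x) x := fun x => (hfd x).sub_const a
  have hAc : Continuous A := continuous_iff_continuousAt.mpr fun x => (hfdA x).continuousAt
  refine ⟨A, ?_, ?_, ?_⟩
  · rw [contDiff_one_iff_fderiv]
    refine ⟨fun x => (hfdA x).differentiableAt, ?_⟩
    have : fderiv ℝ A = w := by ext1 x; exact (hfdA x).fderiv
    rw [this]; exact hwc.continuous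
  · intro i x
    unfold pd
    rw [(hfdA x).fderiv]; simp [hw]
  intro x₁ hx₁
  by_contra hAx
  have hopen : IsOpen {x | u x < t} := isOpen_lt S.hu.continuous continuous_const
  set Sx : Set E2 := {x | u x < t ∧ A x ≠ 0} with hS
  have hloc : ∀ x, u x < t → ∀ᶠ y in nhds x, u y < t ∧ A y = A x := by
    intro x hx
    obtain ⟨r, hr, hb⟩ := Metric.isOpen_iff.mp hopen x hx
    filter_upwards [ball_mem_nhds x hr] with y hy
    refine ⟨hb hy, ?_⟩
    refine (convex_ball x r).is_const_of_fderivWithin_eq_zero (𝕜 := ℝ) (f := A) (fun z _ => (hfdA z).differentiableAt.differentiableWithinAt) ?_ hy (mem_ball_self hr)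
    intro z hz'
    rw [fderivWithin_of_isOpen isOpen_ball hz', (hfdA z).fderiv, ← (hfd z).fderiv]
    exact hw0 z (hb hz')
  have hSb : Sx ⊆ closedBall 0 R := by
    rintro x ⟨hx1, hx2⟩
    by_contra hn
    have : R < ‖x‖ := by simpa using hn
    exact hx2 (by simp only [hA]; rw [ha x this, sub_self])
  have hcomp : IsCompact (closure Sx) := (isCompact_closedBall (0:E2) R).of_isClosed_subset isClosed_closure
    (closure_minimal hSb isClosed_closedBall)
  set κ := (t - u x₁) / (2 * R ^ 2) with hκ
  have hκ0 : 0 < κ := div_pos (by linarith) (by positivity)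
  have hκR : κ * R ^ 2 = (t - u x₁) / 2 := by rw [hκ]; field_simp
  set v : E2 → ℝ := fun x => u x + (-κ) * (x 0 * x 0 + x 1 * x 1) with hv
  have hq : ∀ j : Fin 2, ContDiff ℝ 2 (fun x : E2 => x j * x j) := fun j => (coord_contDiff j).mul (coord_contDiff j)
  have hqq : ContDiff ℝ 2 (fun x : E2 => x 0 * x 0 + x 1 * x 1) := (hq 0).add (hq 1)
  have hvc : ContDiff ℝ 2 v := S.hu.add (contDiff_const.mul hqq)
  have hpq : ∀ i : Fin 2, pd i v = fun x => pd i u x + (-2*κ) * x i := by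
    intro i; ext x
    rw [hv, pd_add (S.hu.differentiable (by norm_num)) ((contDiff_const.mul hqq).differentiable (by norm_num)),
      pd_const_mul (hqq.differentiable (by norm_num)), pd_add ((hq 0).differentiable (by norm_num)) ((hq 1).differentiable (by norm_num)),
      pd_mul ((coord_contDiff 0 (n := 1)).differentiable (by norm_num)) ((coord_contDiff 0 (n := 1)).differentiable (by norm_num)),
      pd_mul ((coord_contDiff 1 (n := 1)).differentiable (by norm_num)) ((coord_contDiff 1 (n := 1)).differentiable (by norm_num))]
    simp only [pd_coord]
    fin_cases i <;> simp <;> ring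
  have hpp : ∀ i : Fin 2, ∀ x, pd i (pd i v) x = pd i (pd i u) x + (-2*κ) := by
    intro i x
    rw [hpq, pd_add ((pd_contDiff S.hu i).differentiable (by norm_num)) ((contDiff_const.mul (coord_contDiff i (n := 1))).differentiable (by norm_num)),
      pd_const_mul ((coord_contDiff i (n := 1)).differentiable (by norm_num)), pd_coord]
    simp
  obtain ⟨x₂, hx₂, hmin⟩ := hcomp.exists_isMinOn ⟨x₁, subset_closure ⟨hx₁, hAx⟩⟩ hvc.continuous.continuousOn
  have hle : v x₂ ≤ v x₁ := hmin (subset_closure ⟨hx₁, hAx⟩)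
  by_cases hux : u x₂ < t
  · have hl := hloc x₂ hux
    have hA2 : A x₂ ≠ 0 := by
      obtain ⟨y, hy, hyS⟩ := (mem_closure_iff_nhds.mp hx₂ _ hl)
      rw [← hy.2]; exact hyS.2
    have hlm : IsLocalMin v x₂ := by
      filter_upwards [hl] with y hy
      exact hmin (subset_closure ⟨hy.1, by rw [hy.2]; exact hA2⟩)
    have h0 := pd2_nonneg_of_min hvc hlm 0
    have h1 := pd2_nonneg_of_min hvc hlm 1
    rw [hpp] at h0 h1
    linarith [S.lap x₂, S.f0 x₂]
  · push Not at hux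
    have hb := closure_minimal hSb isClosed_closedBall hx₂
    have hb' : ‖x₂‖ ≤ R := by simpa using hb
    have h1 := normsq_e2 x₂
    have h2 := normsq_e2 x₁
    simp only [hv] at hle
    have h3 : ‖x₂‖ ^ 2 ≤ R ^ 2 := by gcongr
    have h4 : κ * ‖x₂‖ ^ 2 ≤ κ * R ^ 2 := by gcongr
    have h5 : 0 ≤ κ * ‖x₁‖ ^ 2 := by positivity
    nlinarith

lemma pd_comp {F : ℝ → ℝ} {F' : ℝ} {u : E2 → ℝ} {x : E2} {t : ℝ} (hF : HasDerivAt F F' (u x - t)) (hu : Differentiable ℝ u) (i : Fin 2) :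
    pd i (fun x => F (u x - t)) x = F' * pd i u x := by
  have h1 : HasFDerivAt (fun x => u x - t) (fderiv ℝ u x) x := ((hu x).hasFDerivAt).sub_const t
  have h2 := hF.comp_hasFDerivAt x h1
  unfold pd
  have h3 : fderiv ℝ (fun x => F (u x - t)) x = F' • fderiv ℝ u x := h2.fderiv
  rw [h3]; simp

/-- `√(f+δ)` -/
def gg (f : E2 → ℝ) (δ : ℝ) (x : E2) : ℝ := Real.sqrt (f x + δ)
/-- `β'(u - t)` -/
def bb (ε : ℝ) (u : E2 → ℝ) (t : ℝ) (x : E2) : ℝ := db ε (u x - t)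
/-- `β(u - t)` -/
def be (ε : ℝ) (u : E2 → ℝ) (t : ℝ) (x : E2) : ℝ := bt ε (u x - t)
/-- `x·∇u` -/
def xd (u : E2 → ℝ) (x : E2) : ℝ := x 0 * pd 0 u x + x 1 * pd 1 u x

namespace Setup

lemma du {u f : E2 → ℝ} (S : Setup u f) : Differentiable ℝ u := S.hu.differentiable (by norm_num)

lemma gg_sq {u f : E2 → ℝ} (S : Setup u f) {δ : ℝ} (hδ : 0 < δ) (x : E2) : gg f δ x ^ 2 = f x + δ := Real.sq_sqrt (by linarith [S.f0 x])
lemma gg_pos {u f : E2 → ℝ} (S : Setup u f) {δ : ℝ} (hδ : 0 < δ) (x : E2) : 0 < gg f δ x := Real.sqrt_pos.mpr (by linarith [S.f0 x])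
lemma gg_contDiff {u f : E2 → ℝ} (S : Setup u f) {δ : ℝ} (hδ : 0 < δ) : ContDiff ℝ 2 (gg f δ) :=
  (S.hf.add contDiff_const).sqrt (fun x => by linarith [S.f0 x])
lemma gg_pd {u f : E2 → ℝ} (S : Setup u f) {δ : ℝ} (hδ : 0 < δ) (i : Fin 2) (x : E2) : 2 * gg f δ x * pd i (gg f δ) x = pd i f x := by
  have hd := (S.gg_contDiff hδ).differentiable (by norm_num)
  have h1 := pd_mul hd hd i x
  have h2 : (fun x => gg f δ x * gg f δ x) = fun x => f x + δ := by
    ext x; rw [← sq]; exact S.gg_sq hδ x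
  rw [h2, pd_add (S.hf.differentiable (by norm_num)) (differentiable_const δ)] at h1
  have h3 : pd i (fun _ : E2 => δ) x = 0 := by simp [pd]
  rw [h3] at h1
  linarith
lemma gg_par {u f : E2 → ℝ} (S : Setup u f) {δ : ℝ} (hδ : 0 < δ) (x : E2) : pd 0 (gg f δ) x * pd 1 u x = pd 1 (gg f δ) x * pd 0 u x := by
  have h0 := S.gg_pd hδ 0 x
  have h1 := S.gg_pd hδ 1 x
  have h2 := S.par x
  have hp := S.gg_pos hδ x
  rw [← h0, ← h1] at h2
  have : 2 * gg f δ x * (pd 0 (gg f δ) x * pd 1 u x - pd 1 (gg f δ) x * pd 0 u x) = 0 := by linarith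
  rcases mul_eq_zero.mp this with h | h
  · linarith
  · linarith

lemma bb_contDiff {u f : E2 → ℝ} (S : Setup u f) (ε t : ℝ) : ContDiff ℝ 1 (bb ε u t) :=
  (db_contDiff ε).comp ((S.hu.of_le (by norm_num)).sub contDiff_const)
lemma be_contDiff {u f : E2 → ℝ} (S : Setup u f) (ε t : ℝ) : ContDiff ℝ 2 (be ε u t) :=
  ((bt_contDiff ε).of_le (by norm_num)).comp (S.hu.sub contDiff_const)
lemma bb_zero {u f : E2 → ℝ} (_S : Setup u f) {ε t : ℝ} (hε : 0 < ε) {x : E2} (h : u x < t) : bb ε u t x = 0 := db_zero_left hε (by linarith)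
lemma be_zero {u f : E2 → ℝ} (_S : Setup u f) {ε t : ℝ} (hε : 0 < ε) {x : E2} (h : u x < t) : be ε u t x = 0 := bt_zero hε (by linarith)
lemma bb_hcs {u f : E2 → ℝ} (S : Setup u f) {ε : ℝ} (hε : 0 < ε) (t : ℝ) : HasCompactSupport (bb ε u t) := S.hcs fun _ h => S.bb_zero hε h
lemma be_hcs {u f : E2 → ℝ} (S : Setup u f) {ε : ℝ} (hε : 0 < ε) (t : ℝ) : HasCompactSupport (be ε u t) := S.hcs fun _ h => S.be_zero hε h
lemma be_pd {u f : E2 → ℝ} (S : Setup u f) (ε t : ℝ) (i : Fin 2) (x : E2) : pd i (be ε u t) x = bb ε u t x * pd i u x :=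
  pd_comp (bt_hasDeriv ε _) S.du i
lemma bb_int {u f : E2 → ℝ} (S : Setup u f) {ε : ℝ} (hε : 0 < ε) (t : ℝ) {φ : E2 → ℝ} (h : Continuous φ) : Integrable (fun x => bb ε u t x * φ x) :=
  ci ((S.bb_contDiff ε t).continuous.mul h) (S.bb_hcs hε t).mul_right
lemma be_int {u f : E2 → ℝ} (S : Setup u f) {ε : ℝ} (hε : 0 < ε) (t : ℝ) {φ : E2 → ℝ} (h : Continuous φ) : Integrable (fun x => be ε u t x * φ x) :=
  ci ((S.be_contDiff ε t).continuous.mul h) (S.be_hcs hε t).mul_right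
lemma pdu_cont {u f : E2 → ℝ} (S : Setup u f) (i : Fin 2) : Continuous (pd i u) := pd_cont (S.hu.of_le (by norm_num)) i

lemma M_eq {u f : E2 → ℝ} (S : Setup u f) {ε : ℝ} (hε : 0 < ε) (t : ℝ) :
    ∫ x, bb ε u t x * (pd 0 u x ^ 2 + pd 1 u x ^ 2) = ∫ x, be ε u t x * f x := by
  have h1 : ∀ i : Fin 2, ∫ x, bb ε u t x * pd i u x ^ 2 = - ∫ x, be ε u t x * pd i (pd i u) x := by
    intro i
    rw [← ibp ((S.be_contDiff ε t).of_le (by norm_num)) (pd_contDiff S.hu i) (S.be_hcs hε t) i]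
    congr 1 with x
    rw [S.be_pd]; ring
  have e : ∀ x, bb ε u t x * (pd 0 u x ^ 2 + pd 1 u x ^ 2) = bb ε u t x * pd 0 u x ^ 2 + bb ε u t x * pd 1 u x ^ 2 := fun x => by ring
  simp only [e]
  have hi : ∀ i : Fin 2, Integrable (fun x => bb ε u t x * pd i u x ^ 2) := fun i => S.bb_int hε t ((S.pdu_cont i).pow 2)
  rw [integral_add (hi 0) (hi 1), h1, h1, ← neg_add,
    ← integral_add (S.be_int hε t (pd_cont (pd_contDiff S.hu 0) 0)) (S.be_int hε t (pd_cont (pd_contDiff S.hu 1) 1)), ← integral_neg]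
  congr 1 with x
  have := S.lap x
  linear_combination (- be ε u t x) * this

lemma exA {u f : E2 → ℝ} (S : Setup u f) {ε δ : ℝ} (hε : 0 < ε) (hδ : 0 < δ) (t : ℝ) :
    ∃ A : E2 → ℝ, ContDiff ℝ 1 A ∧ (∀ i x, pd i A x = (bb ε u t x * gg f δ x) * pd i u x) ∧ ∀ x, u x < t → A x = 0 := by
  have hg1 : ContDiff ℝ 1 (gg f δ) := (S.gg_contDiff hδ).of_le (by norm_num)
  refine S.primitive (G := fun x => bb ε u t x * gg f δ x) ((S.bb_contDiff ε t).mul hg1) ?_ ?_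
  · intro x
    have hb : ∀ i, pd i (bb ε u t) x = deriv (db ε) (u x - t) * pd i u x := fun i =>
      pd_comp ((db_contDiff ε).differentiable (by norm_num) _).hasDerivAt S.du i
    rw [pd_mul ((S.bb_contDiff ε t).differentiable (by norm_num)) (hg1.differentiable (by norm_num)),
      pd_mul ((S.bb_contDiff ε t).differentiable (by norm_num)) (hg1.differentiable (by norm_num)), hb, hb]
    linear_combination bb ε u t x * S.gg_par hδ x
  · intro x hx
    simp [S.bb_zero hε hx]

lemma A_lower {u f : E2 → ℝ} (S : Setup u f) {δ : ℝ} (hδ : 0 < δ) (T : ℝ) : ∃ C, 0 ≤ C ∧ ∀ ε, 0 < ε → ∀ t, T ≤ t → ∀ A : E2 → ℝ, ContDiff ℝ 1 A →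
    (∀ i x, pd i A x = (bb ε u t x * gg f δ x) * pd i u x) → (∀ x, u x < t → A x = 0) →
    - (1/2) * (∫ x, bb ε u t x * ((f x + δ) * xd u x)) - C * (∫ x, (be ε u (t - ε) x - be ε u (t + ε) x)) ≤ ∫ x, A x ^ 2 := by
  obtain ⟨R, hR0, hR⟩ := S.bdd T
  have hg1 : ContDiff ℝ 1 (gg f δ) := (S.gg_contDiff hδ).of_le (by norm_num)
  have hgd := hg1.differentiable (by norm_num)
  obtain ⟨L, hL⟩ := (isCompact_closedBall (0:E2) R).exists_bound_of_continuousOn (hg1.continuous_fderiv (by norm_num)).continuousOn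
  obtain ⟨B, hB⟩ := (isCompact_closedBall (0:E2) R).exists_bound_of_continuousOn hg1.continuous.continuousOn
  have hL0 : 0 ≤ L := (norm_nonneg _).trans (hL 0 (by simp [hR0.le]))
  have hB0 : 0 ≤ B := (norm_nonneg _).trans (hB 0 (by simp [hR0.le]))
  refine ⟨(2 * R * L) * (L * R) + (2 * B * (2 * R * L) + B ^ 2), by positivity, ?_⟩
  set C := (2 * R * L) * (L * R) + (2 * B * (2 * R * L) + B ^ 2) with hC
  intro ε hε t ht A hA hpA hA0
  have hAd := hA.differentiable (by norm_num)
  set β := be ε u t with hβ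
  set g := gg f δ with hg
  have hβ1 : ContDiff ℝ 1 β := (S.be_contDiff ε t).of_le (by norm_num)
  have hβd := hβ1.differentiable (by norm_num)
  set D : E2 → ℝ := fun x => A x + (-1) * (g x * β x) with hD
  have hgβ : ContDiff ℝ 1 (fun x => g x * β x) := hg1.mul hβ1
  have hD1 : ContDiff ℝ 1 D := hA.add (contDiff_const.mul hgβ)
  have hDd := hD1.differentiable (by norm_num)
  have hpD : ∀ i x, pd i D x = - (β x * pd i g x) := by
    intro i x
    rw [hD, pd_add hAd ((contDiff_const.mul hgβ).differentiable (by norm_num)), pd_const_mul (hgβ.differentiable (by norm_num)), pd_mul hgd hβd,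
      hpA, hβ, S.be_pd]
    ring
  have hD0 : ∀ x, u x < t → D x = 0 := fun x hx => by
    simp only [hD, hA0 x hx, hβ, S.be_zero hε hx]; ring
  have hβ01 : ∀ x, 0 ≤ β x ∧ β x ≤ 1 := fun x => ⟨bt_nonneg _ _, bt_le_one _ _⟩
  -- bound on D
  have hfD : ∀ x, ‖fderiv ℝ D x‖ ≤ L := by
    intro x
    have e : fderiv ℝ D x = (-(β x)) • fderiv ℝ g x := by
      ext v
      rw [fderiv_e2, hpD, hpD]
      simp only [smul_apply, smul_eq_mul]
      rw [fderiv_e2]; ring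
    rw [e, norm_smul, norm_neg, Real.norm_eq_abs, abs_of_nonneg (hβ01 x).1]
    by_cases hx : u x < t
    · rw [hβ, S.be_zero hε hx]; simpa using hL0
    · push Not at hx
      have h1 : ‖fderiv ℝ g x‖ ≤ L := hL x (by simpa using (hR x (ht.trans hx)).le)
      calc β x * ‖fderiv ℝ g x‖ ≤ 1 * L := mul_le_mul (hβ01 x).2 h1 (norm_nonneg _) zero_le_one
        _ = L := one_mul _
  have hDb : ∀ x, ‖x‖ ≤ R → |D x| ≤ 2 * R * L := by
    intro x hx
    set p : E2 := EuclideanSpace.single 0 R with hp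
    have hpn : ‖p‖ = R := by simp [hp, abs_of_pos hR0]
    have hup : u p < t := by
      by_contra hn
      push Not at hn
      have := hR p (ht.trans hn)
      linarith
    have h1 := (convex_univ (𝕜 := ℝ) (E := E2)).norm_image_sub_le_of_norm_fderiv_le (𝕜 := ℝ) (f := D) (fun z _ => hDd z) (fun z _ => hfD z) (mem_univ p) (mem_univ x)
    rw [hD0 p hup, sub_zero, Real.norm_eq_abs] at h1
    have h2 : ‖x - p‖ ≤ 2 * R := by linarith [norm_sub_le x p]
    calc |D x| ≤ L * ‖x - p‖ := h1
      _ ≤ L * (2 * R) := by gcongr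
      _ = _ := by ring
  -- Y
  set Y : E2 → ℝ := fun x => D x * D x + (2 * (g x * D x) + β x * (g x * g x)) with hY
  have hDD : ContDiff ℝ 1 (fun x => D x * D x) := hD1.mul hD1
  have hgD : ContDiff ℝ 1 (fun x => g x * D x) := hg1.mul hD1
  have hggc : ContDiff ℝ 1 (fun x => g x * g x) := hg1.mul hg1
  have hβgg : ContDiff ℝ 1 (fun x => β x * (g x * g x)) := hβ1.mul hggc
  have h2gD : ContDiff ℝ 1 (fun x => 2 * (g x * D x)) := contDiff_const.mul hgD
  have hYc : ContDiff ℝ 1 Y := hDD.add (h2gD.add hβgg)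
  have hYs : HasCompactSupport Y := S.hcs (t := t) fun x hx => by
    simp only [hY, hD0 x hx, hβ, S.be_zero hε hx]; ring
  have one_ne : (1 : WithTop ℕ∞) ≠ 0 := by norm_num
  have hpY : ∀ i x, pd i Y x = 2 * ((1 - β x) * D x * pd i g x) + bb ε u t x * ((f x + δ) * pd i u x) := by
    intro i x
    rw [hY, pd_add (hDD.differentiable one_ne) ((h2gD.add hβgg).differentiable one_ne), pd_mul hDd hDd, pd_add (h2gD.differentiable one_ne) (hβgg.differentiable one_ne),
      pd_const_mul (hgD.differentiable one_ne), pd_mul hgd hDd, pd_mul hβd (hggc.differentiable one_ne), pd_mul hgd hgd, hpD]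
    have hb : pd i β x = bb ε u t x * pd i u x := S.be_pd ε t i x
    rw [hb]
    have := S.gg_sq hδ x
    rw [← hg] at this
    rw [← this]
    ring
  have hE := euler_ibp hYc hYs
  set Q : E2 → ℝ := fun x => (1 - β x) * (D x * fderiv ℝ g x x + (2 * (g x * D x) + β x * (g x * g x))) with hQ
  have hQc : Continuous Q := by
    have c1 : Continuous (fun x => fderiv ℝ g x x) := (hg1.continuous_fderiv (by norm_num)).clm_apply continuous_id
    have c2 := hD1.continuous
    have c3 := hg1.continuous
    have c4 := hβ1.continuous
    fun_prop
  have hQs : HasCompactSupport Q := S.hcs (t := t) fun x hx => by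
    simp only [hQ, hD0 x hx, hβ, S.be_zero hε hx]; ring
  have hxdc : Continuous (fun x => (f x + δ) * xd u x) := by
    have c1 := S.pdu_cont 0
    have c2 := S.pdu_cont 1
    have c3 := S.hf.continuous
    unfold xd
    fun_prop
  have hA2 : Integrable (fun x => A x ^ 2) := ci (hA.continuous.pow 2) (S.hcs (t := t) fun x hx => by simp [hA0 x hx])
  have hid : ∀ x, (x 0 * pd 0 Y x + x 1 * pd 1 Y x) = 2 * Q x + bb ε u t x * ((f x + δ) * xd u x) + (2 * A x ^ 2 - 2 * Y x) := by
    intro x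
    rw [hpY, hpY]
    have e : A x = D x + g x * β x := by simp only [hD]; ring
    simp only [hQ, hY]
    rw [fderiv_e2, e]
    unfold xd
    ring
  have hYi := ci hYc.continuous hYs
  have hQi := ci hQc hQs
  have hbi := S.bb_int hε t hxdc
  simp only [hid] at hE
  rw [integral_add (i_add (hQi.const_mul 2) hbi) (i_sub (hA2.const_mul 2) (hYi.const_mul 2)), integral_add (hQi.const_mul 2) hbi,
    integral_sub (hA2.const_mul 2) (hYi.const_mul 2), integral_const_mul, integral_const_mul, integral_const_mul] at hE
  have hσi : Integrable (fun x => (be ε u (t - ε) x - be ε u (t + ε) x)) :=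
    (ci (S.be_contDiff ε _).continuous (S.be_hcs hε _)).sub (ci (S.be_contDiff ε _).continuous (S.be_hcs hε _))
  have hQle : ∫ x, Q x ≤ C * ∫ x, (be ε u (t - ε) x - be ε u (t + ε) x) := by
    rw [← integral_const_mul]
    refine integral_mono hQi (hσi.const_mul C) ?_
    intro x
    have hC0 : 0 ≤ C := by positivity
    have hσ0 : 0 ≤ be ε u (t - ε) x - be ε u (t + ε) x := by
      have := bt_mono hε (show u x - (t + ε) ≤ u x - (t - ε) by linarith)
      unfold be; linarith
    simp only
    by_cases h1 : u x < t
    · have : Q x = 0 := by simp only [hQ, hD0 x h1, hβ, S.be_zero hε h1]; ring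
      rw [this]; positivity
    push Not at h1
    by_cases h2 : t + ε ≤ u x
    · have : Q x = 0 := by
        have : β x = 1 := bt_one hε (by linarith)
        simp only [hQ, this]; ring
      rw [this]; positivity
    push Not at h2
    have hσ1 : be ε u (t - ε) x - be ε u (t + ε) x = 1 := by
      unfold be
      rw [bt_one hε (by linarith), bt_zero hε (by linarith)]; ring
    rw [hσ1, mul_one]
    have hxR : ‖x‖ ≤ R := (hR x (ht.trans h1)).le
    have hxm : x ∈ closedBall (0:E2) R := by simpa using hxR
    have d1 := hDb x hxR
    have d2 : |fderiv ℝ g x x| ≤ L * R := by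
      calc |fderiv ℝ g x x| ≤ ‖fderiv ℝ g x‖ * ‖x‖ := (fderiv ℝ g x).le_opNorm x
        _ ≤ L * R := mul_le_mul (hL x hxm) hxR (norm_nonneg _) hL0
    have d3 : |g x| ≤ B := hB x hxm
    have d4 := hβ01 x
    have e1 : D x * fderiv ℝ g x x ≤ (2 * R * L) * (L * R) := by
      refine (le_abs_self _).trans ?_
      rw [abs_mul]
      exact mul_le_mul d1 d2 (abs_nonneg _) (by positivity)
    have e2 : g x * D x ≤ B * (2 * R * L) := by
      refine (le_abs_self _).trans ?_
      rw [abs_mul]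
      exact mul_le_mul d3 d1 (abs_nonneg _) hB0
    have e3 : g x * g x ≤ B ^ 2 := by
      rw [← sq]; exact sq_le_sq' (by linarith [abs_le.mp d3]) (abs_le.mp d3).2
    have e4 : β x * (g x * g x) ≤ B ^ 2 := by
      nlinarith [mul_self_nonneg (g x)]
    have e5 : D x * fderiv ℝ g x x + (2 * (g x * D x) + β x * (g x * g x)) ≤ C := by rw [hC]; linarith
    simp only [hQ]
    nlinarith
  nlinarith

end Setup

/-- reflected gradient -/
def qq (f u : E2 → ℝ) (δ : ℝ) (i : Fin 2) (z : E2 × E2) : ℝ :=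
  gg f δ z.1 * (pd i u z.2 - 2 * (rr i 0 (z.1 - z.2) * pd 0 u z.2 + rr i 1 (z.1 - z.2) * pd 1 u z.2))
def pp (f u : E2 → ℝ) (δ : ℝ) (i : Fin 2) (z : E2 × E2) : ℝ := gg f δ z.2 * pd i u z.1
/-- `|p-q|²` -/
def pq (f u : E2 → ℝ) (δ : ℝ) (z : E2 × E2) : ℝ :=
  (pp f u δ 0 z - qq f u δ 0 z) ^ 2 + (pp f u δ 1 z - qq f u δ 1 z) ^ 2
def ww (ε : ℝ) (u : E2 → ℝ) (t : ℝ) (z : E2 × E2) : ℝ := bb ε u t z.1 * bb ε u t z.2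
/-- squared gradient -/
def g2 (u : E2 → ℝ) (x : E2) : ℝ := pd 0 u x ^ 2 + pd 1 u x ^ 2

lemma qq_sq (f u : E2 → ℝ) (δ : ℝ) (z : E2 × E2) : qq f u δ 0 z ^ 2 + qq f u δ 1 z ^ 2 = gg f δ z.1 ^ 2 * g2 u z.2 := by
  unfold qq rr g2
  by_cases h : z.1 - z.2 = 0
  · rw [h]; simp; ring
  · have h1 : ‖z.1 - z.2‖ ^ 2 ≠ 0 := by
      have := norm_pos_iff.mpr h
      positivity
    have h2 := normsq_e2 (z.1 - z.2)
    set v := z.1 - z.2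
    rw [h2] at h1 ⊢
    field_simp
    ring

lemma qq_perp (f u : E2 → ℝ) (δ : ℝ) (z : E2 × E2) :
    - (z.1 - z.2) 1 * qq f u δ 0 z + (z.1 - z.2) 0 * qq f u δ 1 z
      = gg f δ z.1 * (- (z.1 - z.2) 1 * pd 0 u z.2 + (z.1 - z.2) 0 * pd 1 u z.2) := by
  unfold qq rr
  ring

lemma db_sq_nonneg {ε : ℝ} (hε : 0 < ε) (u : E2 → ℝ) (t : ℝ) (z : E2 × E2) : 0 ≤ ww ε u t z :=
  mul_nonneg (db_nonneg hε _) (db_nonneg hε _)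

namespace Setup

lemma ww_cont {u f : E2 → ℝ} (S : Setup u f) (ε t : ℝ) : Continuous (ww ε u t) :=
  ((S.bb_contDiff ε t).continuous.comp continuous_fst).mul ((S.bb_contDiff ε t).continuous.comp continuous_snd)

lemma ww_hcs {u f : E2 → ℝ} (S : Setup u f) {ε : ℝ} (hε : 0 < ε) (t : ℝ) : HasCompactSupport (ww ε u t) := by
  obtain ⟨R, hR0, hR⟩ := S.bdd t
  have hb : ∀ x, R < ‖x‖ → bb ε u t x = 0 := fun x hx => S.bb_zero hε (by
    by_contra hn; push Not at hn; linarith [hR x hn])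
  refine HasCompactSupport.intro ((isCompact_closedBall (0:E2) R).prod (isCompact_closedBall (0:E2) R)) ?_
  intro z hz
  unfold ww
  by_cases h1 : ‖z.1‖ ≤ R
  · have h2 : R < ‖z.2‖ := by
      by_contra hn; push Not at hn
      exact hz ⟨by simpa using h1, by simpa using hn⟩
    simp [hb _ h2]
  · push Not at h1
    simp [hb _ h1]

lemma ww_int {u f : E2 → ℝ} (S : Setup u f) {ε : ℝ} (hε : 0 < ε) (t : ℝ) {F : E2 × E2 → ℝ} (hF : Continuous F) :
    Integrable (fun z => ww ε u t z * F z) (volume.prod volume) :=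
  ((S.ww_cont ε t).mul hF).integrable_of_hasCompactSupport (S.ww_hcs hε t).mul_right

lemma ww_sep {u f : E2 → ℝ} (_S : Setup u f) (ε t : ℝ) (a b : E2 → ℝ) :
    ∫ z, ww ε u t z * (a z.1 * b z.2) ∂(volume.prod volume) = (∫ x, bb ε u t x * a x) * (∫ x, bb ε u t x * b x) := by
  rw [← integral_prod_mul]
  congr 1 with z
  unfold ww; ring

lemma g2_cont {u f : E2 → ℝ} (S : Setup u f) : Continuous (g2 u) := ((S.pdu_cont 0).pow 2).add ((S.pdu_cont 1).pow 2)

lemma pq_le {u f : E2 → ℝ} (_S : Setup u f) (δ : ℝ) (z : E2 × E2) :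
    pq f u δ z ≤ 2 * (gg f δ z.2 ^ 2 * g2 u z.1 + gg f δ z.1 ^ 2 * g2 u z.2) := by
  have h := qq_sq f u δ z
  have h' : pp f u δ 0 z ^ 2 + pp f u δ 1 z ^ 2 = gg f δ z.2 ^ 2 * g2 u z.1 := by unfold pp g2; ring
  rw [← h, ← h']
  unfold pq
  nlinarith [sq_nonneg (pp f u δ 0 z + qq f u δ 0 z), sq_nonneg (pp f u δ 1 z + qq f u δ 1 z)]

lemma pq_nonneg {u f : E2 → ℝ} (_S : Setup u f) (δ : ℝ) (z : E2 × E2) : 0 ≤ pq f u δ z := by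
  unfold pq; positivity

lemma pq_meas {u f : E2 → ℝ} (S : Setup u f) {δ : ℝ} (hδ : 0 < δ) : Measurable (pq f u δ) := by
  have h1 : ∀ i j : Fin 2, Measurable (fun z : E2 × E2 => rr i j (z.1 - z.2)) := fun i j =>
    (rr_meas i j).comp (measurable_fst.sub measurable_snd)
  have h2 : ∀ i : Fin 2, Measurable (pd i u) := fun i => (S.pdu_cont i).measurable
  have h3 : Measurable (gg f δ) := (S.gg_contDiff hδ).continuous.measurable
  have h4 : ∀ i, Measurable (fun z : E2 × E2 => pd i u z.1) := fun i => (h2 i).comp measurable_fst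
  have h5 : ∀ i, Measurable (fun z : E2 × E2 => pd i u z.2) := fun i => (h2 i).comp measurable_snd
  have h6 : Measurable (fun z : E2 × E2 => gg f δ z.1) := h3.comp measurable_fst
  have h7 : Measurable (fun z : E2 × E2 => gg f δ z.2) := h3.comp measurable_snd
  have h8 : ∀ i, Measurable (pp f u δ i) := fun i => h7.mul (h4 i)
  have h9 : ∀ i, Measurable (qq f u δ i) := fun i => h6.mul ((h5 i).sub ((((h1 i 0).mul (h5 0)).add ((h1 i 1).mul (h5 1))).const_mul 2))
  exact (((h8 0).sub (h9 0)).pow_const 2).add (((h8 1).sub (h9 1)).pow_const 2)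

lemma gg2_cont {u f : E2 → ℝ} (S : Setup u f) {δ : ℝ} (hδ : 0 < δ) : Continuous (fun x => gg f δ x ^ 2) :=
  (S.gg_contDiff hδ).continuous.pow 2

lemma sep_cont {a b : E2 → ℝ} (ha : Continuous a) (hb : Continuous b) : Continuous (fun z : E2 × E2 => a z.1 * b z.2) :=
  (ha.comp continuous_fst).mul (hb.comp continuous_snd)

lemma pq_int {u f : E2 → ℝ} (S : Setup u f) {ε δ : ℝ} (hε : 0 < ε) (hδ : 0 < δ) (t : ℝ) :
    Integrable (fun z => ww ε u t z * pq f u δ z) (volume.prod volume) := by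
  have hG : Continuous (fun z : E2 × E2 => 2 * (gg f δ z.2 ^ 2 * g2 u z.1 + gg f δ z.1 ^ 2 * g2 u z.2)) := by
    have h1 := (S.gg_contDiff hδ).continuous
    have h2 := S.g2_cont
    fun_prop
  refine (S.ww_int hε t hG).mono' ((S.ww_cont ε t).measurable.mul (S.pq_meas hδ)).aestronglyMeasurable ?_
  filter_upwards with z
  rw [Real.norm_eq_abs, abs_of_nonneg (mul_nonneg (db_sq_nonneg hε u t z) (S.pq_nonneg δ z))]
  exact mul_le_mul_of_nonneg_left (S.pq_le δ z) (db_sq_nonneg hε u t z)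

/-- `m_t` -/
def mm {u f : E2 → ℝ} (_S : Setup u f) (ε δ t : ℝ) : ℝ := ∫ x, bb ε u t x * (f x + δ)
/-- `M_t` -/
def MM {u f : E2 → ℝ} (_S : Setup u f) (ε t : ℝ) : ℝ := ∫ x, bb ε u t x * g2 u x
/-- `2 I_t` -/
def II {u f : E2 → ℝ} (_S : Setup u f) (ε δ t : ℝ) : ℝ := ∫ z, ww ε u t z * pq f u δ z ∂(volume.prod volume)

lemma sum_sep {u f : E2 → ℝ} (S : Setup u f) {ε δ : ℝ} (hε : 0 < ε) (hδ : 0 < δ) (t : ℝ) :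
    ∫ z, ww ε u t z * (g2 u z.1 * (f z.2 + δ) + (f z.1 + δ) * g2 u z.2) ∂(volume.prod volume) = 2 * (S.mm ε δ t * S.MM ε t) := by
  have hfc : Continuous (fun x => f x + δ) := S.hf.continuous.add continuous_const
  have e : ∀ z : E2 × E2, ww ε u t z * (g2 u z.1 * (f z.2 + δ) + (f z.1 + δ) * g2 u z.2) =
     ww ε u t z * (g2 u z.1 * (f z.2 + δ)) + ww ε u t z * ((f z.1 + δ) * g2 u z.2) := fun z => by ring
  simp only [e]
  rw [integral_add (S.ww_int hε t (sep_cont S.g2_cont hfc)) (S.ww_int hε t (sep_cont hfc S.g2_cont)),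
    S.ww_sep ε t (g2 u) (fun x => f x + δ), S.ww_sep ε t (fun x => f x + δ) (g2 u)]
  unfold mm MM
  ring

lemma II_eq {u f : E2 → ℝ} (S : Setup u f) {ε δ : ℝ} (hε : 0 < ε) (hδ : 0 < δ) (t : ℝ) {A : E2 → ℝ} (hA : ContDiff ℝ 1 A)
    (hpA : ∀ i x, pd i A x = (bb ε u t x * gg f δ x) * pd i u x) (hA0 : ∀ x, u x < t → A x = 0) :
    S.II ε δ t = 2 * (S.mm ε δ t * S.MM ε t) - 8 * Real.pi * ∫ x, A x ^ 2 := by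
  have hk := kernel_id hA (S.hcs hA0)
  have hfc : Continuous (fun x => f x + δ) := S.hf.continuous.add continuous_const
  have hi : Integrable (fun z => ww ε u t z * (g2 u z.1 * (f z.2 + δ) + (f z.1 + δ) * g2 u z.2)) (volume.prod volume) :=
    S.ww_int hε t ((sep_cont S.g2_cont hfc).add (sep_cont hfc S.g2_cont))
  have e : ∀ z : E2 × E2, (pd 0 A z.1*pd 0 A z.2 + pd 1 A z.1*pd 1 A z.2 - 2*(rr 0 0 (z.1-z.2)*(pd 0 A z.1*pd 0 A z.2) + rr 0 1 (z.1-z.2)*(pd 0 A z.1*pd 1 A z.2) + rr 1 0 (z.1-z.2)*(pd 1 A z.1*pd 0 A z.2) + rr 1 1 (z.1-z.2)*(pd 1 A z.1*pd 1 A z.2)))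
      = (1/2) * (ww ε u t z * (g2 u z.1 * (f z.2 + δ) + (f z.1 + δ) * g2 u z.2) - ww ε u t z * pq f u δ z) := by
    intro z
    have h1 := qq_sq f u δ z
    have h2 := S.gg_sq hδ z.1
    have h3 := S.gg_sq hδ z.2
    have h4 : pq f u δ z = g2 u z.1 * gg f δ z.2 ^ 2 + (qq f u δ 0 z ^ 2 + qq f u δ 1 z ^ 2) - 2 * (pp f u δ 0 z * qq f u δ 0 z + pp f u δ 1 z * qq f u δ 1 z) := by
      unfold pq pp g2; ring
    rw [h4, h1, h2, h3]
    simp only [hpA]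
    unfold ww pp qq
    ring
  simp only [e] at hk
  rw [integral_const_mul, integral_sub hi (S.pq_int hε hδ t), S.sum_sep hε hδ] at hk
  unfold II
  linarith

/-- zero mean facts -/
lemma zero_mean {u f : E2 → ℝ} (S : Setup u f) {ε δ : ℝ} (hε : 0 < ε) (hδ : 0 < δ) (t : ℝ) (i : Fin 2) :
    ∫ x, bb ε u t x * (gg f δ x * pd i u x) = 0 := by
  obtain ⟨A, hA, hpA, hA0⟩ := S.exA hε hδ t
  rw [← integral_pd_zero hA (S.hcs hA0) i]
  congr 1 with x
  rw [hpA]; ring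

lemma zero_rot {u f : E2 → ℝ} (S : Setup u f) {ε δ : ℝ} (hε : 0 < ε) (hδ : 0 < δ) (t : ℝ) (c : E2) :
    ∫ x, bb ε u t x * (gg f δ x * (-(x 1 - c 1) * pd 0 u x + (x 0 - c 0) * pd 1 u x)) = 0 := by
  obtain ⟨A, hA, hpA, hA0⟩ := S.exA hε hδ t
  have hc := S.hcs hA0
  have h1 : ∀ i j : Fin 2, i ≠ j → ∫ x, pd i A x * x j = 0 := by
    intro i j hij
    rw [ibp hA (coord_contDiff j) hc i]
    simp [pd_coord, hij]
  have i1 : ∀ i j : Fin 2, Integrable (fun x => pd i A x * x j) := fun i j => ci ((pd_cont hA i).mul (coord_cont j)) (pd_hcs hc i).mul_right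
  have i2 : ∀ i : Fin 2, Integrable (pd i A) := fun i => ci (pd_cont hA i) (pd_hcs hc i)
  have e : ∀ x, bb ε u t x * (gg f δ x * (-(x 1 - c 1) * pd 0 u x + (x 0 - c 0) * pd 1 u x)) =
     (pd 1 A x * x 0 - c 0 * pd 1 A x) - (pd 0 A x * x 1 - c 1 * pd 0 A x) := by
    intro x
    rw [hpA, hpA]; ring
  simp only [e]
  rw [integral_sub (i_sub (i1 1 0) ((i2 1).const_mul _)) (i_sub (i1 0 1) ((i2 0).const_mul _)),
    integral_sub (i1 1 0) ((i2 1).const_mul _), integral_sub (i1 0 1) ((i2 0).const_mul _), h1 1 0 (by decide), h1 0 1 (by decide),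
    integral_const_mul, integral_const_mul, integral_pd_zero hA hc, integral_pd_zero hA hc]
  simp

end Setup

lemma young_diff {B s a b θ x : ℝ} (hθ : 0 < θ) (hx : |x| ≤ B) (hs : (a - b) ^ 2 = s) :
    |x| * |a ^ 2 - b ^ 2| ≤ B * (s / (2 * θ) + θ * (a ^ 2 + b ^ 2)) := by
  have h1 : |a ^ 2 - b ^ 2| ≤ s / (2 * θ) + θ * (a ^ 2 + b ^ 2) := by
    have h2 : |a ^ 2 - b ^ 2| = |a - b| * |a + b| := by rw [← abs_mul]; congr 1; ring
    rw [h2, ← hs]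
    have h3 : |a - b| ^ 2 = (a - b) ^ 2 := sq_abs _
    have h4 : |a + b| ^ 2 = (a + b) ^ 2 := sq_abs _
    have h5 : |a - b| * |a + b| ≤ |a - b| ^ 2 / (2 * θ) + θ / 2 * |a + b| ^ 2 := by
      have : |a - b| ^ 2 / (2 * θ) + θ / 2 * |a + b| ^ 2 - |a - b| * |a + b| = (|a - b| - θ * |a + b|) ^ 2 / (2 * θ) := by
        field_simp; ring
      have h6 : 0 ≤ (|a - b| - θ * |a + b|) ^ 2 / (2 * θ) := by positivity
      linarith
    rw [h3, h4] at h5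
    nlinarith [mul_nonneg hθ.le (sq_nonneg (a - b))]
  exact mul_le_mul hx h1 (abs_nonneg _) ((abs_nonneg _).trans hx)

namespace Setup

lemma E1 {u f : E2 → ℝ} (S : Setup u f) {ε δ θ R : ℝ} (hε : 0 < ε) (hδ : 0 < δ) (hθ : 0 < θ) (t : ℝ)
    (hR : ∀ x, t ≤ u x → ‖x‖ < R) (c : E2) (hc : ∀ i, |c i| ≤ R) (i : Fin 2) :
    |S.mm ε δ t * (∫ x, bb ε u t x * (g2 u x * (x i - c i))) - S.MM ε t * (∫ x, bb ε u t x * ((f x + δ) * (x i - c i)))|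
      ≤ 2 * R * (S.II ε δ t / (2 * θ) + 2 * θ * (S.mm ε δ t * S.MM ε t)) := by
  have hfc : Continuous (fun x => f x + δ) := S.hf.continuous.add continuous_const
  have hξ : Continuous (fun x : E2 => x i - c i) := (coord_cont i).sub continuous_const
  have c1 : Continuous (fun x => g2 u x * (x i - c i)) := S.g2_cont.mul hξ
  have c2 : Continuous (fun x => (f x + δ) * (x i - c i)) := hfc.mul hξ
  have s1 := S.ww_sep ε t (fun x => g2 u x * (x i - c i)) (fun x => f x + δ)
  have s2 := S.ww_sep ε t (fun x => (f x + δ) * (x i - c i)) (g2 u)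
  have j1 := S.ww_int hε t (sep_cont c1 hfc)
  have j2 := S.ww_int hε t (sep_cont c2 S.g2_cont)
  have e1 : S.mm ε δ t * (∫ x, bb ε u t x * (g2 u x * (x i - c i))) - S.MM ε t * (∫ x, bb ε u t x * ((f x + δ) * (x i - c i)))
     = ∫ z, (ww ε u t z * ((fun x : E2 => g2 u x * (x i - c i)) z.1 * (f z.2 + δ)) - ww ε u t z * ((fun x : E2 => (f x + δ) * (x i - c i)) z.1 * g2 u z.2)) ∂(volume.prod volume) := by
    rw [integral_sub j1 j2, s1, s2]
    unfold mm MM; ring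
  have hs : Integrable (fun z => ww ε u t z * (g2 u z.1 * (f z.2 + δ) + (f z.1 + δ) * g2 u z.2)) (volume.prod volume) :=
    S.ww_int hε t ((sep_cont S.g2_cont hfc).add (sep_cont hfc S.g2_cont))
  have e2 : 2 * R * (S.II ε δ t / (2 * θ) + 2 * θ * (S.mm ε δ t * S.MM ε t))
     = ∫ z, (2 * R / (2 * θ) * (ww ε u t z * pq f u δ z) + 2 * R * θ * (ww ε u t z * (g2 u z.1 * (f z.2 + δ) + (f z.1 + δ) * g2 u z.2))) ∂(volume.prod volume) := by
    rw [integral_add ((S.pq_int hε hδ t).const_mul _) (hs.const_mul _), integral_const_mul, integral_const_mul, S.sum_sep hε hδ]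
    unfold II; ring
  rw [e1, e2, ← Real.norm_eq_abs]
  refine norm_integral_le_of_norm_le (((S.pq_int hε hδ t).const_mul _).add (hs.const_mul _)) ?_
  filter_upwards with z
  rw [Real.norm_eq_abs]
  by_cases h0 : ww ε u t z = 0
  · simp [h0]
  have hz1 : ‖z.1‖ < R := hR _ (by
    by_contra hn; push Not at hn
    exact h0 (by unfold ww; rw [S.bb_zero hε hn]; simp))
  have hw := db_sq_nonneg hε u t z
  have hx : |z.1 i - c i| ≤ 2 * R := by
    have := abs_sub (z.1 i) (c i)
    linarith [abs_coord_le z.1 i, hc i]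
  have y0 := young_diff (a := pp f u δ 0 z) (b := qq f u δ 0 z) hθ hx rfl
  have y1 := young_diff (a := pp f u δ 1 z) (b := qq f u δ 1 z) hθ hx rfl
  have k1 := qq_sq f u δ z
  have k2 : pp f u δ 0 z ^ 2 + pp f u δ 1 z ^ 2 = g2 u z.1 * (f z.2 + δ) := by
    rw [← S.gg_sq hδ]; unfold pp g2; ring
  rw [S.gg_sq hδ] at k1
  have e3 : ww ε u t z * (g2 u z.1 * (z.1 i - c i) * (f z.2 + δ)) - ww ε u t z * ((f z.1 + δ) * (z.1 i - c i) * g2 u z.2)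
     = ww ε u t z * ((z.1 i - c i) * ((pp f u δ 0 z ^ 2 - qq f u δ 0 z ^ 2) + (pp f u δ 1 z ^ 2 - qq f u δ 1 z ^ 2))) := by
    linear_combination (- ww ε u t z * (z.1 i - c i)) * k2 + (ww ε u t z * (z.1 i - c i)) * k1
  rw [e3, abs_mul, abs_of_nonneg hw, abs_mul]
  have e4 : |z.1 i - c i| * |(pp f u δ 0 z ^ 2 - qq f u δ 0 z ^ 2) + (pp f u δ 1 z ^ 2 - qq f u δ 1 z ^ 2)| ≤
     2 * R * (pq f u δ z / (2 * θ) + θ * (g2 u z.1 * (f z.2 + δ) + (f z.1 + δ) * g2 u z.2)) := by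
    calc _ ≤ |z.1 i - c i| * (|pp f u δ 0 z ^ 2 - qq f u δ 0 z ^ 2| + |pp f u δ 1 z ^ 2 - qq f u δ 1 z ^ 2|) := by
          gcongr; exact abs_add_le _ _
      _ ≤ _ := by
          rw [← k1, ← k2]
          unfold pq
          rw [add_div]
          linarith
  calc _ ≤ ww ε u t z * (2 * R * (pq f u δ z / (2 * θ) + θ * (g2 u z.1 * (f z.2 + δ) + (f z.1 + δ) * g2 u z.2))) := by gcongr
    _ = _ := by ring

/-- the rotational derivative about c -/
def _root_.ph (u : E2 → ℝ) (c x : E2) : ℝ := -(x 1 - c 1) * pd 0 u x + (x 0 - c 0) * pd 1 u x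

lemma ph_cont {u f : E2 → ℝ} (S : Setup u f) (c : E2) : Continuous (ph u c) := by
  have h0 := S.pdu_cont 0
  have h1 := S.pdu_cont 1
  unfold ph
  fun_prop

lemma E2b {u f : E2 → ℝ} (S : Setup u f) {ε R : ℝ} (hε : 0 < ε) (t : ℝ)
    (hR : ∀ x, t ≤ u x → ‖x‖ < R) (c : E2) (hc : ∀ i, |c i| ≤ R) (i : Fin 2) :
    |∫ x, bb ε u t x * (ph u c x * pd i u x)| ≤ 4 * R * S.MM ε t := by
  unfold MM
  rw [← integral_const_mul, ← Real.norm_eq_abs]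
  refine norm_integral_le_of_norm_le ((S.bb_int hε t S.g2_cont).const_mul _) ?_
  filter_upwards with x
  rw [Real.norm_eq_abs]
  by_cases h0 : bb ε u t x = 0
  · simp [h0]
  have hz1 : ‖x‖ < R := hR _ (by
    by_contra hn; push Not at hn
    exact h0 (S.bb_zero hε hn))
  have hx : ∀ j, |x j - c j| ≤ 2 * R := fun j => by
    have := abs_sub (x j) (c j)
    linarith [abs_coord_le x j, hc j]
  have hb : 0 ≤ bb ε u t x := db_nonneg hε _
  rw [abs_mul, abs_of_nonneg hb]
  have hR0 : 0 ≤ R := (norm_nonneg _).trans hz1.le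
  have h1 : |ph u c x| ≤ 2 * R * (|pd 0 u x| + |pd 1 u x|) := by
    unfold ph
    refine (abs_add_le _ _).trans ?_
    rw [abs_mul, abs_mul, abs_neg]
    have a1 := mul_le_mul_of_nonneg_right (hx 1) (abs_nonneg (pd 0 u x))
    have a2 := mul_le_mul_of_nonneg_right (hx 0) (abs_nonneg (pd 1 u x))
    linarith
  have h2 : (|pd 0 u x| + |pd 1 u x|) * |pd i u x| ≤ 2 * g2 u x := by
    unfold g2
    have s0 := sq_abs (pd 0 u x)
    have s1 := sq_abs (pd 1 u x)
    rw [← s0, ← s1]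
    fin_cases i <;> simp <;> nlinarith [sq_nonneg (|pd 0 u x| - |pd 1 u x|), sq_nonneg (pd 0 u x), sq_nonneg (pd 1 u x)]
  have h3 : |ph u c x * pd i u x| ≤ 4 * R * g2 u x := by
    rw [abs_mul]
    calc _ ≤ 2 * R * (|pd 0 u x| + |pd 1 u x|) * |pd i u x| := by gcongr
      _ = 2 * R * ((|pd 0 u x| + |pd 1 u x|) * |pd i u x|) := by ring
      _ ≤ 2 * R * (2 * g2 u x) := by gcongr
      _ = _ := by ring
  calc _ ≤ bb ε u t x * (4 * R * g2 u x) := by gcongr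
    _ = _ := by ring

lemma E2a {u f : E2 → ℝ} (S : Setup u f) {ε δ R : ℝ} (hε : 0 < ε) (hδ : 0 < δ) (t : ℝ)
    (hR : ∀ x, t ≤ u x → ‖x‖ < R) (c : E2) (hc : ∀ i, |c i| ≤ R) :
    2 * (S.mm ε δ t * ∫ x, bb ε u t x * ph u c x ^ 2) ≤ 4 * R ^ 2 * S.II ε δ t +
      16 * R * S.MM ε t * (|∫ x, bb ε u t x * ((f x + δ) * (x 0 - c 0))| + |∫ x, bb ε u t x * ((f x + δ) * (x 1 - c 1))|) := by
  have hfc : Continuous (fun x => f x + δ) := S.hf.continuous.add continuous_const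
  have hξ : ∀ i, Continuous (fun x : E2 => x i - c i) := fun i => (coord_cont i).sub continuous_const
  have hg := (S.gg_contDiff hδ).continuous
  have hp := S.ph_cont c
  have hu := S.pdu_cont
  set g := gg f δ with hgdef
  set φ := ph u c with hφ
  -- names of the factors
  set φ2 : E2 → ℝ := fun x => φ x ^ 2 with hφ2
  set f1 : E2 → ℝ := fun x => f x + δ with hf1
  set gφ : E2 → ℝ := fun x => g x * φ x with hgφ
  set a : Fin 2 → E2 → ℝ := fun i x => φ x * pd i u x with ha
  set b : Fin 2 → E2 → ℝ := fun i x => (f x + δ) * (x i - c i) with hb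
  set d : Fin 2 → E2 → ℝ := fun i x => g x * pd i u x with hd
  set e : Fin 2 → E2 → ℝ := fun i x => g x * φ x * (x i - c i) with he
  have cφ2 : Continuous φ2 := hp.pow 2
  have cgφ : Continuous gφ := hg.mul hp
  have ca : ∀ i, Continuous (a i) := fun i => hp.mul (hu i)
  have cb : ∀ i, Continuous (b i) := fun i => hfc.mul (hξ i)
  have cd : ∀ i, Continuous (d i) := fun i => hg.mul (hu i)
  have ce : ∀ i, Continuous (e i) := fun i => cgφ.mul (hξ i)
  set w := ww ε u t with hw
  set Ψ : E2 × E2 → ℝ := fun z => g z.2 * φ z.1 + g z.1 * φ z.2 with hΨ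
  set Z : E2 × E2 → ℝ := fun z => g z.2 * (-(z.2 1 - c 1) * pd 0 u z.1 + (z.2 0 - c 0) * pd 1 u z.1) with hZ
  set Z' : E2 × E2 → ℝ := fun z => g z.1 * (-(z.1 1 - c 1) * pd 0 u z.2 + (z.1 0 - c 0) * pd 1 u z.2) with hZ'
  have cΨ : Continuous Ψ := by rw [hΨ]; fun_prop
  have hu0 := hu 0
  have hu1 := hu 1
  have cZ : Continuous Z := by rw [hZ]; fun_prop
  have cZ' : Continuous Z' := by rw [hZ']; fun_prop
  have wi : ∀ {F : E2 × E2 → ℝ}, Continuous F → Integrable (fun z => w z * F z) (volume.prod volume) := fun hF => S.ww_int hε t hF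
  have ws := S.ww_sep ε t
  rw [← hw] at ws
  -- ∫ w Ψ²
  have hgsq : ∀ x, g x * g x = f1 x := fun x => by rw [← sq]; exact S.gg_sq hδ x
  have i1 : ∫ z, w z * Ψ z ^ 2 ∂(volume.prod volume) = 2 * (S.mm ε δ t * ∫ x, bb ε u t x * φ x ^ 2) := by
    have e1 : ∀ z, w z * Ψ z ^ 2 = w z * (φ2 z.1 * f1 z.2) + w z * (f1 z.1 * φ2 z.2) + 2 * (w z * (gφ z.1 * gφ z.2)) := by
      intro z
      simp only [← hgsq, hΨ, hφ2, hgφ]; ring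
    simp only [e1]
    rw [integral_add (i_add (wi (sep_cont cφ2 hfc)) (wi (sep_cont hfc cφ2))) ((wi (sep_cont cgφ cgφ)).const_mul _),
      integral_add (wi (sep_cont cφ2 hfc)) (wi (sep_cont hfc cφ2)), integral_const_mul, ws, ws, ws]
    have hz : ∫ x, bb ε u t x * gφ x = 0 := S.zero_rot hε hδ t c
    rw [hz]
    unfold mm
    ring
  have hz : ∀ i, ∫ x, bb ε u t x * d i x = 0 := fun i => S.zero_mean hε hδ t i
  have hab := S.E2b hε t hR c hc
  set α : Fin 2 → ℝ := fun i => ∫ x, bb ε u t x * a i x with hα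
  set w' : Fin 2 → ℝ := fun i => ∫ x, bb ε u t x * b i x with hw'
  have i2 : ∫ z, w z * (Ψ z * Z z) ∂(volume.prod volume) = α 1 * w' 0 - α 0 * w' 1 := by
    have e1 : ∀ z, w z * (Ψ z * Z z) = (w z * (a 1 z.1 * b 0 z.2) - w z * (a 0 z.1 * b 1 z.2)) + (w z * (d 1 z.1 * e 0 z.2) - w z * (d 0 z.1 * e 1 z.2)) := by
      intro z
      have := hgsq z.2
      simp only [hf1] at this
      simp only [hΨ, hZ, ha, hb, hd, he, ← this]; ring
    simp only [e1]
    rw [integral_add (i_sub (wi (sep_cont (ca 1) (cb 0))) (wi (sep_cont (ca 0) (cb 1)))) (i_sub (wi (sep_cont (cd 1) (ce 0))) (wi (sep_cont (cd 0) (ce 1)))),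
      integral_sub (wi (sep_cont (ca 1) (cb 0))) (wi (sep_cont (ca 0) (cb 1))), integral_sub (wi (sep_cont (cd 1) (ce 0))) (wi (sep_cont (cd 0) (ce 1))),
      ws, ws, ws, ws, hz, hz]
    simp [hα, hw']
  have i3 : ∫ z, w z * (Ψ z * Z' z) ∂(volume.prod volume) = α 1 * w' 0 - α 0 * w' 1 := by
    have e1 : ∀ z, w z * (Ψ z * Z' z) = (w z * (b 0 z.1 * a 1 z.2) - w z * (b 1 z.1 * a 0 z.2)) + (w z * (e 0 z.1 * d 1 z.2) - w z * (e 1 z.1 * d 0 z.2)) := by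
      intro z
      have := hgsq z.1
      simp only [hf1] at this
      simp only [hΨ, hZ', ha, hb, hd, he, ← this]; ring
    simp only [e1]
    rw [integral_add (i_sub (wi (sep_cont (cb 0) (ca 1))) (wi (sep_cont (cb 1) (ca 0)))) (i_sub (wi (sep_cont (ce 0) (cd 1))) (wi (sep_cont (ce 1) (cd 0)))),
      integral_sub (wi (sep_cont (cb 0) (ca 1))) (wi (sep_cont (cb 1) (ca 0))), integral_sub (wi (sep_cont (ce 0) (cd 1))) (wi (sep_cont (ce 1) (cd 0))),
      ws, ws, ws, ws, hz, hz]
    simp [hα, hw']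
    ring
  have cΨZ : Continuous (fun z => Ψ z * Z z) := cΨ.mul cZ
  have cΨZ' : Continuous (fun z => Ψ z * Z' z) := cΨ.mul cZ'
  have hpqi : Integrable (fun z => w z * pq f u δ z) (volume.prod volume) := S.pq_int hε hδ t
  have hmain : ∫ z, w z * Ψ z ^ 2 ∂(volume.prod volume) ≤ ∫ z, (4 * R ^ 2 * (w z * pq f u δ z) + 2 * (w z * (Ψ z * Z z)) + 2 * (w z * (Ψ z * Z' z))) ∂(volume.prod volume) := by
    refine integral_mono (wi (cΨ.pow 2)) (i_add (i_add (hpqi.const_mul _) ((wi cΨZ).const_mul _)) ((wi cΨZ').const_mul _)) ?_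
    intro z
    simp only
    by_cases h0 : w z = 0
    · simp [h0]
    have hw0 : 0 ≤ w z := db_sq_nonneg hε u t z
    have hz1 : ‖z.1‖ < R := hR _ (by
      by_contra hn; push Not at hn
      exact h0 (by rw [hw]; unfold ww; rw [S.bb_zero hε hn]; simp))
    have hz2 : ‖z.2‖ < R := hR _ (by
      by_contra hn; push Not at hn
      exact h0 (by rw [hw]; unfold ww; rw [S.bb_zero hε hn]; simp))
    have hv : ‖z.1 - z.2‖ ^ 2 ≤ 4 * R ^ 2 := by
      have := norm_sub_le z.1 z.2
      have h5 : ‖z.1 - z.2‖ ≤ 2 * R := by linarith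
      nlinarith [norm_nonneg (z.1 - z.2)]
    have hX : Ψ z - Z z - Z' z = -(z.1 - z.2) 1 * (pp f u δ 0 z - qq f u δ 0 z) + (z.1 - z.2) 0 * (pp f u δ 1 z - qq f u δ 1 z) := by
      have := qq_perp f u δ z
      rw [← hgdef] at this
      have e5 : -(z.1 - z.2) 1 * (pp f u δ 0 z - qq f u δ 0 z) + (z.1 - z.2) 0 * (pp f u δ 1 z - qq f u δ 1 z) =
        -(z.1 - z.2) 1 * pp f u δ 0 z + (z.1 - z.2) 0 * pp f u δ 1 z - (g z.1 * (- (z.1 - z.2) 1 * pd 0 u z.2 + (z.1 - z.2) 0 * pd 1 u z.2)) := by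
        rw [← this]; ring
      rw [e5]
      simp only [hΨ, hZ, hZ', hφ, ph, pp, PiLp.sub_apply, ← hgdef]
      ring
    have hX2 : (Ψ z - Z z - Z' z) ^ 2 ≤ 4 * R ^ 2 * pq f u δ z := by
      rw [hX]
      have h6 := normsq_e2 (z.1 - z.2)
      have h7 := mul_le_mul_of_nonneg_right hv (S.pq_nonneg δ z)
      refine le_trans ?_ h7
      rw [h6]
      unfold pq
      generalize pp f u δ 0 z - qq f u δ 0 z = A
      generalize pp f u δ 1 z - qq f u δ 1 z = B
      nlinarith [sq_nonneg ((z.1 - z.2) 0 * A + (z.1 - z.2) 1 * B)]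
    have h8 : Ψ z ^ 2 ≤ 4 * R ^ 2 * pq f u δ z + 2 * (Ψ z * Z z) + 2 * (Ψ z * Z' z) := by
      nlinarith [sq_nonneg (Z z + Z' z)]
    calc w z * Ψ z ^ 2 ≤ w z * (4 * R ^ 2 * pq f u δ z + 2 * (Ψ z * Z z) + 2 * (Ψ z * Z' z)) := by gcongr
      _ = _ := by ring
  rw [i1, integral_add (i_add (hpqi.const_mul _) ((wi cΨZ).const_mul _)) ((wi cΨZ').const_mul _),
    integral_add (hpqi.const_mul _) ((wi cΨZ).const_mul _), integral_const_mul, integral_const_mul, integral_const_mul, i2, i3] at hmain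
  have hII : S.II ε δ t = ∫ z, w z * pq f u δ z ∂(volume.prod volume) := rfl
  rw [hII]
  have k0 : |α 0 * w' 1| ≤ 4 * R * S.MM ε t * |w' 1| := by
    rw [abs_mul]; gcongr; exact hab 0
  have k1 : |α 1 * w' 0| ≤ 4 * R * S.MM ε t * |w' 0| := by
    rw [abs_mul]; gcongr; exact hab 1
  have l0 := (abs_le.mp k0).1
  have l1 := (abs_le.mp k1).2
  have : 2 * (S.mm ε δ t * ∫ x, bb ε u t x * φ x ^ 2) ≤ 4 * R ^ 2 * (∫ z, w z * pq f u δ z ∂(volume.prod volume)) + 16 * R * S.MM ε t * (|w' 0| + |w' 1|) := by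
    linarith
  exact this

end Setup

lemma db_bdd {ε : ℝ} (hε : 0 < ε) : ∃ D, 0 ≤ D ∧ ∀ s, |db ε s| ≤ D := by
  obtain ⟨D, hD⟩ := (isCompact_Icc (a := (0:ℝ)) (b := ε)).exists_bound_of_continuousOn (f := db ε) (db_cont ε).continuousOn
  refine ⟨max D 0, le_max_right _ _, fun s => ?_⟩
  by_cases h1 : s ≤ 0
  · rw [db_zero_left hε h1]; simp
  by_cases h2 : ε ≤ s
  · rw [db_zero_right hε h2]; simp
  push Not at h1 h2
  exact (hD s ⟨h1.le, h2.le⟩).trans (le_max_left _ _)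

namespace Setup

lemma bb_dom {u f : E2 → ℝ} (S : Setup u f) {ε D t s : ℝ} (hε : 0 < ε) (hD0 : 0 ≤ D) (hD : ∀ s, |db ε s| ≤ D) (hs : t - 1 < s) (φ : E2 → ℝ) (x : E2) :
    ‖bb ε u s x * φ x‖ ≤ D * ‖be 1 u (t - 2) x * φ x‖ := by
  by_cases h : u x < s
  · rw [S.bb_zero hε h]; simp; positivity
  · push Not at h
    have : be 1 u (t - 2) x = 1 := bt_one one_pos (by linarith)
    rw [this, one_mul, norm_mul]
    gcongr
    exact hD _

lemma be_deriv {u f : E2 → ℝ} (S : Setup u f) {ε : ℝ} (hε : 0 < ε) {φ : E2 → ℝ} (h : Continuous φ) (t : ℝ) :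
    HasDerivAt (fun t => ∫ x, be ε u t x * φ x) (-∫ x, bb ε u t x * φ x) t := by
  obtain ⟨D, hD0, hD⟩ := db_bdd hε
  rw [← integral_neg]
  refine (hasDerivAt_integral_of_dominated_loc_of_deriv_le (F := fun t x => be ε u t x * φ x) (F' := fun t x => -(bb ε u t x * φ x))
    (bound := fun x => D * ‖be 1 u (t - 2) x * φ x‖) (s := Ioi (t - 1)) (Ioi_mem_nhds (by linarith)) ?_ (S.be_int hε t h) ?_ ?_ ?_ ?_).2
  · exact Eventually.of_forall fun s => (S.be_int hε s h).aestronglyMeasurable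
  · exact (S.bb_int hε t h).neg.aestronglyMeasurable
  · filter_upwards with x s hs
    rw [norm_neg]
    exact S.bb_dom hε hD0 hD hs φ x
  · exact (S.be_int one_pos (t - 2) h).norm.const_mul D
  · filter_upwards with x s hs
    have h1 : HasDerivAt (fun s => u x - s) (-1) s := by simpa using (hasDerivAt_id s).const_sub (u x)
    have h2 := ((bt_hasDeriv ε (u x - s)).comp s h1).mul_const (φ x)
    refine HasDerivAt.congr_deriv (f := fun s => be ε u s x * φ x) h2 ?_
    unfold bb; ring

lemma bb_tcont {u f : E2 → ℝ} (S : Setup u f) {ε : ℝ} (hε : 0 < ε) {φ : E2 → ℝ} (h : Continuous φ) :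
    Continuous (fun t => ∫ x, bb ε u t x * φ x) := by
  obtain ⟨D, hD0, hD⟩ := db_bdd hε
  rw [continuous_iff_continuousAt]
  intro t
  refine continuousAt_of_dominated (bound := fun x => D * ‖be 1 u (t - 2) x * φ x‖) ?_ ?_ ((S.be_int one_pos (t - 2) h).norm.const_mul D) ?_
  · exact Eventually.of_forall fun s => (S.bb_int hε s h).aestronglyMeasurable
  · filter_upwards [Ioi_mem_nhds (show t - 1 < t by linarith)] with s hs
    filter_upwards with x
    exact S.bb_dom hε hD0 hD hs φ x
  · filter_upwards with x
    have : Continuous (fun s => bb ε u s x * φ x) := ((db_cont ε).comp (continuous_const.sub continuous_id)).mul continuous_const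
    exact this.continuousAt

lemma be_tcont {u f : E2 → ℝ} (S : Setup u f) {ε : ℝ} (hε : 0 < ε) {φ : E2 → ℝ} (h : Continuous φ) :
    Continuous (fun t => ∫ x, be ε u t x * φ x) :=
  continuous_iff_continuousAt.mpr fun t => (S.be_deriv hε h t).continuousAt

lemma bb_nonneg {u f : E2 → ℝ} (_S : Setup u f) {ε : ℝ} (hε : 0 < ε) (t : ℝ) (x : E2) : 0 ≤ bb ε u t x := db_nonneg hε _
lemma be_nonneg {u f : E2 → ℝ} (_S : Setup u f) {ε : ℝ} (t : ℝ) (x : E2) : 0 ≤ be ε u t x := bt_nonneg _ _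

lemma be_le {u f : E2 → ℝ} (S : Setup u f) {ε : ℝ} (hε : 0 < ε) {t s : ℝ} (hst : s + 1 ≤ t) (x : E2) : be ε u t x ≤ be 1 u s x := by
  by_cases h : u x < t
  · rw [S.be_zero hε h]; exact S.be_nonneg _ _
  · push Not at h
    have : be 1 u s x = 1 := bt_one one_pos (by linarith)
    rw [this]; exact bt_le_one _ _

lemma be_int_le {u f : E2 → ℝ} (S : Setup u f) {ε : ℝ} (hε : 0 < ε) {t s : ℝ} (hst : s + 1 ≤ t) {φ : E2 → ℝ} (h : Continuous φ) :
    |∫ x, be ε u t x * φ x| ≤ ∫ x, be 1 u s x * |φ x| := by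
  rw [← Real.norm_eq_abs]
  refine norm_integral_le_of_norm_le (S.be_int one_pos s h.abs) ?_
  filter_upwards with x
  rw [Real.norm_eq_abs, abs_mul, abs_of_nonneg (S.be_nonneg _ _)]
  gcongr
  exact S.be_le hε hst x

lemma II_nonneg {u f : E2 → ℝ} (S : Setup u f) {ε : ℝ} (hε : 0 < ε) (δ t : ℝ) : 0 ≤ S.II ε δ t :=
  integral_nonneg fun z => mul_nonneg (db_sq_nonneg hε u t z) (S.pq_nonneg δ z)

lemma be_top {u f : E2 → ℝ} (S : Setup u f) {ε T : ℝ} (hε : 0 < ε) (hT : ∀ x, u x < T) (φ : E2 → ℝ) : ∫ x, be ε u T x * φ x = 0 := by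
  have : ∀ x, be ε u T x * φ x = 0 := fun x => by rw [S.be_zero hε (hT x)]; simp
  simp [this]

lemma MM_be {u f : E2 → ℝ} (S : Setup u f) {ε : ℝ} (hε : 0 < ε) (t : ℝ) : S.MM ε t = ∫ x, be ε u t x * f x := S.M_eq hε t

lemma xd_cont {u f : E2 → ℝ} (S : Setup u f) : Continuous (xd u) := by
  have h0 := S.pdu_cont 0
  have h1 := S.pdu_cont 1
  unfold xd
  fun_prop

lemma exJ {u f : E2 → ℝ} (S : Setup u f) {T0 T1 : ℝ} (h01 : T0 ≤ T1) (hT1 : ∀ x, u x < T1)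
    (hDef : ∀ η > 0, ∃ T ≤ T0, ∀ ε, 0 < ε → ε ≤ 1 →
      (1/2) * (∫ x, be ε u T x * f x) ^ 2 + 2 * Real.pi * ∫ x, be ε u T x * (f x * xd u x) ≤ η) :
    ∀ η > 0, ∃ δ ε, 0 < δ ∧ δ ≤ η ∧ 0 < ε ∧ ε ≤ η ∧ ε ≤ 1 ∧ ∃ J : ℝ → ℝ, Continuous J ∧
      (∀ t, T0 ≤ t → S.II ε δ t ≤ J t) ∧ ∫ t in T0..T1, J t ≤ η := by
  intro η hη
  obtain ⟨T, hT, hd⟩ := hDef (η/8) (by positivity)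
  have hfc := S.hf.continuous
  have hxc := S.xd_cont
  have hfx : Continuous (fun x => f x * xd u x) := hfc.mul hxc
  set F1 := ∫ x, be 1 u (T - 1) x * |f x| with hF1
  set D1 := ∫ x, be 1 u (T - 1) x * |(1:ℝ)| with hD1
  set G1 := ∫ x, be 1 u (T - 1) x * |xd u x| with hG1
  set D2 := ∫ x, be 1 u (T - 2) x * |(1:ℝ)| with hD2
  have F1n : 0 ≤ F1 := integral_nonneg fun x => mul_nonneg (S.be_nonneg _ _) (abs_nonneg _)
  have D1n : 0 ≤ D1 := integral_nonneg fun x => mul_nonneg (S.be_nonneg _ _) (abs_nonneg _)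
  have G1n : 0 ≤ G1 := integral_nonneg fun x => mul_nonneg (S.be_nonneg _ _) (abs_nonneg _)
  have D2n : 0 ≤ D2 := integral_nonneg fun x => mul_nonneg (S.be_nonneg _ _) (abs_nonneg _)
  have hpi := Real.pi_pos
  set K := 2 * F1 * D1 + 4 * Real.pi * G1 + 1 with hK
  have hKp : 0 < K := by positivity
  obtain ⟨δ, hδ, hδη, hδK⟩ : ∃ δ, 0 < δ ∧ δ ≤ η ∧ δ * K ≤ η / 4 :=
    ⟨min η (η / (4 * K)), by positivity, min_le_left _ _, by
      calc _ ≤ (η / (4 * K)) * K := by gcongr; exact min_le_right _ _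
        _ = η / 4 := by field_simp⟩
  obtain ⟨C, hC0, hC⟩ := S.A_lower hδ T
  obtain ⟨ε, hε, hεη, hε1, hεC⟩ : ∃ ε, 0 < ε ∧ ε ≤ η ∧ ε ≤ 1 ∧ ε * (16 * Real.pi * C * D2 + 1) ≤ η / 4 := by
    set L := 16 * Real.pi * C * D2 + 1 with hL
    have hLp : 0 < L := by positivity
    exact ⟨min (min η 1) (η / (4 * L)), by positivity, (min_le_left _ _).trans (min_le_left _ _), (min_le_left _ _).trans (min_le_right _ _), by
      calc _ ≤ (η / (4 * L)) * L := by gcongr; exact min_le_right _ _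
        _ = η / 4 := by field_simp⟩
  have c1 : Continuous (fun _ : E2 => (1:ℝ)) := continuous_const
  set Φ : ℝ → ℝ := fun t => ∫ x, be ε u t x * 1 with hΦ
  have cΦ : Continuous Φ := S.be_tcont hε c1
  set P : ℝ → ℝ := fun t => 2 * (∫ x, bb ε u t x * f x) * (∫ x, be ε u t x * f x) + 2 * δ * F1 * (∫ x, bb ε u t x * 1)
    + 4 * Real.pi * (∫ x, bb ε u t x * (f x * xd u x)) + 4 * Real.pi * δ * (∫ x, bb ε u t x * xd u x) with hP
  set s : ℝ → ℝ := fun t => Φ (t - ε) - Φ (t + ε) with hs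
  have cP : Continuous P := by
    have a1 := S.bb_tcont hε hfc
    have a2 := S.be_tcont hε hfc
    have a3 := S.bb_tcont hε c1
    have a4 := S.bb_tcont hε hfx
    have a5 := S.bb_tcont hε hxc
    rw [hP]
    fun_prop
  have cs : Continuous s := by rw [hs]; fun_prop
  have hJII : ∀ t, T ≤ t → S.II ε δ t ≤ P t + 8 * Real.pi * C * s t := by
    intro t ht
    obtain ⟨A, hA, hpA, hA0⟩ := S.exA hε hδ t
    have h1 := hC ε hε t ht A hA hpA hA0
    have h2 := S.II_eq hε hδ t hA hpA hA0
    have h3 : S.mm ε δ t = (∫ x, bb ε u t x * f x) + δ * ∫ x, bb ε u t x * 1 := by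
      unfold mm
      rw [← integral_const_mul, ← integral_add (S.bb_int hε t hfc) ((S.bb_int hε t c1).const_mul _)]
      congr 1; ext x; ring
    have h4 : ∫ x, bb ε u t x * ((f x + δ) * xd u x) = (∫ x, bb ε u t x * (f x * xd u x)) + δ * ∫ x, bb ε u t x * xd u x := by
      rw [← integral_const_mul, ← integral_add (S.bb_int hε t hfx) ((S.bb_int hε t hxc).const_mul _)]
      congr 1; ext x; ring
    have h5 : ∫ x, (be ε u (t - ε) x - be ε u (t + ε) x) = s t := by
      have := integral_sub (S.be_int hε (t - ε) c1) (S.be_int hε (t + ε) c1)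
      simp only [hs, hΦ]
      rw [← this]; congr 1; ext x; ring
    rw [h4, h5] at h1
    rw [h2, h3, S.MM_be hε]
    have h6 : ∫ x, be ε u t x * f x ≤ F1 := (le_abs_self _).trans (S.be_int_le hε (by linarith) hfc)
    have h7 : 0 ≤ ∫ x, bb ε u t x * 1 := integral_nonneg fun x => mul_nonneg (S.bb_nonneg hε _ _) zero_le_one
    have h8 := mul_le_mul_of_nonneg_left h6 (mul_nonneg hδ.le h7)
    have h9 := mul_le_mul_of_nonneg_left h1 hpi.le
    simp only [hP]
    linarith
  have hJ0 : ∀ t, T ≤ t → 0 ≤ P t + 8 * Real.pi * C * s t := fun t ht => (S.II_nonneg hε δ t).trans (hJII t ht)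
  have cJ : Continuous (fun t => P t + 8 * Real.pi * C * s t) := by fun_prop
  refine ⟨δ, ε, hδ, hδη, hε, hεη, hε1, fun t => P t + 8 * Real.pi * C * s t, cJ, fun t ht => hJII t (hT.trans ht), ?_⟩
  have g1 : ∫ t in T0..T1, (P t + 8 * Real.pi * C * s t) ≤ ∫ t in T..T1, (P t + 8 * Real.pi * C * s t) := by
    rw [← intervalIntegral.integral_add_adjacent_intervals (cJ.intervalIntegrable T T0) (cJ.intervalIntegrable T0 T1)]
    have := intervalIntegral.integral_nonneg hT (fun t ht => hJ0 t ht.1) (μ := volume)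
    linarith
  refine g1.trans ?_
  rw [intervalIntegral.integral_add (cP.intervalIntegrable _ _) ((cs.const_mul _).intervalIntegrable _ _), intervalIntegral.integral_const_mul]
  have g2 : ∫ t in T..T1, P t = (∫ x, be ε u T x * f x) ^ 2 + 2 * δ * F1 * (∫ x, be ε u T x * 1)
    + 4 * Real.pi * (∫ x, be ε u T x * (f x * xd u x)) + 4 * Real.pi * δ * (∫ x, be ε u T x * xd u x) := by
    set G : ℝ → ℝ := fun t => -((∫ x, be ε u t x * f x) ^ 2 + 2 * δ * F1 * (∫ x, be ε u t x * 1)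
      + 4 * Real.pi * (∫ x, be ε u t x * (f x * xd u x)) + 4 * Real.pi * δ * (∫ x, be ε u t x * xd u x)) with hG
    have hGd : ∀ t, HasDerivAt G (P t) t := by
      intro t
      have := (((((S.be_deriv hε hfc t).pow 2).add ((S.be_deriv hε c1 t).const_mul (2 * δ * F1))).add ((S.be_deriv hε hfx t).const_mul (4 * Real.pi))).add
        ((S.be_deriv hε hxc t).const_mul (4 * Real.pi * δ))).neg
      refine HasDerivAt.congr_deriv (f := G) this ?_
      simp only [hP]
      norm_num
      ring
    rw [intervalIntegral.integral_eq_sub_of_hasDerivAt (fun t _ => hGd t) (cP.intervalIntegrable _ _)]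
    simp only [hG, S.be_top hε hT1]
    ring
  have g3 : ∫ t in T..T1, s t ≤ 2 * ε * D2 := by
    have hi : ∀ a b, IntervalIntegrable Φ volume a b := fun a b => cΦ.intervalIntegrable a b
    have e1 : ∫ t in T..T1, s t = (∫ t in (T - ε)..(T + ε), Φ t) - ∫ t in (T1 - ε)..(T1 + ε), Φ t := by
      simp only [hs]
      have q1 : Continuous (fun t => Φ (t - ε)) := by fun_prop
      have q2 : Continuous (fun t => Φ (t + ε)) := by fun_prop
      rw [intervalIntegral.integral_sub (q1.intervalIntegrable _ _) (q2.intervalIntegrable _ _)]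
      rw [intervalIntegral.integral_comp_sub_right, intervalIntegral.integral_comp_add_right]
      have := intervalIntegral.integral_add_adjacent_intervals (hi (T - ε) (T + ε)) (hi (T + ε) (T1 + ε))
      have := intervalIntegral.integral_add_adjacent_intervals (hi (T - ε) (T1 - ε)) (hi (T1 - ε) (T1 + ε))
      linarith
    have e2 : 0 ≤ ∫ t in (T1 - ε)..(T1 + ε), Φ t := intervalIntegral.integral_nonneg (by linarith) fun t _ =>
      integral_nonneg fun x => mul_nonneg (S.be_nonneg _ _) zero_le_one
    have e3 : ∫ t in (T - ε)..(T + ε), Φ t ≤ ∫ t in (T - ε)..(T + ε), D2 := by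
      refine intervalIntegral.integral_mono_on (by linarith) (hi _ _) (continuous_const.intervalIntegrable _ _) ?_
      intro t ht
      exact (le_abs_self _).trans (S.be_int_le hε (by linarith [ht.1]) c1)
    rw [intervalIntegral.integral_const, smul_eq_mul] at e3
    linarith
  have k0 := hd ε hε hε1
  have k1 : ∫ x, be ε u T x * 1 ≤ D1 := (le_abs_self _).trans (S.be_int_le hε (by linarith) c1)
  have k2 : ∫ x, be ε u T x * xd u x ≤ G1 := (le_abs_self _).trans (S.be_int_le hε (by linarith) hxc)
  rw [g2]
  have k3 := mul_le_mul_of_nonneg_left k1 (mul_nonneg hδ.le F1n)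
  have k4 := mul_le_mul_of_nonneg_left k2 (mul_nonneg hpi.le hδ.le)
  have k5 := mul_le_mul_of_nonneg_left g3 (mul_nonneg hpi.le hC0)
  have k6 : δ * K = 2 * (δ * F1 * D1) + 4 * (Real.pi * δ * G1) + δ := by rw [hK]; ring
  have k7 : ε * (16 * Real.pi * C * D2 + 1) = 8 * (Real.pi * C * (2 * ε * D2)) + ε := by ring
  linarith

end Setup

lemma far_grad {ω : E2 → ℝ} (h : ContDiff ℝ 2 ω) (hc : HasCompactSupport ω) :
    ∃ C R, 0 < C ∧ 0 < R ∧ ∀ x : E2, R ≤ ‖x‖ → |(∫ y, ω y) + 2 * Real.pi * xd (newtonConv ω) x| ≤ C / ‖x‖ := by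
  obtain ⟨R0, hR0, hR⟩ := supp_bound hc
  have hcont := h.continuous
  have hyc : ∀ i : Fin 2, Continuous (fun y : E2 => y i * ω y) := fun i => (coord_cont i).mul hcont
  have hys : ∀ i : Fin 2, HasCompactSupport (fun y : E2 => y i * ω y) := fun i => hc.mul_left
  have hI : ∀ i : Fin 2, 0 ≤ ∫ y : E2, |y i * ω y| := fun i => integral_nonneg fun y => abs_nonneg _
  refine ⟨2 * (∫ y : E2, |y 0 * ω y|) + 2 * (∫ y : E2, |y 1 * ω y|) + 1, 2 * R0, by linarith [hI 0, hI 1], by positivity, fun x hx => ?_⟩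
  have hxp : 0 < ‖x‖ := by linarith
  have key : (∫ y, ω y) + 2 * Real.pi * xd (newtonConv ω) x = -(cv (Kk 0) (fun y => y 0 * ω y) x) - cv (Kk 1) (fun y => y 1 * ω y) x := by
    unfold xd
    rw [newton_pd h hc, newton_pd h hc]
    have e1 : (∫ y, ω y) + 2 * Real.pi * (x 0 * (-(1 / (2 * Real.pi)) * cv (Kk 0) ω x) + x 1 * (-(1 / (2 * Real.pi)) * cv (Kk 1) ω x))
      = (∫ y, ω y) - (x 0 * cv (Kk 0) ω x + x 1 * cv (Kk 1) ω x) := by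
      have := Real.pi_pos
      field_simp; ring
    rw [e1]
    have i1 : ∀ i, Integrable (fun z => Kk i z * ω (x - z)) := fun i => cv_integrable (Kk_locInt i) hcont hc x
    have i2 : ∀ i, Integrable (fun z => Kk i z * ((x - z) i * ω (x - z))) := fun i => cv_integrable (ψ := fun y => y i * ω y) (Kk_locInt i) (hyc i) (hys i) x
    have e2 : ∫ y, ω y = ∫ z, ω (x - z) := (integral_sub_left_eq_self ω volume x).symm
    have e3 : ∫ z, ω (x - z) = ∫ z, ((x 0 * (Kk 0 z * ω (x - z)) + x 1 * (Kk 1 z * ω (x - z))) - (Kk 0 z * ((x - z) 0 * ω (x - z)) + Kk 1 z * ((x - z) 1 * ω (x - z)))) := by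
      refine integral_congr_ae ?_
      have h0 : ∀ᵐ z : E2, z ≠ 0 := by simp [ae_iff]
      filter_upwards [h0] with z hz
      have := Kk_dot z hz
      simp only [PiLp.sub_apply]
      linear_combination (- ω (x - z)) * this
    rw [e2, e3, integral_sub (i_add ((i1 0).const_mul _) ((i1 1).const_mul _)) (i_add (i2 0) (i2 1)),
      integral_add ((i1 0).const_mul _) ((i1 1).const_mul _), integral_add (i2 0) (i2 1), integral_const_mul, integral_const_mul]
    unfold cv
    ring
  have b : ∀ i, |cv (Kk i) (fun y => y i * ω y) x| ≤ 2 / ‖x‖ * ∫ y : E2, |y i * ω y| := by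
    intro i
    refine far_bound (hyc i) (hys i) (R0 := R0) (fun y hy => hR y (fun h0 => hy (by simp [h0]))) hx ?_
    intro z hz _
    refine (Kk_le i z).trans ?_
    rw [show 2 / ‖x‖ = (‖x‖ / 2)⁻¹ by rw [inv_div]]
    gcongr
  rw [key]
  have b0 := b 0
  have b1 := b 1
  have : (2 * (∫ y : E2, |y 0 * ω y|) + 2 * (∫ y : E2, |y 1 * ω y|) + 1) / ‖x‖ = 2 / ‖x‖ * (∫ y : E2, |y 0 * ω y|) + 2 / ‖x‖ * (∫ y : E2, |y 1 * ω y|) + 1 / ‖x‖ := by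
    field_simp
  rw [this]
  have h1 : 0 < 1 / ‖x‖ := by positivity
  rw [abs_le] at b0 b1 ⊢
  constructor <;> linarith

/-- primitive of a radial profile -/
def Th (χ : ℝ → ℝ) (B s : ℝ) : ℝ := ∫ t in s..B, χ t

lemma Th_deriv {χ : ℝ → ℝ} (h : Continuous χ) (B s : ℝ) : HasDerivAt (Th χ B) (-χ s) s := by
  have h1 := (h.integral_hasStrictDerivAt B s).hasDerivAt.neg
  have : Th χ B = -fun u => ∫ x in B..u, χ x := by
    ext u; simp only [Th, Pi.neg_apply]; rw [intervalIntegral.integral_symm]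
  rw [this]; exact h1

lemma Th_contDiff {χ : ℝ → ℝ} (h : Continuous χ) (B : ℝ) : ContDiff ℝ 1 (Th χ B) := by
  rw [contDiff_one_iff_deriv]
  refine ⟨fun s => (Th_deriv h B s).differentiableAt, ?_⟩
  have : deriv (Th χ B) = fun s => -χ s := by ext s; exact (Th_deriv h B s).deriv
  rw [this]; exact h.neg

lemma Th_zero {χ : ℝ → ℝ} {B s : ℝ} (hB : ∀ s, B ≤ s → χ s = 0) (hs : B ≤ s) : Th χ B s = 0 := by
  unfold Th
  have : ∫ t in s..B, χ t = ∫ t in s..B, (0:ℝ) := intervalIntegral.integral_congr fun t ht => by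
    rw [uIcc_of_ge hs] at ht
    exact hB t ht.1
  rw [this]; simp

/-- radial function -/
def rd (χ : ℝ → ℝ) (x : E2) : ℝ := χ (‖x‖ ^ 2)

lemma rd_cont {χ : ℝ → ℝ} (h : Continuous χ) : Continuous (rd χ) := h.comp (continuous_norm.pow 2)
lemma rd_hcs {χ : ℝ → ℝ} {B : ℝ} (hB : ∀ s, B ≤ s → χ s = 0) : HasCompactSupport (rd χ) := by
  refine HasCompactSupport.intro (isCompact_closedBall (0:E2) (|B| + 1)) ?_
  intro x hx
  refine hB _ ?_
  have : |B| + 1 < ‖x‖ := by simpa using hx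
  nlinarith [abs_nonneg B, le_abs_self B]

lemma pd_nsq (i : Fin 2) (x : E2) : pd i (fun x : E2 => ‖x‖ ^ 2) x = 2 * x i := by
  have : (fun x : E2 => ‖x‖ ^ 2) = fun x : E2 => (x 0 * x 0) + (x 1 * x 1) := by
    ext x; rw [normsq_e2]; ring
  have d : ∀ j, Differentiable ℝ (fun x : E2 => x j) := fun j => (coord_contDiff j (n := 1)).differentiable (by norm_num)
  have dd : ∀ j, Differentiable ℝ (fun x : E2 => x j * x j) := fun j => (d j).mul (d j)
  rw [this, pd_add (dd 0) (dd 1), pd_mul (d 0) (d 0), pd_mul (d 1) (d 1), pd_coord, pd_coord]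
  fin_cases i <;> simp <;> ring

lemma nsq_contDiff {n : WithTop ℕ∞} : ContDiff ℝ n (fun x : E2 => ‖x‖ ^ 2) := contDiff_norm_sq ℝ

lemma rd_Th_contDiff {χ : ℝ → ℝ} (h : Continuous χ) (B : ℝ) : ContDiff ℝ 1 (rd (Th χ B)) :=
  (Th_contDiff h B).comp nsq_contDiff

lemma rd_Th_pd {χ : ℝ → ℝ} (h : Continuous χ) (B : ℝ) (i : Fin 2) (x : E2) : pd i (rd (Th χ B)) x = - rd χ x * (2 * x i) := by
  have h1 : HasDerivAt (Th χ B) (-χ (‖x‖ ^ 2)) (‖x‖ ^ 2 - 0) := by rw [sub_zero]; exact Th_deriv h B _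
  have h2 := pd_comp (u := fun x : E2 => ‖x‖ ^ 2) h1 (nsq_contDiff.differentiable (n := 1) (by norm_num)) i
  simp only [sub_zero] at h2
  rw [pd_nsq] at h2
  exact h2

lemma rad_int {χ : ℝ → ℝ} (h : Continuous χ) {B : ℝ} (hB : ∀ s, B ≤ s → χ s = 0) :
    ∫ x, rd χ x = Real.pi * ∫ t in (0:ℝ)..B, χ t := by
  have h1 := polar_key (rd_Th_contDiff h B) (rd_hcs fun s hs => Th_zero hB hs)
  have e : ∫ z, fderiv ℝ (rd (Th χ B)) z z / ‖z‖ ^ 2 = ∫ z, (-2) * rd χ z := by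
    refine integral_congr_ae ?_
    have h0 : ∀ᵐ z : E2, z ≠ 0 := by simp [ae_iff]
    filter_upwards [h0] with z hz
    have hz' : ‖z‖ ^ 2 ≠ 0 := by
      have := norm_pos_iff.mpr hz
      positivity
    rw [fderiv_e2, rd_Th_pd h, rd_Th_pd h, div_eq_iff hz', normsq_e2]
    ring
  rw [e, integral_const_mul] at h1
  have : rd (Th χ B) 0 = ∫ t in (0:ℝ)..B, χ t := by simp [rd, Th]
  rw [this] at h1
  linarith

lemma rad_ibp {χ : ℝ → ℝ} (hχ : Continuous χ) {B : ℝ} (hB : ∀ s, B ≤ s → χ s = 0) {ω : E2 → ℝ} (h : ContDiff ℝ 2 ω) (hc : HasCompactSupport ω) :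
    ∫ x, rd χ x * xd (newtonConv ω) x = -(1/2) * ∫ x, rd (Th χ B) x * ω x := by
  have hN := newton_contDiff h hc
  have hcs := rd_hcs (χ := Th χ B) fun s hs => Th_zero hB hs
  have b : ∀ i, ∫ x, rd χ x * (x i * pd i (newtonConv ω) x) = (1/2) * ∫ x, rd (Th χ B) x * pd i (pd i (newtonConv ω)) x := by
    intro i
    have := ibp (rd_Th_contDiff hχ B) (pd_contDiff hN i) hcs i
    simp only [rd_Th_pd hχ] at this
    have e : ∫ x : E2, - rd χ x * (2 * x i) * pd i (newtonConv ω) x = (-2) * ∫ x, rd χ x * (x i * pd i (newtonConv ω) x) := by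
      rw [← integral_const_mul]; congr 1; ext x; ring
    rw [e] at this
    linarith
  have cN : ∀ i, Continuous (pd i (newtonConv ω)) := fun i => pd_cont (hN.of_le (by norm_num)) i
  have cN2 : ∀ i, Continuous (pd i (pd i (newtonConv ω))) := fun i => pd_cont (pd_contDiff hN i) i
  have i1 : ∀ i, Integrable (fun x => rd χ x * (x i * pd i (newtonConv ω) x)) := fun i =>
    ci ((rd_cont hχ).mul ((coord_cont i).mul (cN i))) (rd_hcs hB).mul_right
  have i2 : ∀ i, Integrable (fun x => rd (Th χ B) x * pd i (pd i (newtonConv ω)) x) := fun i =>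
    ci ((rd_Th_contDiff hχ B).continuous.mul (cN2 i)) hcs.mul_right
  have e1 : ∀ x, rd χ x * xd (newtonConv ω) x = rd χ x * (x 0 * pd 0 (newtonConv ω) x) + rd χ x * (x 1 * pd 1 (newtonConv ω) x) := fun x => by
    unfold xd; ring
  have e2 : ∀ x, rd (Th χ B) x * ω x = -(rd (Th χ B) x * pd 0 (pd 0 (newtonConv ω)) x + rd (Th χ B) x * pd 1 (pd 1 (newtonConv ω)) x) := fun x => by
    have := newton_lap h hc x
    linear_combination (rd (Th χ B) x) * this
  simp only [e1, e2]
  rw [integral_add (i1 0) (i1 1), integral_neg, integral_add (i2 0) (i2 1), b, b]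
  ring

/-- for radial cutoffs equal to one on the support the bracket vanishes -/
lemma rad_bracket {χ : ℝ → ℝ} (hχ : Continuous χ) {B A : ℝ} (hB : ∀ s, B ≤ s → χ s = 0) (hA : ∀ s, s ≤ A → χ s = 1)
    {ω : E2 → ℝ} (h : ContDiff ℝ 2 ω) (hc : HasCompactSupport ω) (hs : ∀ y, ω y ≠ 0 → ‖y‖ ^ 2 ≤ A) :
    ∫ x, rd χ x * ((∫ y, ω y) + 2 * Real.pi * xd (newtonConv ω) x) = Real.pi * ∫ x, ω x * ‖x‖ ^ 2 := by
  have hN := newton_contDiff h hc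
  have cN : ∀ i, Continuous (pd i (newtonConv ω)) := fun i => pd_cont (hN.of_le (by norm_num)) i
  have cx : Continuous (xd (newtonConv ω)) := by
    have h0 := cN 0
    have h1 := cN 1
    unfold xd; fun_prop
  have i1 : Integrable (rd χ) := ci (rd_cont hχ) (rd_hcs hB)
  have i2 : Integrable (fun x => rd χ x * xd (newtonConv ω) x) := ci ((rd_cont hχ).mul cx) (rd_hcs hB).mul_right
  set m := ∫ y, ω y with hm
  have e1 : ∫ x, rd χ x * (m + 2 * Real.pi * xd (newtonConv ω) x) = m * (∫ x, rd χ x) + 2 * Real.pi * ∫ x, rd χ x * xd (newtonConv ω) x := by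
    rw [← integral_const_mul, ← integral_const_mul, ← integral_add (i1.const_mul _) (i2.const_mul _)]
    congr 1; ext x; ring
  rw [e1, rad_int hχ hB, rad_ibp hχ hB h hc]
  have e2 : ∀ x, rd (Th χ B) x * ω x = Th χ B 0 * ω x - ω x * ‖x‖ ^ 2 := by
    intro x
    by_cases h0 : ω x = 0
    · simp [h0]
    have hx := hs x h0
    have : Th χ B 0 = ‖x‖ ^ 2 + rd (Th χ B) x := by
      unfold rd Th
      rw [← intervalIntegral.integral_add_adjacent_intervals (hχ.intervalIntegrable 0 (‖x‖ ^ 2)) (hχ.intervalIntegrable (‖x‖ ^ 2) B)]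
      congr 1
      have : ∫ t in (0:ℝ)..‖x‖ ^ 2, χ t = ∫ t in (0:ℝ)..‖x‖ ^ 2, (1:ℝ) := intervalIntegral.integral_congr fun t ht => by
        rw [uIcc_of_le (by positivity)] at ht
        exact hA t (ht.2.trans hx)
      rw [this]; simp
    rw [this]; ring
  simp only [e2]
  have j1 : Integrable ω := ci h.continuous hc
  have j2 : Integrable (fun x => ω x * ‖x‖ ^ 2) := ci (h.continuous.mul (continuous_norm.pow 2)) hc.mul_right
  rw [integral_sub (j1.const_mul _) j2, integral_const_mul]
  unfold Th
  ring

/-- bathtub principle -/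
lemma bathtub {b : E2 → ℝ} (hb : Continuous b) (hc : HasCompactSupport b) (h0 : ∀ x, 0 ≤ b x) (h1 : ∀ x, b x ≤ 1) :
    (1/2) * (∫ x, b x) ^ 2 ≤ Real.pi * ∫ x, b x * ‖x‖ ^ 2 := by
  have hpi := Real.pi_pos
  set d := ∫ x, b x with hd
  have hd0 : 0 ≤ d := integral_nonneg h0
  set B := d / Real.pi with hB
  have hB0 : 0 ≤ B := by positivity
  set χ : ℝ → ℝ := fun s => max (B - s) 0 with hχ
  have cχ : Continuous χ := by rw [hχ]; fun_prop
  have hχB : ∀ s, B ≤ s → χ s = 0 := fun s hs => max_eq_right (by linarith)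
  have e1 := rad_int cχ hχB
  have e2 : ∫ t in (0:ℝ)..B, χ t = B ^ 2 / 2 := by
    have : ∫ t in (0:ℝ)..B, χ t = ∫ t in (0:ℝ)..B, (B - t) := intervalIntegral.integral_congr fun t ht => by
      rw [uIcc_of_le hB0] at ht
      exact max_eq_left (by linarith [ht.2])
    rw [this, intervalIntegral.integral_sub (by simp) (by simp)]
    simp; ring
  have ib : Integrable b := ci hb hc
  have ib2 : Integrable (fun x => b x * ‖x‖ ^ 2) := ci (hb.mul (continuous_norm.pow 2)) hc.mul_right
  have e3 : ∫ x, (B * b x - b x * ‖x‖ ^ 2) ≤ ∫ x, rd χ x := by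
    refine integral_mono (i_sub (ib.const_mul _) ib2) (ci (rd_cont cχ) (rd_hcs hχB)) ?_
    intro x
    simp only [rd, hχ]
    rcases le_total (B - ‖x‖ ^ 2) 0 with h | h
    · rw [max_eq_right h]
      nlinarith [h0 x]
    · rw [max_eq_left h]
      nlinarith [h1 x]
  rw [integral_sub (ib.const_mul _) ib2, integral_const_mul, e1, e2] at e3
  have hBd : B * Real.pi = d := by rw [hB]; field_simp
  have : Real.pi * (B * d) = d ^ 2 := by rw [← hBd]; ring
  nlinarith

/-- the stream function in normalised form -/
def uu (ω : E2 → ℝ) (l : ℝ) (x : E2) : ℝ := newtonConv ω x - l / 4 * ‖x‖ ^ 2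

lemma uu_contDiff {ω : E2 → ℝ} (h : ContDiff ℝ 2 ω) (hc : HasCompactSupport ω) (l : ℝ) : ContDiff ℝ 2 (uu ω l) :=
  (newton_contDiff h hc).sub (contDiff_const.mul nsq_contDiff)

lemma uu_pd {ω : E2 → ℝ} (h : ContDiff ℝ 2 ω) (hc : HasCompactSupport ω) (l : ℝ) (i : Fin 2) :
    pd i (uu ω l) = fun x => pd i (newtonConv ω) x + (-(l / 2)) * x i := by
  ext x
  have e : uu ω l = fun x => newtonConv ω x + (-(l / 4)) * ‖x‖ ^ 2 := by ext x; unfold uu; ring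
  have d1 : Differentiable ℝ (fun x : E2 => ‖x‖ ^ 2) := nsq_contDiff.differentiable (n := 1) (by norm_num)
  have d2 : Differentiable ℝ (fun x : E2 => (-(l / 4)) * ‖x‖ ^ 2) := d1.const_mul _
  rw [e, pd_add ((newton_contDiff h hc).differentiable (by norm_num)) d2, pd_const_mul d1, pd_nsq]
  ring

lemma uu_xd {ω : E2 → ℝ} (h : ContDiff ℝ 2 ω) (hc : HasCompactSupport ω) (l : ℝ) (x : E2) :
    xd (uu ω l) x = xd (newtonConv ω) x - l / 2 * ‖x‖ ^ 2 := by
  unfold xd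
  rw [uu_pd h hc, uu_pd h hc, normsq_e2]
  ring

lemma uu_lap {ω : E2 → ℝ} (h : ContDiff ℝ 2 ω) (hc : HasCompactSupport ω) (l : ℝ) (x : E2) :
    pd 0 (pd 0 (uu ω l)) x + pd 1 (pd 1 (uu ω l)) x = -(ω x + l) := by
  have d1 : ∀ i : Fin 2, Differentiable ℝ (fun x : E2 => x i) := fun i => (coord_contDiff i (n := 1)).differentiable (by norm_num)
  have d2 : ∀ i : Fin 2, Differentiable ℝ (fun x : E2 => (-(l/2)) * x i) := fun i => (d1 i).const_mul _
  have d3 : ∀ i : Fin 2, Differentiable ℝ (pd i (newtonConv ω)) := fun i => (pd_contDiff (newton_contDiff h hc) i).differentiable (by norm_num)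
  rw [uu_pd h hc, uu_pd h hc, pd_add (d3 0) (d2 0), pd_add (d3 1) (d2 1), pd_const_mul (d1 0), pd_const_mul (d1 1), pd_coord, pd_coord]
  have := newton_lap h hc x
  simp
  linarith

lemma pd_add_const (ω : E2 → ℝ) (l : ℝ) (i : Fin 2) (x : E2) : pd i (fun x => ω x + l) x = pd i ω x := by
  unfold pd; rw [fderiv_add_const]

lemma mkSetup {ω : E2 → ℝ} (h : ContDiff ℝ 2 ω) (hc : HasCompactSupport ω) {l : ℝ} (hl : 0 ≤ l)
    (hpos : ∀ x, 0 ≤ ω x + l) (hne : ∃ x, ω x ≠ 0)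
    (hpar : ∀ x, pd 0 (uu ω l) x * pd 1 ω x = pd 1 (uu ω l) x * pd 0 ω x) :
    Setup (uu ω l) (fun x => ω x + l) where
  hu := uu_contDiff h hc l
  hf := h.add contDiff_const
  f0 := hpos
  lap := uu_lap h hc l
  par := fun x => by rw [pd_add_const, pd_add_const]; exact hpar x
  bdd := fun T => superlevel_bdd h hc hl hpos hne T

lemma def_expand {ω : E2 → ℝ} (h : ContDiff ℝ 2 ω) (hc : HasCompactSupport ω) (l : ℝ) {b : E2 → ℝ} (hb : Continuous b) (hbc : HasCompactSupport b)
    (h1 : ∀ x, ω x ≠ 0 → b x = 1) :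
    (1/2) * (∫ x, b x * (ω x + l)) ^ 2 + 2 * Real.pi * ∫ x, b x * ((ω x + l) * xd (uu ω l) x)
     = l ^ 2 * ((1/2) * (∫ x, b x) ^ 2 - Real.pi * ∫ x, b x * ‖x‖ ^ 2)
      + l * ((∫ x, b x * ((∫ y, ω y) + 2 * Real.pi * xd (newtonConv ω) x)) - Real.pi * ∫ x, ω x * ‖x‖ ^ 2) := by
  have hpi := Real.pi_pos
  have hN := newton_contDiff h hc
  have cN : ∀ i, Continuous (pd i (newtonConv ω)) := fun i => pd_cont (hN.of_le (by norm_num)) i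
  have cx : Continuous (xd (newtonConv ω)) := by
    have h0 := cN 0
    have h1 := cN 1
    unfold xd; fun_prop
  have hv := virial h hc
  have hv : ∫ x, ω x * xd (newtonConv ω) x = - (∫ x, ω x) ^ 2 / (4 * Real.pi) := hv
  set m := ∫ y, ω y with hm
  have hbω : ∀ x, b x * ω x = ω x := fun x => by
    by_cases h0 : ω x = 0
    · simp [h0]
    · rw [h1 x h0, one_mul]
  have ib : Integrable b := ci hb hbc
  have iω : Integrable ω := ci h.continuous hc
  have ib2 : Integrable (fun x => b x * ‖x‖ ^ 2) := ci (hb.mul (continuous_norm.pow 2)) hbc.mul_right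
  have iω2 : Integrable (fun x => ω x * ‖x‖ ^ 2) := ci (h.continuous.mul (continuous_norm.pow 2)) hc.mul_right
  have ibx : Integrable (fun x => b x * xd (newtonConv ω) x) := ci (hb.mul cx) hbc.mul_right
  have iωx : Integrable (fun x => ω x * xd (newtonConv ω) x) := ci (h.continuous.mul cx) hc.mul_right
  have e1 : ∫ x, b x * (ω x + l) = m + l * ∫ x, b x := by
    rw [← integral_const_mul, hm, ← integral_add iω (ib.const_mul _)]
    congr 1; ext x; linear_combination hbω x
  have e2 : ∫ x, b x * ((ω x + l) * xd (uu ω l) x) = (∫ x, ω x * xd (newtonConv ω) x) + (-(l/2)) * (∫ x, ω x * ‖x‖ ^ 2)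
      + l * (∫ x, b x * xd (newtonConv ω) x) + (-(l^2/2)) * ∫ x, b x * ‖x‖ ^ 2 := by
    rw [← integral_const_mul, ← integral_const_mul, ← integral_const_mul, ← integral_add iωx (iω2.const_mul _),
      ← integral_add (i_add iωx (iω2.const_mul _)) (ibx.const_mul _),
      ← integral_add (i_add (i_add iωx (iω2.const_mul _)) (ibx.const_mul _)) (ib2.const_mul _)]
    congr 1; ext x
    rw [uu_xd h hc]
    linear_combination (xd (newtonConv ω) x - l / 2 * ‖x‖ ^ 2) * hbω x
  have e3 : ∫ x, b x * (m + 2 * Real.pi * xd (newtonConv ω) x) = m * (∫ x, b x) + 2 * Real.pi * ∫ x, b x * xd (newtonConv ω) x := by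
    rw [← integral_const_mul, ← integral_const_mul, ← integral_add (ib.const_mul _) (ibx.const_mul _)]
    congr 1; ext x; ring
  rw [e1, e2, e3, hv]
  field_simp
  ring

/-- the set where `uu ≥ T` contains any ball, for `T` small -/
lemma uu_low {ω : E2 → ℝ} (h : ContDiff ℝ 2 ω) (hc : HasCompactSupport ω) (l R : ℝ) : ∃ T, ∀ x, ‖x‖ ≤ R → T ≤ uu ω l x := by
  obtain ⟨C, hC⟩ := (isCompact_closedBall (0:E2) R).exists_bound_of_continuousOn (f := uu ω l) (uu_contDiff h hc l).continuous.continuousOn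
  exact ⟨-C, fun x hx => (abs_le.mp (hC x (by simpa using hx))).1⟩

lemma def_zero {ω : E2 → ℝ} (h : ContDiff ℝ 2 ω) (hc : HasCompactSupport ω) (S : Setup (uu ω 0) (fun x => ω x + 0)) (T0 : ℝ) :
    ∃ T ≤ T0, ∀ ε, 0 < ε → ε ≤ 1 →
      (1/2) * (∫ x, be ε (uu ω 0) T x * (ω x + 0)) ^ 2 + 2 * Real.pi * ∫ x, be ε (uu ω 0) T x * ((ω x + 0) * xd (uu ω 0) x) ≤ 0 := by
  obtain ⟨R0, hR0, hR⟩ := supp_bound hc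
  obtain ⟨T, hT⟩ := uu_low h hc 0 R0
  refine ⟨min T0 (T - 1), min_le_left _ _, fun ε hε hε1 => ?_⟩
  rw [def_expand h hc 0 (S.be_contDiff ε _).continuous (S.be_hcs hε _)]
  · simp
  · intro x hx
    have := hT x (hR x hx)
    have h2 := min_le_right T0 (T - 1)
    exact bt_one hε (by linarith)

lemma ramp_int {χ : ℝ → ℝ} (h : Continuous χ) {A B : ℝ} (hA : 0 ≤ A) (hAB : A ≤ B) (h0 : ∀ s, 0 ≤ χ s) (h1 : ∀ s, χ s ≤ 1) (hχ : ∀ s, s ≤ A → χ s = 1) :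
    A ≤ (∫ t in (0:ℝ)..B, χ t) ∧ (∫ t in (0:ℝ)..B, χ t) ≤ B := by
  have hi : ∀ a b, IntervalIntegrable χ volume a b := fun a b => h.intervalIntegrable a b
  constructor
  · rw [← intervalIntegral.integral_add_adjacent_intervals (hi 0 A) (hi A B)]
    have e : ∫ t in (0:ℝ)..A, χ t = ∫ t in (0:ℝ)..A, (1:ℝ) := intervalIntegral.integral_congr fun t ht => by
      rw [uIcc_of_le hA] at ht
      exact hχ t ht.2
    have e2 : 0 ≤ ∫ t in A..B, χ t := intervalIntegral.integral_nonneg hAB fun t _ => h0 t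
    rw [e]; simp; exact e2
  · calc _ ≤ ∫ t in (0:ℝ)..B, (1:ℝ) := intervalIntegral.integral_mono_on (hA.trans hAB) (hi _ _) (by simp) fun t _ => h1 t
      _ = B := by simp

/-- smooth cut-off between A and B -/
def ramp (A B s : ℝ) : ℝ := bt (B - A) (B - s)
lemma ramp_cont (A B : ℝ) : Continuous (ramp A B) := (bt_cont _).comp (continuous_const.sub continuous_id)
lemma ramp_one {A B s : ℝ} (hAB : A < B) (h : s ≤ A) : ramp A B s = 1 := bt_one (by linarith) (by linarith)
lemma ramp_zero {A B s : ℝ} (hAB : A < B) (h : B ≤ s) : ramp A B s = 0 := bt_zero (by linarith) (by linarith)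
lemma ramp_nonneg (A B s : ℝ) : 0 ≤ ramp A B s := bt_nonneg _ _
lemma ramp_le (A B s : ℝ) : ramp A B s ≤ 1 := bt_le_one _ _

set_option maxHeartbeats 1600000 in
lemma def_pos {ω : E2 → ℝ} (h : ContDiff ℝ 2 ω) (hc : HasCompactSupport ω) {l : ℝ} (hl : 0 < l) (S : Setup (uu ω l) (fun x => ω x + l)) (T0 : ℝ) {η : ℝ} (hη : 0 < η) :
    ∃ T ≤ T0, ∀ ε, 0 < ε → ε ≤ 1 →
      (1/2) * (∫ x, be ε (uu ω l) T x * (ω x + l)) ^ 2 + 2 * Real.pi * ∫ x, be ε (uu ω l) T x * ((ω x + l) * xd (uu ω l) x) ≤ η := by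
  have hpi := Real.pi_pos
  obtain ⟨R0, hR0, hR⟩ := supp_bound hc
  obtain ⟨C, R1, hC, hR1, hfar⟩ := far_grad h hc
  -- choose κ
  obtain ⟨κ, hκ, hκ1, hκη⟩ : ∃ κ, 0 < κ ∧ κ ≤ 1/8 ∧ l * (8 * Real.pi * C * κ) ≤ η :=
    ⟨min (1/8) (η / (l * (8 * Real.pi * C))), by positivity, min_le_left _ _, by
      calc _ ≤ l * (8 * Real.pi * C * (η / (l * (8 * Real.pi * C)))) := by gcongr; exact min_le_right _ _
        _ = η := by field_simp⟩
  obtain ⟨R2, hR2, hlit⟩ := newton_little h hc (κ := l * κ / 8) (by positivity)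
  obtain ⟨C3, hC3⟩ := uu_low h hc l R2
  -- choose ρ
  obtain ⟨ρ, hρ1, hρ2, hρ3, hρ4, hρ5, hρ6⟩ : ∃ ρ : ℝ, 1 ≤ ρ ∧ 2 * R0 ≤ ρ ∧ 2 * R1 ≤ ρ ∧ 2 * R2 ≤ ρ ∧ 8 / (l * κ) ≤ ρ ∧ (4 / l) * (|T0| + |C3| + 1) ≤ ρ :=
    ⟨max (max (max 1 (2 * R0)) (max (2 * R1) (2 * R2))) (max (8 / (l * κ)) ((4 / l) * (|T0| + |C3| + 1))), by simp, by simp, by simp, by simp, by simp, by simp⟩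
  have hρp : 0 < ρ := by linarith
  have k5 : 1 ≤ l * κ * ρ / 8 := by
    rw [div_le_iff₀ (by positivity)] at hρ5
    linarith
  have k6 : |T0| + |C3| + 1 ≤ l / 4 * ρ := by
    have := mul_le_mul_of_nonneg_left hρ6 (show 0 ≤ l / 4 by positivity)
    calc _ = l / 4 * ((4 / l) * (|T0| + |C3| + 1)) := by field_simp
      _ ≤ _ := this
  have k7 : |T0| + |C3| + 1 ≤ l / 4 * ρ ^ 2 := k6.trans (by nlinarith [mul_pos hl hρp])
  have hκρ : κ * ρ ≤ ρ ^ 2 / 8 := by nlinarith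
  set T := -(l / 4 * ρ ^ 2) with hT
  have hTT0 : T ≤ T0 := by linarith [neg_abs_le T0, abs_nonneg C3]
  refine ⟨T, hTT0, fun ε hε hε1 => ?_⟩
  set b := be ε (uu ω l) T with hb
  have cb : Continuous b := (S.be_contDiff ε T).continuous
  have sb : HasCompactSupport b := S.be_hcs hε T
  have hin : ∀ x, ‖x‖ ^ 2 ≤ ρ ^ 2 - κ * ρ → b x = 1 := by
    intro x hx
    refine bt_one hε (hε1.trans ?_)
    by_cases h2 : ‖x‖ ≤ R2
    · have := hC3 x h2
      linarith [neg_abs_le C3, abs_nonneg T0]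
    · push Not at h2
      have := (abs_le.mp (hlit x h2.le)).1
      have hxρ : ‖x‖ ≤ ρ := by
        refine abs_le_of_sq_le_sq' (a := ‖x‖) ?_ hρp.le |>.2
        nlinarith
      have h3 : l * κ / 8 * ‖x‖ ≤ l * κ / 8 * ρ := by gcongr
      have h4 : l / 4 * ‖x‖ ^ 2 ≤ l / 4 * (ρ ^ 2 - κ * ρ) := by gcongr
      unfold uu
      rw [hT]
      nlinarith
  have hout : ∀ x, ρ ^ 2 + κ * ρ ≤ ‖x‖ ^ 2 → b x = 0 := by
    intro x hx
    refine bt_zero hε ?_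
    have hxρ : ρ ≤ ‖x‖ := by
      refine abs_le_of_sq_le_sq' (a := ρ) ?_ (norm_nonneg x) |>.2
      nlinarith [mul_pos hκ hρp]
    have := (abs_le.mp (hlit x (by linarith))).2
    have h3 : κ / 2 * ‖x‖ ≤ ‖x‖ ^ 2 - ρ ^ 2 := by
      by_cases h4 : ‖x‖ ≤ 2 * ρ
      · nlinarith
      · push Not at h4
        nlinarith
    have h5 := mul_le_mul_of_nonneg_left h3 (show 0 ≤ l / 4 by positivity)
    unfold uu
    rw [hT]
    linarith
  have hωb : ∀ y, ω y ≠ 0 → ‖y‖ ^ 2 ≤ ρ ^ 2 - κ * ρ := by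
    intro y hy
    have h2 := hR y hy
    have : ‖y‖ ≤ ρ / 2 := by linarith
    nlinarith [norm_nonneg y]
  rw [def_expand h hc l cb sb (fun x hx => hin x (hωb x hx))]
  have hbath := bathtub cb sb (fun x => S.be_nonneg _ _) (fun x => bt_le_one _ _)
  set m := ∫ y, ω y with hm
  have hκρ0 : 0 < κ * ρ := by positivity
  set χ := ramp (ρ ^ 2 - κ * ρ) (ρ ^ 2 + κ * ρ) with hχ
  set χ1 := ramp (ρ ^ 2 - 2 * (κ * ρ)) (ρ ^ 2 - κ * ρ) with hχ1
  set χ2 := ramp (ρ ^ 2 + κ * ρ) (ρ ^ 2 + 2 * (κ * ρ)) with hχ2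
  have hχB : ∀ s, ρ ^ 2 + κ * ρ ≤ s → χ s = 0 := fun s hs => ramp_zero (by linarith) hs
  have hχA : ∀ s, s ≤ ρ ^ 2 - κ * ρ → χ s = 1 := fun s hs => ramp_one (by linarith) hs
  have h1B : ∀ s, ρ ^ 2 - κ * ρ ≤ s → χ1 s = 0 := fun s hs => ramp_zero (by linarith) hs
  have h2B : ∀ s, ρ ^ 2 + 2 * (κ * ρ) ≤ s → χ2 s = 0 := fun s hs => ramp_zero (by linarith) hs
  have hbr := rad_bracket (ramp_cont _ _) hχB hχA h hc hωb
  rw [← hm] at hbr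
  have hN := newton_contDiff h hc
  have cN : ∀ i, Continuous (pd i (newtonConv ω)) := fun i => pd_cont (hN.of_le (by norm_num)) i
  have cx : Continuous (fun x => m + 2 * Real.pi * xd (newtonConv ω) x) := by
    have h0 := cN 0
    have h1 := cN 1
    unfold xd; fun_prop
  have i1 : Integrable (fun x => b x * (m + 2 * Real.pi * xd (newtonConv ω) x)) := ci (cb.mul cx) sb.mul_right
  have i2 : Integrable (fun x => rd χ x * (m + 2 * Real.pi * xd (newtonConv ω) x)) := ci ((rd_cont (ramp_cont _ _)).mul cx) (rd_hcs hχB).mul_right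
  have j1 : Integrable (rd χ1) := ci (rd_cont (ramp_cont _ _)) (rd_hcs h1B)
  have j2 : Integrable (rd χ2) := ci (rd_cont (ramp_cont _ _)) (rd_hcs h2B)
  have hdiff : |(∫ x, b x * (m + 2 * Real.pi * xd (newtonConv ω) x)) - Real.pi * ∫ x, ω x * ‖x‖ ^ 2| ≤ 8 * Real.pi * C * κ := by
    rw [← hbr, ← integral_sub i1 i2, ← Real.norm_eq_abs]
    have hbnd : ∀ x, ‖b x * (m + 2 * Real.pi * xd (newtonConv ω) x) - rd χ x * (m + 2 * Real.pi * xd (newtonConv ω) x)‖ ≤ (2 * C / ρ) * (rd χ2 x - rd χ1 x) := by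
      intro x
      rw [← sub_mul, Real.norm_eq_abs, abs_mul]
      by_cases hx1 : ‖x‖ ^ 2 ≤ ρ ^ 2 - κ * ρ
      · have : rd χ2 x = 1 := ramp_one (by linarith) (by linarith)
        have h3 : rd χ1 x ≤ 1 := ramp_le _ _ _
        rw [hin x hx1, show rd χ x = 1 from hχA _ hx1, this]
        simp
        exact mul_nonneg (by positivity) (by linarith)
      by_cases hx2 : ρ ^ 2 + κ * ρ ≤ ‖x‖ ^ 2
      · have : rd χ1 x = 0 := h1B _ (by linarith)
        have h3 : 0 ≤ rd χ2 x := ramp_nonneg _ _ _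
        rw [hout x hx2, show rd χ x = 0 from hχB _ hx2, this]
        simp
        positivity
      push Not at hx1 hx2
      have e1 : rd χ1 x = 0 := h1B _ hx1.le
      have e2 : rd χ2 x = 1 := ramp_one (by linarith) hx2.le
      have hxρ : ρ / 2 ≤ ‖x‖ := by
        refine abs_le_of_sq_le_sq' (a := ρ / 2) ?_ (norm_nonneg x) |>.2
        nlinarith
      have h3 := hfar x (by linarith)
      have h4 : |b x - rd χ x| ≤ 1 := by
        have a1 : 0 ≤ b x := S.be_nonneg _ _
        have a2 : b x ≤ 1 := bt_le_one _ _
        have a3 : 0 ≤ rd χ x := ramp_nonneg _ _ _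
        have a4 : rd χ x ≤ 1 := ramp_le _ _ _
        rw [abs_le]; constructor <;> linarith
      rw [e1, e2]
      calc _ ≤ 1 * (C / ‖x‖) := by gcongr
        _ ≤ 1 * (C / (ρ / 2)) := by gcongr
        _ = _ := by field_simp; ring
    refine (norm_integral_le_of_norm_le ((i_sub j2 j1).const_mul _) (ae_of_all _ hbnd)).trans ?_
    rw [integral_const_mul, integral_sub j2 j1, rad_int (ramp_cont _ _) h1B, rad_int (ramp_cont _ _) h2B]
    have r1 := (ramp_int (ramp_cont (ρ ^ 2 - 2 * (κ * ρ)) (ρ ^ 2 - κ * ρ)) (A := ρ ^ 2 - 2 * (κ * ρ)) (B := ρ ^ 2 - κ * ρ) (by nlinarith) (by linarith)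
      (ramp_nonneg _ _) (ramp_le _ _) (fun s hs => ramp_one (by linarith) hs)).1
    have r2 := (ramp_int (ramp_cont (ρ ^ 2 + κ * ρ) (ρ ^ 2 + 2 * (κ * ρ))) (A := ρ ^ 2 + κ * ρ) (B := ρ ^ 2 + 2 * (κ * ρ)) (by positivity) (by linarith)
      (ramp_nonneg _ _) (ramp_le _ _) (fun s hs => ramp_one (by linarith) hs)).2
    rw [← hχ1] at r1
    rw [← hχ2] at r2
    calc _ = (2 * C / ρ) * Real.pi * ((∫ t in (0:ℝ)..(ρ ^ 2 + 2 * (κ * ρ)), χ2 t) - ∫ t in (0:ℝ)..(ρ ^ 2 - κ * ρ), χ1 t) := by ring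
      _ ≤ (2 * C / ρ) * Real.pi * (4 * (κ * ρ)) := by gcongr; linarith
      _ = _ := by field_simp; ring
  have k1 := mul_le_mul_of_nonneg_left ((le_abs_self _).trans hdiff) hl.le
  have k2 : l ^ 2 * ((1/2) * (∫ x, b x) ^ 2 - Real.pi * ∫ x, b x * ‖x‖ ^ 2) ≤ 0 := mul_nonpos_of_nonneg_of_nonpos (by positivity) (by linarith)
  linarith

lemma def_small {ω : E2 → ℝ} (h : ContDiff ℝ 2 ω) (hc : HasCompactSupport ω) {l : ℝ} (hl : 0 ≤ l) (S : Setup (uu ω l) (fun x => ω x + l)) (T0 : ℝ) :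
    ∀ η > 0, ∃ T ≤ T0, ∀ ε, 0 < ε → ε ≤ 1 →
      (1/2) * (∫ x, be ε (uu ω l) T x * (ω x + l)) ^ 2 + 2 * Real.pi * ∫ x, be ε (uu ω l) T x * ((ω x + l) * xd (uu ω l) x) ≤ η := by
  intro η hη
  rcases hl.eq_or_lt with rfl | hl
  · obtain ⟨T, hT, h1⟩ := def_zero h hc S T0
    exact ⟨T, hT, fun ε h2 h3 => (h1 ε h2 h3).trans hη.le⟩
  · exact def_pos h hc hl S T0 hη

namespace Setup

lemma be_anti {u f : E2 → ℝ} (_S : Setup u f) {ε : ℝ} (hε : 0 < ε) {t s : ℝ} (h : t ≤ s) (x : E2) : be ε u s x ≤ be ε u t x :=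
  bt_mono hε (by linarith)

lemma MM_anti {u f : E2 → ℝ} (S : Setup u f) {ε : ℝ} (hε : 0 < ε) {t s : ℝ} (h : t ≤ s) : S.MM ε s ≤ S.MM ε t := by
  rw [S.MM_be hε, S.MM_be hε]
  refine integral_mono (S.be_int hε s S.hf.continuous) (S.be_int hε t S.hf.continuous) fun x => ?_
  exact mul_le_mul_of_nonneg_right (S.be_anti hε h x) (S.f0 x)

lemma be_pd_zero {u f : E2 → ℝ} (S : Setup u f) {ε : ℝ} (hε : 0 < ε) (t : ℝ) (i : Fin 2) : ∫ x, be ε u t x * pd i u x = 0 := by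
  set BT : ℝ → ℝ := fun s => ∫ r in (0:ℝ)..s, bt ε r with hBT
  have hd : ∀ s, HasDerivAt BT (bt ε s) s := fun s => ((bt_cont ε).integral_hasStrictDerivAt 0 s).hasDerivAt
  have hC : ContDiff ℝ 1 BT := by
    rw [contDiff_one_iff_deriv]
    refine ⟨fun s => (hd s).differentiableAt, ?_⟩
    have : deriv BT = bt ε := by ext s; exact (hd s).deriv
    rw [this]; exact bt_cont ε
  have h0 : ∀ s ≤ 0, BT s = 0 := by
    intro s hs
    simp only [hBT]
    have : ∫ r in (0:ℝ)..s, bt ε r = ∫ r in (0:ℝ)..s, (0:ℝ) := intervalIntegral.integral_congr fun r hr => by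
      rw [uIcc_of_ge hs] at hr
      exact bt_zero hε hr.2
    rw [this]; simp
  have hφ : ContDiff ℝ 1 (fun x => BT (u x - t)) := hC.comp ((S.hu.of_le (by norm_num)).sub contDiff_const)
  have := integral_pd_zero hφ (S.hcs (t := t) fun x hx => h0 _ (by linarith)) i
  rw [← this]
  congr 1; ext x
  rw [pd_comp (hd _) S.du]
  rfl

lemma W_eq {u f : E2 → ℝ} (S : Setup u f) {ε : ℝ} (hε : 0 < ε) (t : ℝ) (c : E2) (i : Fin 2) :
    ∫ x, bb ε u t x * (g2 u x * (x i - c i)) = ∫ x, be ε u t x * (f x * (x i - c i)) := by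
  have hξ : Continuous (fun x : E2 => x i - c i) := (coord_cont i).sub continuous_const
  have cξ : ContDiff ℝ 1 (fun x : E2 => x i - c i) := (coord_contDiff i).sub contDiff_const
  have pξ : ∀ j x, pd j (fun x : E2 => x i - c i) x = if j = i then 1 else 0 := by
    intro j x
    have := pd_add_const (fun x : E2 => x i) (-c i) j x
    rw [pd_coord] at this
    rw [← this]; rfl
  have hu := S.pdu_cont
  have hu2 : ∀ j, Continuous (pd j (pd j u)) := fun j => pd_cont (pd_contDiff S.hu j) j
  have b : ∀ j, ∫ x, bb ε u t x * (pd j u x ^ 2 * (x i - c i)) = - ∫ x, be ε u t x * (pd j (pd j u) x * (x i - c i) + pd j u x * (if j = i then 1 else 0)) := by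
    intro j
    have h1 := ibp ((S.be_contDiff ε t).of_le (by norm_num)) ((pd_contDiff S.hu j).mul cξ) (S.be_hcs hε t) j
    have e1 : ∀ x, pd j (be ε u t) x * (pd j u x * (x i - c i)) = bb ε u t x * (pd j u x ^ 2 * (x i - c i)) := fun x => by
      rw [S.be_pd]; ring
    have e2 : ∀ x, pd j (fun x => pd j u x * (x i - c i)) x = pd j (pd j u) x * (x i - c i) + pd j u x * (if j = i then 1 else 0) := fun x => by
      rw [pd_mul ((pd_contDiff S.hu j).differentiable (by norm_num)) (cξ.differentiable (by norm_num)), pξ]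
    simp only [e1, e2] at h1
    exact h1
  have i1 : ∀ j, Integrable (fun x => bb ε u t x * (pd j u x ^ 2 * (x i - c i))) := fun j => S.bb_int hε t (((hu j).pow 2).mul hξ)
  have cc : ∀ j, Continuous (fun x => pd j (pd j u) x * (x i - c i) + pd j u x * (if j = i then 1 else 0)) := fun j =>
    ((hu2 j).mul hξ).add ((hu j).mul continuous_const)
  have i2 : ∀ j, Integrable (fun x => be ε u t x * (pd j (pd j u) x * (x i - c i) + pd j u x * (if j = i then 1 else 0))) := fun j => S.be_int hε t (cc j)
  have e3 : ∀ x, bb ε u t x * (g2 u x * (x i - c i)) = bb ε u t x * (pd 0 u x ^ 2 * (x i - c i)) + bb ε u t x * (pd 1 u x ^ 2 * (x i - c i)) := fun x => by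
    unfold g2; ring
  simp only [e3]
  rw [integral_add (i1 0) (i1 1), b, b, ← neg_add, ← integral_add (i2 0) (i2 1)]
  have e4 : ∀ x, be ε u t x * (pd 0 (pd 0 u) x * (x i - c i) + pd 0 u x * (if 0 = i then 1 else 0)) + be ε u t x * (pd 1 (pd 1 u) x * (x i - c i) + pd 1 u x * (if 1 = i then 1 else 0))
    = be ε u t x * pd i u x - be ε u t x * (f x * (x i - c i)) := by
    intro x
    have h1 := S.lap x
    have h2 : pd 0 u x * (if 0 = i then 1 else 0) + pd 1 u x * (if 1 = i then 1 else 0) = pd i u x := by fin_cases i <;> simp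
    linear_combination be ε u t x * (x i - c i) * h1 + be ε u t x * h2
  simp only [e4]
  have cfξ : Continuous (fun x => f x * (x i - c i)) := S.hf.continuous.mul hξ
  rw [integral_sub (S.be_int hε t (hu i)) (S.be_int hε t cfξ), S.be_pd_zero hε]
  ring

/-- generic bound: weights times bounded -/
lemma xi_bound {u f : E2 → ℝ} (S : Setup u f) {R : ℝ} {b : E2 → ℝ} {t : ℝ} (hb0 : ∀ x, 0 ≤ b x) (hbz : ∀ x, u x < t → b x = 0)
    (hR : ∀ x, t ≤ u x → ‖x‖ < R) {c : E2} {i : Fin 2} (hc : |c i| ≤ R) {p : E2 → ℝ} (hp : ∀ x, 0 ≤ p x) (hi : Integrable (fun x => b x * p x)) :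
    |∫ x, b x * (p x * (x i - c i))| ≤ 2 * R * ∫ x, b x * p x := by
  rw [← Real.norm_eq_abs, ← integral_const_mul]
  refine norm_integral_le_of_norm_le (hi.const_mul _) (ae_of_all _ fun x => ?_)
  by_cases h : u x < t
  · simp [hbz x h]
  · push Not at h
    have h1 := hR x h
    have hx : |x i - c i| ≤ 2 * R := by
      have := abs_sub (x i) (c i)
      linarith [abs_coord_le x i]
    rw [Real.norm_eq_abs, abs_mul, abs_mul, abs_of_nonneg (hb0 x), abs_of_nonneg (hp x)]
    have := mul_le_mul_of_nonneg_left hx (mul_nonneg (hb0 x) (hp x))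
    linarith

set_option maxHeartbeats 1000000 in
lemma step {u f : E2 → ℝ} (S : Setup u f) {T0 t1 T1 R F1 D1 θ ε δ μ0 : ℝ} (h01 : T0 ≤ t1) (h11 : t1 ≤ T1) (hT1 : ∀ x, u x < T1)
    (hR0 : 0 < R) (hR : ∀ x, T0 ≤ u x → ‖x‖ < R) (hε : 0 < ε) (hδ : 0 < δ) (hθ : 0 < θ) (hθ1 : θ ≤ 1) (hδη : δ ≤ θ ^ 2)
    (hF1 : ∫ x, be ε u T0 x * f x ≤ F1) (hD1 : ∫ x, be ε u T0 x * 1 ≤ D1) {J : ℝ → ℝ} (cJ : Continuous J)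
    (hJ : ∀ t, T0 ≤ t → S.II ε δ t ≤ J t) (hJi : ∫ t in T0..T1, J t ≤ θ ^ 2) (c : E2) (hc : ∀ i, |c i| ≤ R)
    (hW0 : ∀ i, ∫ x, be ε u T0 x * (f x * (x i - c i)) = 0) (hμ : 0 < μ0) (hM : μ0 ≤ S.MM ε t1) :
    ∫ t in T0..t1, S.mm ε δ t * (∫ x, bb ε u t x * ph u c x ^ 2) ≤
      θ * (2 * R ^ 2 + 16 * R * ((F1 + D1) * F1 * ((R * (1 + 4 * F1 * (F1 + D1)) + 4 * R * F1 * D1) / μ0 ^ 2) + R * (1 + 4 * F1 * (F1 + D1)))) := by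
  have hfc := S.hf.continuous
  have c1 : Continuous (fun _ : E2 => (1:ℝ)) := continuous_const
  have hfδ : Continuous (fun x => f x + δ) := hfc.add continuous_const
  have hξ : ∀ i : Fin 2, Continuous (fun x : E2 => x i - c i) := fun i => (coord_cont i).sub continuous_const
  have F0 : 0 ≤ F1 := le_trans (integral_nonneg fun x => mul_nonneg (S.be_nonneg _ _) (S.f0 x)) hF1
  have D0 : 0 ≤ D1 := le_trans (integral_nonneg fun x => mul_nonneg (S.be_nonneg _ _) zero_le_one) hD1
  have hRt : ∀ t, T0 ≤ t → ∀ x, t ≤ u x → ‖x‖ < R := fun t ht x hx => hR x (ht.trans hx)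
  set L := F1 + D1 with hL
  have L0 : 0 ≤ L := by positivity
  have hθ2 : θ ^ 2 ≤ θ := by nlinarith
  have hδ1 : δ ≤ 1 := by linarith
  -- time functions
  set mm := S.mm ε δ with hmm
  set MM := S.MM ε with hMM
  set b1 : ℝ → ℝ := fun t => ∫ x, bb ε u t x * 1 with hb1
  have cmm : Continuous mm := S.bb_tcont hε hfδ
  have cMM : Continuous MM := S.bb_tcont hε S.g2_cont
  have cb1 : Continuous b1 := S.bb_tcont hε c1
  have mm0 : ∀ t, 0 ≤ mm t := fun t => integral_nonneg fun x => mul_nonneg (S.bb_nonneg hε _ _) (by linarith [S.f0 x])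
  have MM0 : ∀ t, 0 ≤ MM t := fun t => integral_nonneg fun x => mul_nonneg (S.bb_nonneg hε _ _) (by unfold g2; positivity)
  have b10 : ∀ t, 0 ≤ b1 t := fun t => integral_nonneg fun x => mul_nonneg (S.bb_nonneg hε _ _) zero_le_one
  have MMle : ∀ t, T0 ≤ t → MM t ≤ F1 := fun t ht => by
    have := S.MM_anti hε ht
    have h2 := S.MM_be hε T0
    linarith
  have J0 : ∀ t, T0 ≤ t → 0 ≤ J t := fun t ht => (S.II_nonneg hε δ t).trans (hJ t ht)
  have h0T1 := h01.trans h11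
  -- time integrals
  have hInteg : ∀ {ψ : E2 → ℝ}, Continuous ψ → ∫ t in T0..T1, (∫ x, bb ε u t x * ψ x) = ∫ x, be ε u T0 x * ψ x := by
    intro ψ hψ
    have := intervalIntegral.integral_eq_sub_of_hasDerivAt (a := T0) (b := T1) (fun t _ => S.be_deriv hε hψ t) ((S.bb_tcont hε hψ).neg.intervalIntegrable _ _)
    rw [intervalIntegral.integral_neg, S.be_top hε hT1] at this
    linarith
  have hb1i : ∫ t in T0..T1, b1 t ≤ D1 := by rw [hb1, hInteg c1]; exact hD1
  have hmmi : ∫ t in T0..T1, mm t ≤ L := by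
    have e : ∫ t in T0..T1, mm t = ∫ x, be ε u T0 x * (f x + δ) := hInteg hfδ
    have e2 : ∫ x, be ε u T0 x * (f x + δ) = (∫ x, be ε u T0 x * f x) + δ * ∫ x, be ε u T0 x * 1 := by
      rw [← integral_const_mul, ← integral_add (S.be_int hε T0 hfc) ((S.be_int hε T0 c1).const_mul _)]
      congr 1; ext x; ring
    rw [e, e2]
    have : δ * ∫ x, be ε u T0 x * 1 ≤ 1 * D1 := by
      gcongr
      exact integral_nonneg fun x => mul_nonneg (S.be_nonneg _ _) zero_le_one
    linarith
  -- error function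
  set e : ℝ → ℝ := fun t => 2 * R * (J t / (2 * θ) + 2 * θ * F1 * mm t) with he
  have ce : Continuous e := by rw [he]; fun_prop
  have e0 : ∀ t, T0 ≤ t → 0 ≤ e t := fun t ht => by
    have := J0 t ht
    have := mm0 t
    simp only [he]; positivity
  set K1 := R * (1 + 4 * F1 * L) with hK1
  have K10 : 0 ≤ K1 := by positivity
  have hei : ∫ t in T0..T1, e t ≤ θ * K1 := by
    simp only [he]
    rw [intervalIntegral.integral_const_mul, intervalIntegral.integral_add ((cJ.div_const _).intervalIntegrable _ _) ((cmm.const_mul _).intervalIntegrable _ _),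
      intervalIntegral.integral_div, intervalIntegral.integral_const_mul]
    calc _ ≤ 2 * R * (θ ^ 2 / (2 * θ) + 2 * θ * F1 * L) := by gcongr
      _ = _ := by rw [hK1]; field_simp; ring
  have hE1 : ∀ t, T0 ≤ t → ∀ i, |mm t * (∫ x, be ε u t x * (f x * (x i - c i))) - MM t * ∫ x, bb ε u t x * ((f x + δ) * (x i - c i))| ≤ e t := by
    intro t ht i
    have := S.E1 hε hδ hθ t (hRt t ht) c hc i
    rw [S.W_eq hε] at this
    refine this.trans ?_
    simp only [he]
    have h3 := hJ t ht
    have h4 : mm t * MM t ≤ F1 * mm t := by rw [mul_comm]; gcongr; exacts [mm0 t, MMle t ht]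
    rw [mul_assoc (2 * θ) F1]
    gcongr
  -- bound on Q
  set g : ℝ → ℝ := fun t => (e t + 4 * R * F1 * δ * b1 t) / μ0 ^ 2 with hg
  have cg : Continuous g := by rw [hg]; fun_prop
  have g0 : ∀ t, T0 ≤ t → 0 ≤ g t := fun t ht => by
    have := e0 t ht
    have := b10 t
    simp only [hg]; positivity
  set K2 := (K1 + 4 * R * F1 * D1) / μ0 ^ 2 with hK2
  have K20 : 0 ≤ K2 := by positivity
  have hgi : ∫ t in T0..T1, g t ≤ θ * K2 := by
    simp only [hg]
    rw [intervalIntegral.integral_div, intervalIntegral.integral_add (ce.intervalIntegrable _ _) ((cb1.const_mul _).intervalIntegrable _ _),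
      show ∫ t in T0..T1, 4 * R * F1 * δ * b1 t = 4 * R * F1 * δ * ∫ t in T0..T1, b1 t from intervalIntegral.integral_const_mul _ _]
    have p1 : δ * ∫ t in T0..T1, b1 t ≤ θ * D1 := mul_le_mul (by linarith) hb1i (intervalIntegral.integral_nonneg h0T1 fun t _ => b10 t) hθ.le
    have p2 : 4 * R * F1 * δ * ∫ t in T0..T1, b1 t ≤ 4 * R * F1 * θ * D1 := by
      have := mul_le_mul_of_nonneg_left p1 (show 0 ≤ 4 * R * F1 by positivity)
      linarith
    calc _ ≤ (θ * K1 + 4 * R * F1 * θ * D1) / μ0 ^ 2 := div_le_div_of_nonneg_right (add_le_add hei p2) (by positivity)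
      _ = _ := by rw [hK2]; ring
  have sub_int : ∀ {φ : ℝ → ℝ}, Continuous φ → (∀ t, T0 ≤ t → 0 ≤ φ t) → ∀ t, T0 ≤ t → t ≤ T1 → ∫ s in T0..t, φ s ≤ ∫ s in T0..T1, φ s := by
    intro φ hφ hφ0 t ht ht1
    rw [← intervalIntegral.integral_add_adjacent_intervals (hφ.intervalIntegrable T0 t) (hφ.intervalIntegrable t T1)]
    have := intervalIntegral.integral_nonneg (μ := volume) ht1 fun s hs => hφ0 s (ht.trans hs.1)
    linarith
  have MMlow : ∀ t, t ≤ t1 → μ0 ≤ MM t := fun t ht => hM.trans (S.MM_anti hε ht)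
  have hQ : ∀ i, ∀ t ∈ Icc T0 t1, |(∫ x, be ε u t x * (f x * (x i - c i))) / MM t| ≤ θ * K2 := by
    intro i t ht
    have cfξ : Continuous (fun x => f x * (x i - c i)) := hfc.mul (hξ i)
    set W : ℝ → ℝ := fun t => ∫ x, be ε u t x * (f x * (x i - c i)) with hW
    have dW : ∀ t, HasDerivAt W (-∫ x, bb ε u t x * (f x * (x i - c i))) t := fun t => S.be_deriv hε cfξ t
    have dM : ∀ t, HasDerivAt MM (-∫ x, bb ε u t x * f x) t := fun t => by
      have : MM = fun t => ∫ x, be ε u t x * f x := by ext t; exact S.MM_be hε t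
      rw [this]; exact S.be_deriv hε hfc t
    have dQ : ∀ t, t ≤ t1 → HasDerivAt (fun t => W t / MM t) _ t := fun t ht => (dW t).div (dM t) (by linarith [MMlow t ht])
    have := image_norm_le_of_norm_deriv_right_le_deriv_boundary (a := T0) (b := t1) (f := fun t => W t / MM t)
      (f' := fun t => ((-∫ x, bb ε u t x * (f x * (x i - c i))) * MM t - W t * (-∫ x, bb ε u t x * f x)) / MM t ^ 2)
      (B := fun t => ∫ s in T0..t, g s) (B' := g)
      (fun t ht => (dQ t ht.2).continuousAt.continuousWithinAt) (fun t ht => (dQ t ht.2.le).hasDerivWithinAt)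
      (by simp [hW, hW0]) (fun t => (cg.integral_hasStrictDerivAt T0 t).hasDerivAt) ?_ ht
    · exact this.trans ((sub_int cg g0 t ht.1 (ht.2.trans h11)).trans hgi)
    · intro s hs
      rw [Real.norm_eq_abs, abs_div, abs_of_nonneg (sq_nonneg (MM s))]
      have hMs := MMlow s hs.2.le
      have hden : μ0 ^ 2 ≤ MM s ^ 2 := by gcongr
      have hEs := hE1 s hs.1 i
      have w1 : ∫ x, bb ε u s x * ((f x + δ) * (x i - c i)) = (∫ x, bb ε u s x * (f x * (x i - c i))) + δ * ∫ x, bb ε u s x * (1 * (x i - c i)) := by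
        have c1ξ : Continuous (fun x : E2 => 1 * (x i - c i)) := c1.mul (hξ i)
        rw [← integral_const_mul, ← integral_add (S.bb_int hε s cfξ) ((S.bb_int hε s c1ξ).const_mul _)]
        congr 1; ext x; ring
      have w2 : mm s = (∫ x, bb ε u s x * f x) + δ * b1 s := by
        rw [hb1, ← integral_const_mul, ← integral_add (S.bb_int hε s hfc) ((S.bb_int hε s c1).const_mul _), hmm]
        unfold Setup.mm
        congr 1; ext x; ring
      have w3 := S.xi_bound (b := bb ε u s) (c := c) (i := i) (p := fun _ => 1) (S.bb_nonneg hε s) (fun x hx => S.bb_zero hε hx) (hRt s hs.1) (hc i) (fun _ => zero_le_one) (S.bb_int hε s c1)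
      have w4 := S.xi_bound (b := be ε u s) (c := c) (i := i) (p := f) (S.be_nonneg s) (fun x hx => S.be_zero hε hx) (hRt s hs.1) (hc i) S.f0 (S.be_int hε s hfc)
      have w5 : ∫ x, be ε u s x * f x = MM s := (S.MM_be hε s).symm
      have w6 : ∫ x, bb ε u s x * 1 = b1 s := rfl
      simp only [w5, w6] at w3 w4
      have hMF := MMle s hs.1
      have hb := b10 s
      have hM0 := MM0 s
      set X := ∫ x, bb ε u s x * (f x * (x i - c i))
      set Y := ∫ x, bb ε u s x * (1 * (x i - c i))
      set Ws := ∫ x, be ε u s x * (f x * (x i - c i)) with hWs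
      have hWW : W s = Ws := rfl
      rw [w1, w2] at hEs
      rw [hWW]
      have hnum : |(-X) * MM s - Ws * (-∫ x, bb ε u s x * f x)| ≤ e s + 4 * R * F1 * δ * b1 s := by
        set fs := ∫ x, bb ε u s x * f x
        have y1 : (-X) * MM s - Ws * (-fs) = ((fs + δ * b1 s) * Ws - MM s * (X + δ * Y)) + (δ * (MM s * Y) - δ * (Ws * b1 s)) := by ring
        rw [y1]
        refine (abs_add_le _ _).trans ?_
        have y2 : |δ * (MM s * Y) - δ * (Ws * b1 s)| ≤ δ * (MM s * (2 * R * b1 s)) + δ * ((2 * R * MM s) * b1 s) := by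
          refine (abs_sub _ _).trans ?_
          rw [abs_mul, abs_mul, abs_mul, abs_mul, abs_of_pos hδ, abs_of_nonneg hM0, abs_of_nonneg hb]
          gcongr
        have y3 : δ * (MM s * (2 * R * b1 s)) + δ * ((2 * R * MM s) * b1 s) = 4 * R * δ * b1 s * MM s := by ring
        have y4 : 4 * R * δ * b1 s * MM s ≤ 4 * R * δ * b1 s * F1 := by gcongr
        linarith
      have hnn : 0 ≤ e s + 4 * R * F1 * δ * b1 s := (abs_nonneg _).trans hnum
      simp only [hg]
      gcongr
  -- final
  have cph := S.ph_cont c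
  have cph2 : Continuous (fun x => ph u c x ^ 2) := cph.pow 2
  have clhs : Continuous (fun t => mm t * ∫ x, bb ε u t x * ph u c x ^ 2) := cmm.mul (S.bb_tcont hε cph2)
  set r : ℝ → ℝ := fun t => 2 * R ^ 2 * J t + 16 * R * (F1 * (θ * K2) * mm t + e t) with hr
  have cr : Continuous r := by rw [hr]; fun_prop
  have r0 : ∀ t, T0 ≤ t → 0 ≤ r t := fun t ht => by
    have := J0 t ht
    have := mm0 t
    have := e0 t ht
    simp only [hr]; positivity
  have hpt : ∀ t ∈ Icc T0 t1, mm t * (∫ x, bb ε u t x * ph u c x ^ 2) ≤ r t := by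
    intro t ht
    have h1 := S.E2a hε hδ t (hRt t ht.1) c hc
    have h2 := hJ t ht.1
    have hMw : ∀ i, MM t * |∫ x, bb ε u t x * ((f x + δ) * (x i - c i))| ≤ F1 * (θ * K2) * mm t + e t := by
      intro i
      have a1 := hE1 t ht.1 i
      have a2 := hQ i t ht
      have hMt := MMlow t ht.2
      have hMp : 0 < MM t := by linarith
      rw [abs_div, abs_of_pos hMp, div_le_iff₀ hMp] at a2
      set w := ∫ x, bb ε u t x * ((f x + δ) * (x i - c i))
      set Wt := ∫ x, be ε u t x * (f x * (x i - c i))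
      have a3 : MM t * |w| = |MM t * w| := by rw [abs_mul, abs_of_pos hMp]
      have a4 : |MM t * w| ≤ |mm t * Wt| + |mm t * Wt - MM t * w| := by
        have := abs_sub_abs_le_abs_sub (MM t * w) (mm t * Wt)
        rw [abs_sub_comm (mm t * Wt)]
        linarith
      have a5 : |mm t * Wt| ≤ mm t * (θ * K2 * F1) := by
        rw [abs_mul, abs_of_nonneg (mm0 t)]
        have := mm0 t
        have := MMle t ht.1
        gcongr
        refine a2.trans ?_
        gcongr
      linarith
    have m0 := mul_le_mul_of_nonneg_left (hMw 0) hR0.le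
    have m1 := mul_le_mul_of_nonneg_left (hMw 1) hR0.le
    have m2 := mul_le_mul_of_nonneg_left h2 (sq_nonneg R)
    simp only [hr]
    linarith
  calc _ ≤ ∫ t in T0..t1, r t := intervalIntegral.integral_mono_on h01 (clhs.intervalIntegrable _ _) (cr.intervalIntegrable _ _) hpt
    _ ≤ ∫ t in T0..T1, r t := sub_int cr r0 t1 h01 h11
    _ = 2 * R ^ 2 * (∫ t in T0..T1, J t) + 16 * R * (F1 * (θ * K2) * (∫ t in T0..T1, mm t) + ∫ t in T0..T1, e t) := by
        simp only [hr]
        have q1 : Continuous (fun t => F1 * (θ * K2) * mm t + e t) := by fun_prop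
        rw [intervalIntegral.integral_add ((cJ.const_mul _).intervalIntegrable _ _) ((q1.const_mul _).intervalIntegrable _ _),
          intervalIntegral.integral_const_mul, intervalIntegral.integral_const_mul,
          intervalIntegral.integral_add ((cmm.const_mul _).intervalIntegrable _ _) (ce.intervalIntegrable _ _), intervalIntegral.integral_const_mul]
    _ ≤ 2 * R ^ 2 * θ + 16 * R * (F1 * (θ * K2) * L + θ * K1) := by
        gcongr; linarith
    _ = _ := by ring

end Setup

lemma bt_eps {ε ε0 s : ℝ} (hε : 0 < ε) (h : ε ≤ ε0) : bt ε0 s ≤ bt ε s := by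
  rcases le_or_gt s 0 with hs | hs
  · rw [bt_zero (hε.trans_le h) hs]; exact bt_nonneg _ _
  · exact Real.smoothTransition.monotone (div_le_div_of_nonneg_left hs.le hε h)

lemma ph_diff (u : E2 → ℝ) (c c' x : E2) {ρ : ℝ} (h : ∀ i, |c' i - c i| ≤ ρ) :
    |ph u c' x - ph u c x| ≤ ρ * (|pd 0 u x| + |pd 1 u x|) := by
  have e : ph u c' x - ph u c x = (c' 1 - c 1) * pd 0 u x - (c' 0 - c 0) * pd 1 u x := by unfold ph; ring
  rw [e]
  refine (abs_sub _ _).trans ?_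
  rw [abs_mul, abs_mul]
  have a1 := mul_le_mul_of_nonneg_right (h 1) (abs_nonneg (pd 0 u x))
  have a2 := mul_le_mul_of_nonneg_right (h 0) (abs_nonneg (pd 1 u x))
  linarith

namespace Setup

lemma center {u f : E2 → ℝ} (S : Setup u f) {T0 R ε : ℝ} (hε : 0 < ε) (hR0 : 0 < R) (hR : ∀ x, T0 ≤ u x → ‖x‖ < R) :
    ∃ c : E2, (∀ i, |c i| ≤ R) ∧ ∀ i, ∫ x, be ε u T0 x * (f x * (x i - c i)) = 0 := by
  have hfc := S.hf.continuous
  set M := ∫ x, be ε u T0 x * f x with hM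
  have M0 : 0 ≤ M := integral_nonneg fun x => mul_nonneg (S.be_nonneg _ _) (S.f0 x)
  have cf : ∀ i : Fin 2, Continuous (fun x : E2 => f x * x i) := fun i => hfc.mul (coord_cont i)
  have hV : ∀ i : Fin 2, |∫ x, be ε u T0 x * (f x * x i)| ≤ R * M := by
    intro i
    rw [← Real.norm_eq_abs, hM, ← integral_const_mul]
    refine norm_integral_le_of_norm_le ((S.be_int hε T0 hfc).const_mul _) (ae_of_all _ fun x => ?_)
    by_cases h : u x < T0
    · simp [S.be_zero hε h]
    · push Not at h
      have h1 := hR x h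
      have hx : |x i| ≤ R := by linarith [abs_coord_le x i]
      rw [Real.norm_eq_abs, abs_mul, abs_mul, abs_of_nonneg (S.be_nonneg T0 x), abs_of_nonneg (S.f0 x)]
      have := mul_le_mul_of_nonneg_left hx (mul_nonneg (S.be_nonneg (ε := ε) T0 x) (S.f0 x))
      linarith
  refine ⟨WithLp.toLp 2 (fun i => (∫ x, be ε u T0 x * (f x * x i)) / M), fun i => ?_, fun i => ?_⟩
  · rcases M0.eq_or_lt with h | h
    · simp [← h, hR0.le]
    · rw [abs_div, abs_of_pos h, div_le_iff₀ h]; exact hV i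
  · have e : ∀ k : ℝ, ∫ x, be ε u T0 x * (f x * (x i - k)) = (∫ x, be ε u T0 x * (f x * x i)) - k * M := by
      intro k
      rw [hM, ← integral_const_mul, ← integral_sub (S.be_int hε T0 (cf i)) ((S.be_int hε T0 hfc).const_mul _)]
      congr 1; ext x; ring
    rw [e]
    rcases M0.eq_or_lt with h | h
    · have := hV i
      rw [← h, mul_zero] at this
      have h3 := abs_nonpos_iff.mp this
      rw [← h, h3]; simp
    · simp [h.ne']

set_option maxHeartbeats 1000000 in
lemma lower {u f : E2 → ℝ} (S : Setup u f) {T0 : ℝ} {c x0 : E2} (hx0 : T0 < u x0) (hne : f x0 * ph u c x0 ≠ 0) :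
    ∃ t1 μ0 κ ε1 ρ : ℝ, 0 < μ0 ∧ 0 < κ ∧ 0 < ε1 ∧ 0 < ρ ∧ T0 ≤ t1 ∧ (∃ x, t1 ≤ u x) ∧ ∀ ε δ (c' : E2), 0 < ε → ε ≤ ε1 → 0 < δ →
      (∀ i, |c' i - c i| ≤ ρ) → μ0 ≤ S.MM ε t1 ∧ κ ≤ ∫ t in T0..t1, S.mm ε δ t * (∫ x, bb ε u t x * ph u c' x ^ 2) := by
  have hfc := S.hf.continuous
  have huc := S.hu.continuous
  have fx0 : 0 < f x0 := lt_of_le_of_ne (S.f0 x0) (Ne.symm (left_ne_zero_of_mul hne))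
  have px0 : ph u c x0 ≠ 0 := right_ne_zero_of_mul hne
  have hnm : ¬ IsLocalMax u x0 := by
    intro h
    have := h.fderiv_eq_zero
    apply px0
    simp [ph, pd, this]
  have hfr : ∃ᶠ x in nhds x0, u x0 < u x := by
    intro h
    apply hnm
    filter_upwards [h] with x hx
    exact not_lt.mp hx
  obtain ⟨x1, hx1, fx1⟩ := (hfr.and_eventually (hfc.continuousAt.eventually (lt_mem_nhds fx0))).exists
  set t1 := (u x0 + u x1) / 2 with ht1
  set ε0 := (u x1 - t1) / 2 with hε0
  have ε0p : 0 < ε0 := by simp only [hε0, ht1]; linarith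
  set σ := (u x0 - T0) / 2 with hσ
  have σp : 0 < σ := by simp only [hσ]; linarith
  set μ0 := ∫ x, be ε0 u t1 x * f x with hμ0
  have μp : 0 < μ0 := by
    refine Continuous.integral_pos_of_hasCompactSupport_nonneg_nonzero (x := x1) ((S.be_contDiff ε0 t1).continuous.mul hfc)
      ((S.be_hcs ε0p t1).mul_right) (fun x => mul_nonneg (S.be_nonneg _ _) (S.f0 x)) ?_
    have : be ε0 u t1 x1 = 1 := bt_one ε0p (by simp only [hε0]; simp only [hε0, ht1] at ε0p; linarith)
    rw [this]; simpa using fx1.ne'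
  set ψ0 := |ph u c x0| with hψ0
  have ψp : 0 < ψ0 := abs_pos.mpr px0
  set P := |pd 0 u x0| + |pd 1 u x0| + 1 with hP
  have Pp : 0 < P := by positivity
  set a := f x0 / 2 with ha
  have ap : 0 < a := by positivity
  have ev1 : ∀ᶠ x in nhds x0, a < f x := hfc.continuousAt.eventually (lt_mem_nhds (by simp only [ha]; linarith))
  have ev2 : ∀ᶠ x in nhds x0, ψ0 / 2 < |ph u c x| := (S.ph_cont c).abs.continuousAt.eventually (lt_mem_nhds (by show _ < ψ0; linarith))
  have ev3 : ∀ᶠ x in nhds x0, T0 + σ < u x := huc.continuousAt.eventually (lt_mem_nhds (by simp only [hσ]; linarith))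
  have ev4 : ∀ᶠ x in nhds x0, u x < t1 := huc.continuousAt.eventually (gt_mem_nhds (by simp only [ht1]; linarith))
  have ev5 : ∀ᶠ x in nhds x0, |pd 0 u x| + |pd 1 u x| < P := ((S.pdu_cont 0).abs.add (S.pdu_cont 1).abs).continuousAt.eventually
    (gt_mem_nhds (by show _ < P; simp only [hP]; exact lt_add_one _))
  obtain ⟨r0, r0p, hr0⟩ := Metric.eventually_nhds_iff.mp (ev1.and (ev2.and (ev3.and (ev4.and ev5))))
  set r := min r0 1 with hr
  have rp : 0 < r := lt_min r0p one_pos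
  set ζ : E2 → ℝ := fun x => max 0 (r - ‖x - x0‖) with hζ
  have cζ : Continuous ζ := by rw [hζ]; fun_prop
  have ζ0 : ∀ x, 0 ≤ ζ x := fun x => le_max_left _ _
  have ζ1 : ∀ x, ζ x ≤ 1 := fun x => max_le zero_le_one (by linarith [norm_nonneg (x - x0), min_le_right r0 1])
  have ζz : ∀ x, ζ x = 0 ∨ (a < f x ∧ ψ0 / 2 < |ph u c x| ∧ T0 + σ < u x ∧ u x < t1 ∧ |pd 0 u x| + |pd 1 u x| < P) := by
    intro x
    by_cases h : dist x x0 < r0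
    · exact Or.inr (hr0 h)
    · left
      push Not at h
      rw [dist_eq_norm] at h
      exact max_eq_left (by linarith [min_le_left r0 1])
  have hcζ : HasCompactSupport ζ := S.hcs (t := T0) fun x hx => by
    rcases ζz x with h | h
    · exact h
    · linarith [h.2.2.1]
  set Z := ∫ x, ζ x with hZ
  have Zp : 0 < Z := Continuous.integral_pos_of_hasCompactSupport_nonneg_nonzero (x := x0) cζ hcζ ζ0 (by simp [hζ, rp.le, rp.ne', max_eq_right])
  have tp : 0 < t1 - T0 := by simp only [ht1]; linarith
  refine ⟨t1, μ0, a * (ψ0 / 4) ^ 2 * (Z ^ 2 / (t1 - T0)), min ε0 σ, ψ0 / (4 * P), μp, by positivity, lt_min ε0p σp, by positivity, by linarith,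
    ⟨x1, by simp only [ht1]; linarith⟩, ?_⟩
  intro ε δ c' hε hε1 hδ hc'
  have hεε := hε1.trans (min_le_left _ _)
  have hεσ := hε1.trans (min_le_right _ _)
  constructor
  · rw [S.MM_be hε]
    refine integral_mono (S.be_int ε0p t1 hfc) (S.be_int hε t1 hfc) fun x => ?_
    exact mul_le_mul_of_nonneg_right (bt_eps hε hεε) (S.f0 x)
  set X : ℝ → ℝ := fun t => ∫ x, bb ε u t x * ζ x with hX
  have cX : Continuous X := S.bb_tcont hε cζ
  have X0 : ∀ t, 0 ≤ X t := fun t => integral_nonneg fun x => mul_nonneg (S.bb_nonneg hε _ _) (ζ0 x)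
  have cfδ : Continuous (fun x => f x + δ) := hfc.add continuous_const
  have cph2 : Continuous (fun x => ph u c' x ^ 2) := (S.ph_cont c').pow 2
  have m1 : ∀ t, a * X t ≤ S.mm ε δ t := by
    intro t
    unfold mm
    rw [hX, ← integral_const_mul]
    refine integral_mono ((S.bb_int hε t cζ).const_mul _) (S.bb_int hε t cfδ) fun x => ?_
    have hb := S.bb_nonneg hε t x
    show a * (bb ε u t x * ζ x) ≤ bb ε u t x * (f x + δ)
    have : a * ζ x ≤ f x + δ := by
      rcases ζz x with h | h
      · rw [h]; linarith [S.f0 x]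
      · have := mul_le_mul_of_nonneg_left (ζ1 x) ap.le
        linarith [h.1]
    have := mul_le_mul_of_nonneg_left this hb
    linarith
  have m2 : ∀ t, (ψ0 / 4) ^ 2 * X t ≤ ∫ x, bb ε u t x * ph u c' x ^ 2 := by
    intro t
    rw [hX, ← integral_const_mul]
    refine integral_mono ((S.bb_int hε t cζ).const_mul _) (S.bb_int hε t cph2) fun x => ?_
    have hb := S.bb_nonneg hε t x
    show (ψ0 / 4) ^ 2 * (bb ε u t x * ζ x) ≤ bb ε u t x * ph u c' x ^ 2
    have : (ψ0 / 4) ^ 2 * ζ x ≤ ph u c' x ^ 2 := by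
      rcases ζz x with h | h
      · rw [h]; nlinarith [sq_nonneg (ph u c' x)]
      · have h1 := ph_diff u c c' x hc'
        have h2 : ψ0 / (4 * P) * (|pd 0 u x| + |pd 1 u x|) ≤ ψ0 / (4 * P) * P := by
          have := h.2.2.2.2.le
          gcongr
        have h3 : ψ0 / (4 * P) * P = ψ0 / 4 := by field_simp
        have h4 := abs_sub_abs_le_abs_sub (ph u c x) (ph u c' x)
        rw [abs_sub_comm] at h4
        have h5 : ψ0 / 4 ≤ |ph u c' x| := by linarith [h.2.1]
        rw [← sq_abs (ph u c' x)]
        have h6 : (ψ0 / 4) ^ 2 ≤ |ph u c' x| ^ 2 := by gcongr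
        have := mul_le_mul_of_nonneg_left (ζ1 x) (sq_nonneg (ψ0 / 4))
        linarith
    have := mul_le_mul_of_nonneg_left this hb
    linarith
  have iX : ∫ t in T0..t1, X t = Z := by
    have := intervalIntegral.integral_eq_sub_of_hasDerivAt (a := T0) (b := t1) (fun t _ => S.be_deriv hε cζ t) (cX.neg.intervalIntegrable _ _)
    rw [intervalIntegral.integral_neg] at this
    have e1 : ∫ x, be ε u t1 x * ζ x = 0 := by
      rw [← integral_zero E2 ℝ]
      congr 1; ext x
      rcases ζz x with h | h
      · rw [h, mul_zero]
      · rw [S.be_zero hε h.2.2.2.1, zero_mul]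
    have e2 : ∫ x, be ε u T0 x * ζ x = Z := by
      congr 1; ext x
      rcases ζz x with h | h
      · rw [h, mul_zero]
      · have : be ε u T0 x = 1 := bt_one hε (by linarith [h.2.2.1])
        rw [this, one_mul]
    rw [e1, e2] at this
    linarith
  set α := Z / (t1 - T0) with hα
  have k0 : 0 ≤ a * (ψ0 / 4) ^ 2 := by positivity
  have key : ∀ t ∈ Icc T0 t1, a * (ψ0 / 4) ^ 2 * (2 * α * X t - α ^ 2) ≤ S.mm ε δ t * (∫ x, bb ε u t x * ph u c' x ^ 2) := by
    intro t _
    have h1 : a * X t * ((ψ0 / 4) ^ 2 * X t) ≤ S.mm ε δ t * (∫ x, bb ε u t x * ph u c' x ^ 2) :=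
      mul_le_mul (m1 t) (m2 t) (mul_nonneg (sq_nonneg _) (X0 t)) ((mul_nonneg ap.le (X0 t)).trans (m1 t))
    have h2 : 2 * α * X t - α ^ 2 ≤ X t ^ 2 := by nlinarith [sq_nonneg (X t - α)]
    have := mul_le_mul_of_nonneg_left h2 k0
    linarith
  have cmm : Continuous (S.mm ε δ) := S.bb_tcont hε cfδ
  have cl : Continuous (fun t => a * (ψ0 / 4) ^ 2 * (2 * α * X t - α ^ 2)) := by fun_prop
  have := intervalIntegral.integral_mono_on (μ := volume) (show T0 ≤ t1 by linarith) (cl.intervalIntegrable _ _) ((cmm.mul (S.bb_tcont hε cph2)).intervalIntegrable _ _) key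
  refine le_trans (le_of_eq ?_) this
  have cX2 : Continuous (fun t => 2 * α * X t) := by fun_prop
  rw [intervalIntegral.integral_const_mul, intervalIntegral.integral_sub (cX2.intervalIntegrable _ _) (continuous_const.intervalIntegrable _ _),
    show ∫ t in T0..t1, 2 * α * X t = 2 * α * ∫ t in T0..t1, X t from intervalIntegral.integral_const_mul _ _, iX, intervalIntegral.integral_const]
  rw [hα, smul_eq_mul]
  field_simp
  ring

lemma endgame {u f : E2 → ℝ} (S : Setup u f) {T0 T1 : ℝ} (h01 : T0 ≤ T1) (hT1 : ∀ x, u x < T1)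
    (hDef : ∀ η > 0, ∃ T ≤ T0, ∀ ε, 0 < ε → ε ≤ 1 →
      (1/2) * (∫ x, be ε u T x * f x) ^ 2 + 2 * Real.pi * ∫ x, be ε u T x * (f x * xd u x) ≤ η) :
    ∃ c : E2, ∀ x, T0 < u x → f x * ph u c x = 0 := by
  have hfc := S.hf.continuous
  have c1 : Continuous (fun _ : E2 => (1:ℝ)) := continuous_const
  obtain ⟨R, hR0, hR⟩ := S.bdd T0
  have hθ : ∀ n : ℕ, 0 < 1 / ((n:ℝ) + 1) := fun n => by positivity
  have hex : ∀ n : ℕ, ∃ δ ε : ℝ, ∃ c : E2, 0 < δ ∧ δ ≤ (1 / ((n:ℝ) + 1)) ^ 2 ∧ 0 < ε ∧ ε ≤ (1 / ((n:ℝ) + 1)) ^ 2 ∧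
      (∃ J : ℝ → ℝ, Continuous J ∧ (∀ t, T0 ≤ t → S.II ε δ t ≤ J t) ∧ ∫ t in T0..T1, J t ≤ (1 / ((n:ℝ) + 1)) ^ 2) ∧
      (∀ i, |c i| ≤ R) ∧ ∀ i, ∫ x, be ε u T0 x * (f x * (x i - c i)) = 0 := by
    intro n
    obtain ⟨δ, ε, h1, h2, h3, h4, h5, J, h6⟩ := S.exJ h01 hT1 hDef ((1 / ((n:ℝ) + 1)) ^ 2) (by have := hθ n; positivity)
    obtain ⟨c, hc, hc0⟩ := S.center h3 hR0 hR
    exact ⟨δ, ε, c, h1, h2, h3, h4, ⟨J, h6⟩, hc, hc0⟩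
  choose δ ε c hδ hδ2 hε hε2 hJ hc hc0 using hex
  have hball : ∀ n, c n ∈ closedBall (0:E2) (2 * R) := by
    intro n
    rw [mem_closedBall_zero_iff]
    have h1 := normsq_e2 (c n)
    have h2 := sq_le_sq' (abs_le.mp (hc n 0)).1 (abs_le.mp (hc n 0)).2
    have h3 := sq_le_sq' (abs_le.mp (hc n 1)).1 (abs_le.mp (hc n 1)).2
    exact le_of_sq_le_sq (by nlinarith) (by positivity)
  obtain ⟨c₀, _, φ, hφ, hlim⟩ := (isCompact_closedBall (0:E2) (2 * R)).tendsto_subseq hball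
  refine ⟨c₀, fun x0 hx0 => ?_⟩
  by_contra hne
  obtain ⟨t1, μ0, κ, ε1, ρ, μp, κp, εp, ρp, h0t, ⟨xx, hxx⟩, H⟩ := S.lower hx0 hne
  have h11 : t1 ≤ T1 := hxx.trans (hT1 xx).le
  set F1 := ∫ x, be 1 u (T0 - 1) x * |f x| with hF1
  set D1 := ∫ x, be 1 u (T0 - 1) x * |(1:ℝ)| with hD1
  set K := 2 * R ^ 2 + 16 * R * ((F1 + D1) * F1 * ((R * (1 + 4 * F1 * (F1 + D1)) + 4 * R * F1 * D1) / μ0 ^ 2) + R * (1 + 4 * F1 * (F1 + D1))) with hK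
  have htend : Tendsto (fun n : ℕ => 1 / ((φ n : ℝ) + 1)) atTop (nhds 0) := tendsto_one_div_add_atTop_nhds_zero_nat.comp hφ.tendsto_atTop
  have e1 : ∀ᶠ n in atTop, 1 / ((φ n : ℝ) + 1) * K < κ := by
    have := htend.mul_const K
    rw [zero_mul] at this
    exact this.eventually (gt_mem_nhds κp)
  have e2 : ∀ᶠ n in atTop, 1 / ((φ n : ℝ) + 1) < ε1 := htend.eventually (gt_mem_nhds εp)
  have e3 : ∀ᶠ n in atTop, dist (c (φ n)) c₀ < ρ := hlim.eventually (ball_mem_nhds _ ρp)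
  obtain ⟨n, g1, g2, g3⟩ := (e1.and (e2.and e3)).exists
  have hθ1 : 1 / ((φ n : ℝ) + 1) ≤ 1 := by
    rw [div_le_one (by positivity)]; linarith [(Nat.cast_nonneg (φ n) : (0:ℝ) ≤ _)]
  have hθn := hθ (φ n)
  obtain ⟨J, cJ, hJ1, hJ2⟩ := hJ (φ n)
  obtain ⟨hM, hκ⟩ := H (ε (φ n)) (δ (φ n)) (c (φ n)) (hε _) ((hε2 _).trans (by nlinarith)) (hδ _) (fun i => by
    have := abs_coord_le (c (φ n) - c₀) i
    rw [dist_eq_norm] at g3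
    exact this.trans g3.le)
  have hb1 : ∫ x, be (ε (φ n)) u T0 x * f x ≤ F1 := (le_abs_self _).trans (S.be_int_le (hε _) (by linarith) hfc)
  have hb2 : ∫ x, be (ε (φ n)) u T0 x * 1 ≤ D1 := (le_abs_self _).trans (S.be_int_le (hε _) (by linarith) c1)
  have := S.step h0t h11 hT1 hR0 hR (hε _) (hδ _) hθn hθ1 (hδ2 _) hb1 hb2 cJ hJ1 hJ2 (c (φ n)) (hc _) (hc0 _) μp hM
  linarith

end Setup

lemma Setup.exists_top {u f : E2 → ℝ} (S : Setup u f) (T0 : ℝ) : ∃ T1, T0 ≤ T1 ∧ ∀ x, u x < T1 := by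
  obtain ⟨R, _, hR⟩ := S.bdd T0
  obtain ⟨C, hC⟩ := (isCompact_closedBall (0:E2) R).exists_bound_of_continuousOn (f := u) S.hu.continuous.continuousOn
  refine ⟨max T0 (C + 1), le_max_left _ _, fun x => ?_⟩
  by_cases h : T0 ≤ u x
  · have := hC x (by simpa using (hR x h).le)
    exact lt_of_lt_of_le (by linarith [(abs_le.mp this).2]) (le_max_right _ _)
  · push Not at h
    exact lt_of_lt_of_le h (le_max_left _ _)

lemma exists_c {ω : E2 → ℝ} (h : ContDiff ℝ 2 ω) (hc : HasCompactSupport ω) {l : ℝ} (hl : 0 ≤ l) (S : Setup (uu ω l) (fun x => ω x + l)) (T0 : ℝ) :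
    ∃ c : E2, ∀ x, T0 < uu ω l x → (ω x + l) * ph (uu ω l) c x = 0 := by
  obtain ⟨T1, h01, hT1⟩ := S.exists_top T0
  exact S.endgame h01 hT1 (def_small h hc hl S T0)

lemma ph_zero_zero {ω : E2 → ℝ} (h : ContDiff ℝ 2 ω) (hc : HasCompactSupport ω) (S : Setup (uu ω 0) (fun x => ω x + 0)) :
    ∃ c : E2, ∀ x, (ω x + 0) * ph (uu ω 0) c x = 0 := by
  obtain ⟨R0, hR0, hR⟩ := supp_bound hc
  obtain ⟨T, hT⟩ := uu_low h hc 0 R0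
  obtain ⟨c, hcc⟩ := exists_c h hc le_rfl S (T - 1)
  refine ⟨c, fun x => ?_⟩
  by_cases hx : ω x = 0
  · simp [hx]
  · exact hcc x (by linarith [hT x (hR x hx)])

set_option maxHeartbeats 1000000 in
lemma ph_zero_pos {ω : E2 → ℝ} (h : ContDiff ℝ 2 ω) (hc : HasCompactSupport ω) {l : ℝ} (hl : 0 < l) (S : Setup (uu ω l) (fun x => ω x + l)) (x : E2) :
    (ω x + l) * ph (uu ω l) 0 x = 0 := by
  obtain ⟨R0, hR0, hR⟩ := supp_bound hc
  obtain ⟨C, R, hC, hRp, hN⟩ := newton_pd_bound h hc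
  have key : ∀ η > 0, ∃ c : E2, (∀ i, |c i| ≤ η) ∧ (ω x + l) * ph (uu ω l) c x = 0 := by
    intro η hη
    set s := R0 + R + 1 + 8 * C / l + 8 * C / (l * η) with hs
    have p1 : 0 < 8 * C / l := by positivity
    have p2 : 0 < 8 * C / (l * η) := by positivity
    have s1 : 1 ≤ s := by linarith
    have sR0 : R0 < s := by linarith
    have sR : R ≤ s := by linarith
    have sa : 8 * C ≤ s * l := by
      have : 8 * C / l ≤ s := by linarith
      exact (div_le_iff₀ hl).mp this
    have sb : 8 * C ≤ s * (l * η) := by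
      have : 8 * C / (l * η) ≤ s := by linarith
      exact (div_le_iff₀ (by positivity)).mp this
    obtain ⟨T, hT⟩ := uu_low h hc l s
    obtain ⟨c, hcc⟩ := exists_c h hc hl.le S (min T (uu ω l x) - 1)
    have hx : (ω x + l) * ph (uu ω l) c x = 0 := hcc x (by linarith [min_le_right T (uu ω l x)])
    refine ⟨c, ?_, hx⟩
    have hpt : ∀ y : E2, ‖y‖ = s → ph (uu ω l) c y = 0 ∧ ∀ i, |pd i (newtonConv ω) y| ≤ C / s := by
      intro y hy
      have h0 : ω y = 0 := by
        by_contra hn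
        linarith [hR y hn]
      have h1 := hcc y (by linarith [min_le_left T (uu ω l x), hT y hy.le])
      rw [h0, zero_add] at h1
      refine ⟨(mul_eq_zero.mp h1).resolve_left hl.ne', fun i => ?_⟩
      have := hN y (by rw [hy]; exact sR) i
      rwa [hy] at this
    have ns : ∀ i : Fin 2, ‖(EuclideanSpace.single i s : E2)‖ = s := fun i => by
      rw [EuclideanSpace.norm_single, Real.norm_eq_abs, abs_of_nonneg (by linarith)]
    obtain ⟨a1, a2⟩ := hpt _ (ns 0)
    obtain ⟨b1, b2⟩ := hpt _ (ns 1)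
    unfold ph at a1 b1
    simp only [uu_pd h hc] at a1 b1
    simp at a1 b1
    set A0 := pd 0 (newtonConv ω) (EuclideanSpace.single 0 s)
    set A1 := pd 1 (newtonConv ω) (EuclideanSpace.single 0 s)
    set B0 := pd 0 (newtonConv ω) (EuclideanSpace.single 1 s)
    set B1 := pd 1 (newtonConv ω) (EuclideanSpace.single 1 s)
    set κ := C / s with hκ
    have κ0 : 0 ≤ κ := by positivity
    have κs : κ * s = C := by rw [hκ]; field_simp
    have A : l / 2 * s * |c 1| ≤ |c 1| * κ + (s + |c 0|) * κ := by
      have e : l / 2 * s * c 1 = c 1 * A0 + (s - c 0) * A1 := by linarith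
      have e2 : l / 2 * s * |c 1| = |l / 2 * s * c 1| := by rw [abs_mul, abs_of_nonneg (by positivity : 0 ≤ l / 2 * s)]
      rw [e2, e]
      refine (abs_add_le _ _).trans ?_
      rw [abs_mul, abs_mul]
      have t1 := a2 0
      have t2 := a2 1
      have t3 : |s - c 0| ≤ s + |c 0| := by
        have := abs_sub s (c 0)
        rwa [abs_of_nonneg (by linarith : 0 ≤ s)] at this
      gcongr
    have B : l / 2 * s * |c 0| ≤ |c 0| * κ + (s + |c 1|) * κ := by
      have e : l / 2 * s * c 0 = c 0 * B1 + (s - c 1) * B0 := by linarith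
      have e2 : l / 2 * s * |c 0| = |l / 2 * s * c 0| := by rw [abs_mul, abs_of_nonneg (by positivity : 0 ≤ l / 2 * s)]
      rw [e2, e]
      refine (abs_add_le _ _).trans ?_
      rw [abs_mul, abs_mul]
      have t1 := b2 0
      have t2 := b2 1
      have t3 : |s - c 1| ≤ s + |c 1| := by
        have := abs_sub s (c 1)
        rwa [abs_of_nonneg (by linarith : 0 ≤ s)] at this
      gcongr
    set q := |c 0| + |c 1| with hq
    have q0 : 0 ≤ q := by positivity
    have h1 : l / 2 * s * q ≤ 2 * C + 2 * q * κ := by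
      rw [hq]; linarith
    have h2 : κ ≤ l / 8 * s := by
      have : κ ≤ C := by rw [hκ]; exact div_le_self hC.le s1
      linarith
    have h3 : q * κ ≤ q * (l / 8 * s) := by gcongr
    have h4 : l * s * q ≤ 8 * C := by linarith
    have h5 : l * s * q ≤ l * s * η := by linarith
    have h6 : q ≤ η := le_of_mul_le_mul_left h5 (by positivity)
    intro i
    fin_cases i
    · show |c 0| ≤ η
      linarith [abs_nonneg (c 1)]
    · show |c 1| ≤ η
      linarith [abs_nonneg (c 0)]
  by_contra hne
  have hpos := abs_pos.mpr hne
  set u := uu ω l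
  set K := (ω x + l) * (|pd 0 u x| + |pd 1 u x|) with hK
  have hf0 : 0 ≤ ω x + l := S.f0 x
  have K0 : 0 ≤ K := by positivity
  set V := |(ω x + l) * ph u 0 x| with hV
  obtain ⟨c, hc1, hc2⟩ := key (V / (K + 1)) (by positivity)
  have hd := ph_diff u c 0 x (ρ := V / (K + 1)) (fun i => by simpa using hc1 i)
  have h1 : V ≤ V / (K + 1) * K := by
    have e : (ω x + l) * ph u 0 x = (ω x + l) * (ph u 0 x - ph u c x) := by rw [mul_sub, hc2, sub_zero]
    calc V = (ω x + l) * |ph u 0 x - ph u c x| := by rw [hV, e, abs_mul, abs_of_nonneg hf0]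
      _ ≤ (ω x + l) * (V / (K + 1) * (|pd 0 u x| + |pd 1 u x|)) := by gcongr
      _ = _ := by rw [hK]; ring
  have h2 : V / (K + 1) * K = V * (K / (K + 1)) := by ring
  have h3 : K / (K + 1) < 1 := by rw [div_lt_one (by positivity)]; linarith
  have h4 : V * (K / (K + 1)) < V * 1 := mul_lt_mul_of_pos_left h3 hpos
  linarith

/-- rotational derivative of `f` vanishes -/
lemma Setup.rot_f {u f : E2 → ℝ} (S : Setup u f) {c : E2} (hph : ∀ x, f x * ph u c x = 0) (x : E2) : ph f c x = 0 := by
  rcases (S.f0 x).eq_or_lt with h0 | h0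
  · have : IsLocalMin f x := by
      filter_upwards with y
      rw [← h0]; exact S.f0 y
    simp [ph, pd, this.fderiv_eq_zero]
  by_contra hne
  have hcp : Continuous (ph f c) := by
    have h0 := pd_cont (S.hf.of_le (by norm_num)) 0
    have h1 := pd_cont (S.hf.of_le (by norm_num)) 1
    unfold ph
    fun_prop
  have ev1 : ∀ᶠ y in nhds x, 0 < f y := S.hf.continuous.continuousAt.eventually (lt_mem_nhds h0)
  have ev2 : ∀ᶠ y in nhds x, ph f c y ≠ 0 := hcp.continuousAt.eventually_ne hne
  have ev : ∀ᶠ y in nhds x, pd 0 u y = 0 ∧ pd 1 u y = 0 := by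
    filter_upwards [ev1, ev2] with y hy1 hy2
    have h1 := (mul_eq_zero.mp (hph y)).resolve_left hy1.ne'
    have h2 := S.par y
    unfold ph at h1 hy2
    constructor
    · refine (mul_eq_zero.mp (?_ : pd 0 u y * _ = 0)).resolve_right hy2
      linear_combination pd 0 f y * h1 + (y 0 - c 0) * h2
    · refine (mul_eq_zero.mp (?_ : pd 1 u y * _ = 0)).resolve_right hy2
      linear_combination pd 1 f y * h1 + (y 1 - c 1) * h2
  have z : ∀ i : Fin 2, ∀ᶠ y in nhds x, pd i u y = 0 := fun i => by
    fin_cases i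
    · exact ev.mono fun y h => h.1
    · exact ev.mono fun y h => h.2
  have z2 : ∀ i : Fin 2, pd i (pd i u) x = 0 := fun i => by
    have : pd i u =ᶠ[nhds x] fun _ => (0:ℝ) := z i
    unfold pd at this ⊢
    rw [this.fderiv_eq]; simp
  have := S.lap x
  rw [z2, z2] at this
  linarith

lemma polar_exists (v : E2) : ∃ α : ℝ, v 0 = ‖v‖ * Real.cos α ∧ v 1 = ‖v‖ * Real.sin α := by
  set z : ℂ := ⟨v 0, v 1⟩ with hz
  have hn : ‖z‖ = ‖v‖ := by
    have h1 := normsq_e2 v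
    have h2 : ‖z‖ ^ 2 = v 0 ^ 2 + v 1 ^ 2 := by rw [← Complex.normSq_eq_norm_sq, Complex.normSq_apply]; ring
    exact (sq_eq_sq₀ (norm_nonneg _) (norm_nonneg _)).mp (by rw [h1, h2])
  exact ⟨z.arg, by rw [← hn, Complex.norm_mul_cos_arg], by rw [← hn, Complex.norm_mul_sin_arg]⟩

lemma radial_of_rot {f : E2 → ℝ} (hf : ContDiff ℝ 2 f) {c : E2} (hph : ∀ x, ph f c x = 0) (x y : E2) (hxy : ‖x - c‖ = ‖y - c‖) : f x = f y := by
  have hd := hf.differentiable (by norm_num : (2 : WithTop ℕ∞) ≠ 0)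
  set ρ := ‖x - c‖ with hρ
  set γ : ℝ → E2 := fun θ => c + ((ρ * Real.cos θ) • EuclideanSpace.single 0 (1:ℝ) + (ρ * Real.sin θ) • EuclideanSpace.single 1 (1:ℝ)) with hγ
  have hγd : ∀ θ, HasDerivAt γ ((ρ * (-Real.sin θ)) • EuclideanSpace.single 0 (1:ℝ) + (ρ * Real.cos θ) • EuclideanSpace.single 1 (1:ℝ)) θ := fun θ =>
    ((((Real.hasDerivAt_cos θ).const_mul ρ).smul_const _).add (((Real.hasDerivAt_sin θ).const_mul ρ).smul_const _)).const_add c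
  have h1 : ∀ θ, HasDerivAt (fun θ => f (γ θ)) 0 θ := by
    intro θ
    have := ((hd (γ θ)).hasFDerivAt).comp_hasDerivAt θ (hγd θ)
    rw [fderiv_e2] at this
    refine this.congr_deriv ?_
    have h2 := hph (γ θ)
    unfold ph at h2
    have g0 : γ θ 0 = c 0 + ρ * Real.cos θ := by simp [hγ]
    have g1 : γ θ 1 = c 1 + ρ * Real.sin θ := by simp [hγ]
    rw [g0, g1] at h2
    simp
    linarith
  have hconst : ∀ a b, f (γ a) = f (γ b) := is_const_of_deriv_eq_zero (fun θ => (h1 θ).differentiableAt) (fun θ => (h1 θ).deriv)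
  have hpt : ∀ z : E2, ‖z - c‖ = ρ → ∃ α, z = γ α := by
    intro z hz
    obtain ⟨α, a0, a1⟩ := polar_exists (z - c)
    rw [hz] at a0 a1
    refine ⟨α, ?_⟩
    ext i
    fin_cases i
    · simp [hγ] at a0 ⊢; linarith
    · simp [hγ] at a1 ⊢; linarith
  obtain ⟨a, ha⟩ := hpt x rfl
  obtain ⟨b, hb⟩ := hpt y hxy.symm
  rw [ha, hb]; exact hconst a b

lemma core {ω : E2 → ℝ} (h : ContDiff ℝ 2 ω) (hc : HasCompactSupport ω) {l : ℝ} (hpos : ∀ x, 0 ≤ ω x + l)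
    (hrot : ∀ c : ℝ, (∀ x, ω x = c → fderiv ℝ ω x ≠ 0) →
      ∀ x, ω x = c → ∀ y ∈ connectedComponentIn {z | ω z = c} x, uu ω l y = uu ω l x) :
    ∃ c : E2, (l ≠ 0 → c = 0) ∧ ∀ x y, ‖x - c‖ = ‖y - c‖ → ω x = ω y := by
  by_cases hne : ∃ x, ω x ≠ 0
  swap
  · push Not at hne
    exact ⟨0, fun _ => rfl, fun x y _ => by rw [hne, hne]⟩
  obtain ⟨R0, hR0, hR⟩ := supp_bound hc
  have hl : 0 ≤ l := by
    have : ω (EuclideanSpace.single 0 (R0 + 1)) = 0 := by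
      by_contra hn
      have := hR _ hn
      rw [EuclideanSpace.norm_single, Real.norm_eq_abs, abs_of_nonneg (by linarith)] at this
      linarith
    have h2 := hpos (EuclideanSpace.single 0 (R0 + 1))
    linarith
  have S := mkSetup h hc hl hpos hne (parallel h hc (uu_contDiff h hc l) hrot)
  have hex : ∃ c : E2, (l ≠ 0 → c = 0) ∧ ∀ x, (ω x + l) * ph (uu ω l) c x = 0 := by
    rcases hl.eq_or_lt with rfl | hl'
    · obtain ⟨c, hcc⟩ := ph_zero_zero h hc S
      exact ⟨c, fun hn => absurd rfl hn, hcc⟩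
    · exact ⟨0, fun _ => rfl, ph_zero_pos h hc hl' S⟩
  obtain ⟨c, hc0, hcc⟩ := hex
  refine ⟨c, hc0, fun x y hxy => ?_⟩
  have := radial_of_rot S.hf (S.rot_f hcc) x y hxy
  simpa using this

lemma newtonConv_neg (ω : E2 → ℝ) (x : E2) : newtonConv (fun y => -ω y) x = -newtonConv ω x := by
  unfold newtonConv
  rw [← integral_neg]
  congr 1; ext y; ring

lemma final_aux {ω₀ : E2 → ℝ} {Ω : ℝ} (h : ∃ c : E2, (Ω ≠ 0 → c = 0) ∧ ∀ x y, ‖x - c‖ = ‖y - c‖ → ω₀ x = ω₀ y) :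
    (Ω ≠ 0 → ∃ g : ℝ → ℝ, ∀ x, ω₀ x = g ‖x‖) ∧
    (Ω = 0 → ∃ (a : E2) (g : ℝ → ℝ), ∀ x, ω₀ x = g ‖x - a‖) := by
  obtain ⟨c, hc, hxy⟩ := h
  have key : ∀ x, ω₀ x = (fun r : ℝ => ω₀ (c + EuclideanSpace.single 0 r)) ‖x - c‖ := by
    intro x
    apply hxy
    rw [add_sub_cancel_left, EuclideanSpace.norm_single, norm_norm]
  constructor
  · intro h0
    refine ⟨fun r : ℝ => ω₀ (c + EuclideanSpace.single 0 r), fun x => ?_⟩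
    have := key x
    rw [hc h0] at this ⊢
    rwa [sub_zero] at this
  · intro _
    exact ⟨c, fun r : ℝ => ω₀ (c + EuclideanSpace.single 0 r), key⟩

/-- Radial symmetry of a uniformly rotating smooth solution of the 2D Euler equation:
if `ω₀ ∈ C²` has compact support, the stream function `N*ω₀ + (Ω/2)|x|²` is constant on
each connected component of every regular level set of `ω₀`, and the angular velocity
satisfies `Ω ≤ (1/2) min ω₀` or `Ω ≥ (1/2) max ω₀`, then `ω₀` is radially symmetric
(up to a translation when `Ω = 0`). -/
theorem radial_symmetry_of_uniformly_rotating_smooth_solution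
    (ω₀ : E2 → ℝ) (Ω : ℝ)
    (hreg : ContDiff ℝ 2 ω₀) (hsupp : HasCompactSupport ω₀)
    -- the stream function `u = N*ω₀ + (Ω/2)|x|²` :
    (u : E2 → ℝ) (hu : u = fun x => newtonConv ω₀ x + Ω / 2 * ‖x‖ ^ 2)
    -- `u` is constant on each connected component of every regular level set of `ω₀` :
    (hrot : ∀ c : ℝ, (∀ x, ω₀ x = c → fderiv ℝ ω₀ x ≠ 0) →
      ∀ x, ω₀ x = c → ∀ y ∈ connectedComponentIn {z | ω₀ z = c} x, u y = u x)
    -- the angular velocity condition :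
    (hΩ : Ω ≤ (1 / 2) * sInf (Set.range ω₀) ∨ (1 / 2) * sSup (Set.range ω₀) ≤ Ω) :
    (Ω ≠ 0 → ∃ g : ℝ → ℝ, ∀ x, ω₀ x = g ‖x‖) ∧
    (Ω = 0 → ∃ (a : E2) (g : ℝ → ℝ), ∀ x, ω₀ x = g ‖x - a‖) := by
  apply final_aux
  have hcpt : IsCompact (range ω₀) := hsupp.isCompact_range hreg.continuous
  rcases hΩ with hΩ | hΩ
  · have hpos : ∀ x, 0 ≤ ω₀ x + (-2 * Ω) := fun x => by
      have := csInf_le hcpt.bddBelow (mem_range_self x)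
      linarith
    have he : uu ω₀ (-2 * Ω) = u := by
      rw [hu]; ext x; unfold uu; ring
    obtain ⟨c, h1, h2⟩ := core hreg hsupp hpos (by rw [he]; exact hrot)
    exact ⟨c, fun h => h1 (by simpa using h), h2⟩
  · have hpos : ∀ x, 0 ≤ (fun y => -ω₀ y) x + 2 * Ω := fun x => by
      have := le_csSup hcpt.bddAbove (mem_range_self x)
      simp only
      linarith
    have he : ∀ x, uu (fun y => -ω₀ y) (2 * Ω) x = - u x := by
      intro x
      rw [hu]; unfold uu; rw [newtonConv_neg]; ring
    obtain ⟨c, h1, h2⟩ := core (ω := fun y => -ω₀ y) hreg.neg (hsupp.comp_left (g := fun t : ℝ => -t) neg_zero) hpos (by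
      intro c hc x hx y hy
      rw [he, he, neg_inj]
      have hset : {z | -ω₀ z = c} = {z | ω₀ z = -c} := by
        ext z; simp [neg_eq_iff_eq_neg]
      rw [hset] at hy
      refine hrot (-c) (fun z hz => ?_) x (neg_eq_iff_eq_neg.mp hx) y hy
      have := hc z (by simp [hz])
      rw [fderiv_fun_neg] at this
      simpa using this)
    exact ⟨c, fun h => h1 (by simpa using h), fun x y hxy => neg_injective (h2 x y hxy)⟩
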